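/- Let g_k = e^{2u_k} g_euc be smooth conformal metrics on the unit disk D such that each (D, g_k) extends to a complete surface with uniformly bounded total absolute Gauss curvature, ∫_D |K(g_k)| dμ_{g_k} < τ ≤ ε₀, and additionally μ(D, g_k) < Λ₂. Then, after passing to a subsequence, e^{u_k} converges in L^q(D_r) for every q < 4π/τ, and for every r ∈ (0,1) and p ∈ (1,2) one of the following holds: (a) u_k converges weakly in W^{1,p}(D_r); or (b) e^{u_k} converges to 0 in L^q(D_r), and both μ(D_r, g_k) and the intrinsic diameter diam(D_r, g_k) converge to 0. Moreover, in case (b) there exist constants c_k such that u_k − c_k converges weakly in W^{1,p}(D_r). -/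

import Mathlib

open MeasureTheory Filter Metric
open scoped Topology ENNReal

noncomputable section

/-- The Laplacian of `u : ℂ → ℝ` (sum of the two pure second derivatives). -/
def lap (u : ℂ → ℝ) (x : ℂ) : ℝ :=
  iteratedFDeriv ℝ 2 u x ![1, 1] + iteratedFDeriv ℝ 2 u x ![Complex.I, Complex.I]

/-- Gauss curvature of the conformal metric `e^{2u} g_euc`: `K = -e^{-2u} Δu`. -/
def gauss (u : ℂ → ℝ) (x : ℂ) : ℝ := -Real.exp (-(2 * u x)) * lap u x

/-- Area `μ(A, g)` of a set for the metric `g = e^{2u} g_euc`. -/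
def confAreaE (u : ℂ → ℝ) (A : Set ℂ) : ℝ≥0∞ :=
  ∫⁻ x in A, ENNReal.ofReal (Real.exp (2 * u x))

/-- Total curvature `∫_A |K(g)| dμ_g` of the metric `g = e^{2u} g_euc`. -/
def curvIntE (u : ℂ → ℝ) (A : Set ℂ) : ℝ≥0∞ :=
  ∫⁻ x in A, ENNReal.ofReal (|gauss u x| * Real.exp (2 * u x))

/-- `C¹` paths from `x` to `y` staying in `S`. -/
def PathsIn (S : Set ℂ) (x y : ℂ) : Set (ℝ → ℂ) :=
  {γ | γ 0 = x ∧ γ 1 = y ∧ (∀ t ∈ Set.Icc (0:ℝ) 1, γ t ∈ S) ∧ ContDiff ℝ 1 γ}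

/-- Length of a path for the metric `e^{2u} g_euc`. -/
def confLen (u : ℂ → ℝ) (γ : ℝ → ℂ) : ℝ :=
  ∫ t in (0:ℝ)..1, Real.exp (u (γ t)) * ‖deriv γ t‖

/-- Geodesic distance (within `S`) of the conformal metric `e^{2u} g_euc`. -/
def confDist (u : ℂ → ℝ) (S : Set ℂ) (x y : ℂ) : ℝ :=
  sInf (confLen u '' PathsIn S x y)

/-- Metric ball `B_r^g(z)` of the conformal metric (within `S`). -/
def confBall (u : ℂ → ℝ) (S : Set ℂ) (z : ℂ) (r : ℝ) : Set ℂ :=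
  {x ∈ S | confDist u S z x < r}

/-- `‖f‖_{L^{2,∞}(Ω)} ≤ C`, i.e. `t·|{|f| > t}|^{1/2} ≤ C` for all `t > 0`. -/
def wL2Bound (f : ℂ → ℝ) (Ω : Set ℂ) (C : ℝ) : Prop :=
  ∀ t : ℝ, 0 < t → t * (volume {x ∈ Ω | t < |f x|}).toReal ^ ((1:ℝ)/2) ≤ C

/-- The `W^{1,p}(Ω)` norm of a differentiable function (via its classical gradient). -/
def w1pNormE (u : ℂ → ℝ) (Ω : Set ℂ) (p : ℝ) : ℝ≥0∞ :=
  (∫⁻ x in Ω, ENNReal.ofReal (|u x| ^ p)) ^ (1/p)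
    + (∫⁻ x in Ω, ENNReal.ofReal (‖fderiv ℝ u x‖ ^ p)) ^ (1/p)

/-- Real dot product on `ℂ = ℝ²`. -/
def dotC (a b : ℂ) : ℝ := a.re * b.re + a.im * b.im

/-- `V` is the distributional (weak) gradient of `u` on `Ω`. -/
def IsWeakGradOn (Ω : Set ℂ) (u : ℂ → ℝ) (V : ℂ → ℂ) : Prop :=
  ∀ φ : ℂ → ℝ, ContDiff ℝ (⊤ : ℕ∞) φ → HasCompactSupport φ → tsupport φ ⊆ Ω →
    ∀ w : ℂ, ∫ x in Ω, u x * fderiv ℝ φ x w = -∫ x in Ω, dotC (V x) w * φ x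

/-- `v k → u` weakly in `W^{1,p}(Ω)`: uniformly bounded `W^{1,p}` norms together with
convergence, tested against smooth compactly supported functions, of the functions and of
their weak gradients. -/
def WeakW1pLim (Ω : Set ℂ) (p : ℝ) (v : ℕ → ℂ → ℝ) (u : ℂ → ℝ) : Prop :=
  ∃ V : ℕ → ℂ → ℂ,
    (∀ k, IsWeakGradOn Ω (v k) (V k)) ∧
    (∃ C : ℝ, ∀ k, (∫ x in Ω, |v k x| ^ p) ^ (1/p)
        + (∫ x in Ω, ‖V k x‖ ^ p) ^ (1/p) ≤ C) ∧
    (∀ φ : ℂ → ℝ, ContDiff ℝ (⊤ : ℕ∞) φ → HasCompactSupport φ → tsupport φ ⊆ Ω →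
      Tendsto (fun k => ∫ x in Ω, v k x * φ x) atTop (𝓝 (∫ x in Ω, u x * φ x)) ∧
      ∀ w : ℂ, Tendsto (fun k => ∫ x in Ω, dotC (V k x) w * φ x) atTop
        (𝓝 (-∫ x in Ω, u x * fderiv ℝ φ x w)))

/-- Mean value of `φ` on a set. -/
def avgOn (φ : ℂ → ℝ) (A : Set ℂ) : ℝ := (volume A).toReal⁻¹ * ∫ x in A, φ x

/-- Mean oscillation of `φ` on the disk `D_t(x₀)`. -/
def meanOsc (φ : ℂ → ℝ) (x₀ : ℂ) (t : ℝ) : ℝ :=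
  avgOn (fun x => |φ x - avgOn φ (ball x₀ t)|) (ball x₀ t)

/-- The John–Nirenberg radius `ρ(φ, x₀, Ω, λ)`. -/
def jnRad (φ : ℂ → ℝ) (x₀ : ℂ) (Ω : Set ℂ) (lam : ℝ) : ℝ :=
  sSup {r : ℝ | 0 ≤ r ∧ ∀ t : ℝ, 0 < t → t < r → ball x₀ t ⊆ Ω ∧ meanOsc φ x₀ t ≤ lam}

/-- Mean value of `u` along the circle `∂D_r(0)`. -/
def circMean (u : ℂ → ℝ) (r : ℝ) : ℝ :=
  (2 * Real.pi)⁻¹ * ∫ θ in (0:ℝ)..(2 * Real.pi), u ((r : ℂ) * Complex.exp ((θ : ℂ) * Complex.I))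

/-- Completeness of the conformal metric `e^{2v} g_euc` on all of `ℂ`. -/
def ConfComplete (v : ℂ → ℝ) : Prop :=
  ∀ x : ℕ → ℂ,
    (∀ ε : ℝ, 0 < ε → ∃ N : ℕ, ∀ m ≥ N, ∀ n ≥ N, confDist v Set.univ (x m) (x n) < ε) →
    ∃ l : ℂ, Tendsto (fun n => confDist v Set.univ (x n) l) atTop (𝓝 0)

/-- `(D, g_k)` extends to a complete conformal surface with total curvature at most `Λ`. -/
def ExtendsComplete (u : ℂ → ℝ) (Λ : ℝ) : Prop :=
  ∃ v : ℂ → ℝ, ContDiff ℝ (⊤ : ℕ∞) v ∧ Set.EqOn v u (ball (0:ℂ) 1) ∧ ConfComplete v ∧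
    curvIntE v Set.univ ≤ ENNReal.ofReal Λ

/-- Gromov–Hausdorff convergence of `(S, dk k)` to `(S, d)`, phrased through
correspondences of small distortion. -/
def GHTendsto (S : Set ℂ) (dk : ℕ → ℂ → ℂ → ℝ) (d : ℂ → ℂ → ℝ) : Prop :=
  ∀ ε : ℝ, 0 < ε → ∀ᶠ k in atTop, ∃ R : Set (ℂ × ℂ),
    (∀ p ∈ R, p.1 ∈ S ∧ p.2 ∈ S) ∧
    (∀ x ∈ S, ∃ y ∈ S, (x, y) ∈ R) ∧
    (∀ y ∈ S, ∃ x ∈ S, (x, y) ∈ R) ∧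
    (∀ p ∈ R, ∀ q ∈ R, |dk k p.1 q.1 - d p.2 q.2| < ε)

/-- `−Δu = f` on `Ω` in the sense of distributions. -/
def DistribLaplaceEq (Ω : Set ℂ) (u f : ℂ → ℝ) : Prop :=
  ∀ φ : ℂ → ℝ, ContDiff ℝ (⊤ : ℕ∞) φ → HasCompactSupport φ → tsupport φ ⊆ Ω →
    -∫ x in Ω, u x * lap φ x = ∫ x in Ω, f x * φ x

lemma kint_aux (s : ℝ) (hs : s < 2) : IntegrableOn (fun x : ℂ => ‖x‖ ^ (-s)) (ball 0 1) := by
  have := (integrableOn_fun_norm_addHaar (E := ℂ) volume (f := fun t : ℝ => t ^ (-s)) (r := 1)).2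
  apply this
  rw [Complex.finrank_real_complex]
  have h2 : IntegrableOn (fun y : ℝ => y ^ (1 - s)) (Set.Ioo 0 1) := by
    rw [intervalIntegral.integrableOn_Ioo_rpow_iff (by norm_num)]
    linarith
  refine h2.congr_fun (fun y hy => ?_) measurableSet_Ioo
  have : 0 < y := hy.1
  simp only [smul_eq_mul]
  rw [show (2 - 1 : ℕ) = 1 from rfl, pow_one, sub_eq_add_neg, Real.rpow_add this, Real.rpow_one]

lemma kint (s : ℝ) (hs0 : 0 ≤ s) (hs : s < 2) (ρ : ℝ) : ∃ C : ℝ, 0 < C ∧ ∀ y : ℂ,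
    ∫⁻ x in ball (0:ℂ) ρ, ENNReal.ofReal (‖x - y‖ ^ (-s)) ≤ ENNReal.ofReal C := by
  have h1 : ∫⁻ x in ball (0:ℂ) 1, ENNReal.ofReal (‖x‖ ^ (-s)) < ⊤ := by
    have := (kint_aux s hs).hasFiniteIntegral
    rw [hasFiniteIntegral_iff_ofReal] at this
    · exact this
    · exact Eventually.of_forall fun x => by positivity
  have h2 : volume (ball (0:ℂ) ρ) < ⊤ := measure_ball_lt_top
  set A := volume (ball (0:ℂ) ρ) + ∫⁻ x in ball (0:ℂ) 1, ENNReal.ofReal (‖x‖ ^ (-s)) with hA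
  have hA' : A < ⊤ := ENNReal.add_lt_top.2 ⟨h2, h1⟩
  refine ⟨A.toReal + 1, by positivity, fun y => ?_⟩
  have h3 : A ≤ ENNReal.ofReal (A.toReal + 1) := by
    rw [ENNReal.le_ofReal_iff_toReal_le hA'.ne (by positivity)]; linarith
  refine le_trans ?_ h3
  have h4 : ∀ x : ℂ, ENNReal.ofReal (‖x - y‖ ^ (-s)) ≤
      1 + (ball y 1).indicator (fun x => ENNReal.ofReal (‖x - y‖ ^ (-s))) x := by
    intro x
    by_cases hx : x ∈ ball y 1
    · rw [Set.indicator_of_mem hx]; exact le_add_self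
    · rw [Set.indicator_of_notMem hx, add_zero]
      rw [ENNReal.ofReal_le_one]
      apply Real.rpow_le_one_of_one_le_of_nonpos
      · simpa [dist_eq_norm] using hx
      · linarith
  calc ∫⁻ x in ball (0:ℂ) ρ, ENNReal.ofReal (‖x - y‖ ^ (-s))
      ≤ ∫⁻ x in ball (0:ℂ) ρ, (1 + (ball y 1).indicator (fun x => ENNReal.ofReal (‖x - y‖ ^ (-s))) x) :=
        lintegral_mono h4
    _ = volume (ball (0:ℂ) ρ) + ∫⁻ x in ball (0:ℂ) ρ, (ball y 1).indicator (fun x => ENNReal.ofReal (‖x - y‖ ^ (-s))) x := by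
        rw [lintegral_add_left measurable_const]; simp
    _ ≤ volume (ball (0:ℂ) ρ) + ∫⁻ x, (ball y 1).indicator (fun x => ENNReal.ofReal (‖x - y‖ ^ (-s))) x := by
        gcongr; exact Measure.restrict_le_self
    _ = A := by
        rw [hA]
        congr 1
        rw [← lintegral_add_right_eq_self _ y, ← lintegral_indicator measurableSet_ball]
        congr 1; ext x
        simp only [Set.indicator, mem_ball, dist_eq_norm, add_sub_cancel_right, sub_zero]

lemma expJ {α : Type*} [MeasurableSpace α] (μ : Measure α) (δ : ℝ) (hδ : 0 < δ)
    (hμ : μ Set.univ ≤ ENNReal.ofReal δ) (g : α → ℝ) (hg : Integrable g μ) :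
    ENNReal.ofReal (Real.exp (∫ x, g x ∂μ)) ≤
      1 + ENNReal.ofReal (1 / δ) * ∫⁻ x, ENNReal.ofReal (Real.exp (δ * g x)) ∂μ := by
  haveI : IsFiniteMeasure μ := ⟨hμ.trans_lt ENNReal.ofReal_lt_top⟩
  by_cases htop : ∫⁻ x, ENNReal.ofReal (Real.exp (δ * g x)) ∂μ = ⊤
  · rw [htop, ENNReal.mul_top (by simpa using hδ)]; simp
  have hme : AEStronglyMeasurable (fun x => Real.exp (δ * g x)) μ :=
    Real.continuous_exp.comp_aestronglyMeasurable (hg.aestronglyMeasurable.const_mul δ)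
  have hi : Integrable (fun x => Real.exp (δ * g x)) μ := by
    refine ⟨hme, ?_⟩
    rw [hasFiniteIntegral_iff_ofReal (Eventually.of_forall fun x => (Real.exp_pos _).le)]
    exact lt_top_iff_ne_top.2 htop
  rw [← ofReal_integral_eq_lintegral_ofReal hi (Eventually.of_forall fun x => (Real.exp_pos _).le),
    ← ENNReal.ofReal_mul (by positivity), ← ENNReal.ofReal_one,
    ← ENNReal.ofReal_add zero_le_one (mul_nonneg (by positivity) (integral_nonneg fun x => (Real.exp_pos _).le))]
  apply ENNReal.ofReal_le_ofReal
  set A := ∫ x, g x ∂μ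
  have h1 : ∫ x, Real.exp A * (1 + δ * g x - A) ∂μ ≤ ∫ x, Real.exp (δ * g x) ∂μ := by
    apply integral_mono _ hi
    · intro x
      have := Real.add_one_le_exp (δ * g x - A)
      have h2 : Real.exp (δ * g x) = Real.exp A * Real.exp (δ * g x - A) := by
        rw [← Real.exp_add]; ring_nf
      dsimp only
      rw [h2]
      exact mul_le_mul_of_nonneg_left (by linarith) (Real.exp_pos _).le
    · exact (((integrable_const (1:ℝ)).add (hg.const_mul δ)).sub (integrable_const A)).const_mul _
  rw [integral_const_mul] at h1
  have h3 : ∫ x, (1 + δ * g x - A) ∂μ = (1 - A) * μ.real Set.univ + δ * A := by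
    have h4 : ∀ x, (1 + δ * g x - A) = (1 - A) + δ * g x := fun x => by ring
    simp_rw [h4]
    rw [integral_add (integrable_const _) (hg.const_mul δ), integral_const, integral_const_mul]
    simp only [smul_eq_mul]; ring
  rw [h3] at h1
  have hm : μ.real Set.univ ≤ δ := by
    unfold Measure.real; exact ENNReal.toReal_le_of_le_ofReal hδ.le hμ
  have hm0 : 0 ≤ μ.real Set.univ := measureReal_nonneg
  have h5 : (1 - A) * Real.exp A ≤ 1 := by
    have := Real.add_one_le_exp (-A)
    calc (1 - A) * Real.exp A ≤ Real.exp (-A) * Real.exp A :=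
          mul_le_mul_of_nonneg_right (by linarith) (Real.exp_pos _).le
      _ = 1 := by rw [← Real.exp_add]; simp
  have h6 : Real.exp A * δ ≤ δ + ∫ x, Real.exp (δ * g x) ∂μ := by
    nlinarith [mul_le_mul_of_nonneg_left h5 (sub_nonneg.2 hm)]
  have : Real.exp A ≤ (δ + ∫ x, Real.exp (δ * g x) ∂μ) / δ := by
    rw [le_div_iff₀ hδ]; exact h6
  rw [add_div, div_self hδ.ne'] at this
  rw [one_div, inv_mul_eq_div]; exact this

/-- regularised logarithm -/
def Lr (ε : ℝ) (y : ℂ) : ℝ := 1 / 2 * Real.log (‖y‖ ^ 2 + ε ^ 2)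

lemma normsq_eq (y : ℂ) : ‖y‖ ^ 2 = y.re ^ 2 + y.im ^ 2 := by
  rw [← Complex.normSq_eq_norm_sq, Complex.normSq_apply]; ring

lemma dotC_le (a b : ℂ) : |dotC a b| ≤ ‖a‖ * ‖b‖ := by
  apply abs_le_of_sq_le_sq _ (by positivity)
  rw [mul_pow, normsq_eq, normsq_eq]; unfold dotC
  nlinarith [sq_nonneg (a.re * b.im - a.im * b.re)]

lemma Lr_sub (ε : ℝ) (hε : 0 < ε) (z : ℂ) (hz : z ≠ 0) :
    |Lr ε z - Real.log ‖z‖| ≤ ε * ‖z‖⁻¹ := by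
  have hz' : 0 < ‖z‖ := norm_pos_iff.2 hz
  have h1 : Lr ε z - Real.log ‖z‖ = 1 / 2 * Real.log (1 + (ε * ‖z‖⁻¹) ^ 2) := by
    have : ‖z‖ ^ 2 + ε ^ 2 = ‖z‖ ^ 2 * (1 + (ε * ‖z‖⁻¹) ^ 2) := by field_simp
    unfold Lr
    rw [this, Real.log_mul (by positivity) (by positivity), Real.log_pow]; push_cast; ring
  rw [h1]
  set t := ε * ‖z‖⁻¹
  have ht : 0 ≤ t := by positivity
  have h2 : 0 ≤ Real.log (1 + t ^ 2) := Real.log_nonneg (by nlinarith)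
  rw [abs_of_nonneg (by positivity)]
  have h3 : Real.log (1 + t ^ 2) ≤ Real.log ((1 + t) ^ 2) :=
    Real.log_le_log (by positivity) (by nlinarith)
  rw [Real.log_pow] at h3
  have h4 : Real.log (1 + t) ≤ t := by
    have := Real.log_le_sub_one_of_pos (show 0 < 1 + t by positivity); linarith
  push_cast at h3; linarith

lemma hasFDerivAt_nsq (y : ℂ) : HasFDerivAt (fun y : ℂ => ‖y‖ ^ 2)
    ((2 * y.re) • Complex.reCLM + (2 * y.im) • Complex.imCLM) y := by
  have h1 : HasFDerivAt (fun y : ℂ => y.re) Complex.reCLM y := Complex.reCLM.hasFDerivAt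
  have h2 : HasFDerivAt (fun y : ℂ => y.im) Complex.imCLM y := Complex.imCLM.hasFDerivAt
  have := (h1.pow 2).add (h2.pow 2)
  refine (this.congr_fderiv ?_).congr_of_eventuallyEq (Eventually.of_forall fun z => normsq_eq z)
  ext <;> simp

lemma Lr_fderiv (ε : ℝ) (hε : 0 < ε) (w y : ℂ) :
    fderiv ℝ (Lr ε) y w = dotC y w * (‖y‖ ^ 2 + ε ^ 2)⁻¹ := by
  have h := (((hasFDerivAt_nsq y).add_const (ε ^ 2)).log (by positivity)).const_mul (1 / 2)
  have : fderiv ℝ (Lr ε) y = _ := h.fderiv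
  rw [this]
  simp [dotC]; ring

lemma Lr_contDiff (ε : ℝ) (hε : 0 < ε) : ContDiff ℝ (⊤ : ℕ∞) (Lr ε) := by
  unfold Lr
  apply ContDiff.mul contDiff_const
  apply ContDiff.log
  · exact (contDiff_norm_sq ℝ).add contDiff_const
  · intro x; positivity

lemma Lr_fderiv2 (ε : ℝ) (hε : 0 < ε) (w y : ℂ) :
    fderiv ℝ (fun y => fderiv ℝ (Lr ε) y w) y w =
      ‖w‖ ^ 2 * (‖y‖ ^ 2 + ε ^ 2)⁻¹ - 2 * dotC y w ^ 2 * ((‖y‖ ^ 2 + ε ^ 2)⁻¹) ^ 2 := by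
  simp_rw [Lr_fderiv ε hε w]
  have h1 : HasFDerivAt (fun y : ℂ => y.re) Complex.reCLM y := Complex.reCLM.hasFDerivAt
  have h2 : HasFDerivAt (fun y : ℂ => y.im) Complex.imCLM y := Complex.imCLM.hasFDerivAt
  have h3 : HasFDerivAt (fun y : ℂ => dotC y w) (w.re • Complex.reCLM + w.im • Complex.imCLM) y := by
    unfold dotC
    exact (h1.mul_const w.re).add (h2.mul_const w.im)
  have hp : ‖y‖ ^ 2 + ε ^ 2 ≠ 0 := by positivity
  have h4 := ((hasFDerivAt_nsq y).add_const (ε ^ 2))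
  have h5 := (hasDerivAt_inv hp).comp_hasFDerivAt y h4
  have h6 := h3.mul h5
  rw [show (fun y => dotC y w * (‖y‖ ^ 2 + ε ^ 2)⁻¹) = ((fun y => dotC y w) * ((fun x : ℝ => x⁻¹) ∘ fun y : ℂ => ‖y‖ ^ 2 + ε ^ 2)) from rfl, h6.fderiv]
  simp [dotC]
  rw [normsq_eq w]; ring

lemma lap_eq (u : ℂ → ℝ) (hu : ContDiff ℝ 2 u) (x : ℂ) : lap u x =
    fderiv ℝ (fun y => fderiv ℝ u y 1) x 1 +
    fderiv ℝ (fun y => fderiv ℝ u y Complex.I) x Complex.I := by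
  have hd : DifferentiableAt ℝ (fderiv ℝ u) x :=
    ((hu.fderiv_right (m := 1) (by norm_num)).differentiable (by norm_num)) x
  have h : ∀ w : ℂ, fderiv ℝ (fun y => fderiv ℝ u y w) x w = fderiv ℝ (fderiv ℝ u) x w w := by
    intro w
    rw [fderiv_clm_apply hd (by fun_prop)]
    simp
  unfold lap
  rw [iteratedFDeriv_two_apply, iteratedFDeriv_two_apply, h, h]
  simp

lemma Lr_lap (ε : ℝ) (hε : 0 < ε) (y : ℂ) :
    lap (Lr ε) y = 2 * ε ^ 2 * ((‖y‖ ^ 2 + ε ^ 2)⁻¹) ^ 2 := by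
  rw [lap_eq _ ((Lr_contDiff ε hε).of_le (WithTop.coe_le_coe.2 (le_top : (2:ℕ∞) ≤ ⊤))), Lr_fderiv2 ε hε, Lr_fderiv2 ε hε]
  have hp : ‖y‖ ^ 2 + ε ^ 2 ≠ 0 := by positivity
  have h7 : ‖y‖ ^ 2 = y.re ^ 2 + y.im ^ 2 := normsq_eq y
  simp [dotC]
  field_simp
  rw [h7]; ring

lemma ibp (f g : ℂ → ℝ) (hf : ContDiff ℝ 1 f) (hg : ContDiff ℝ 1 g) (hgs : HasCompactSupport g) (w : ℂ) :
    ∫ x, f x * fderiv ℝ g x w = - ∫ x, fderiv ℝ f x w * g x := by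
  have hf' : Continuous (fun x => fderiv ℝ f x w) := by
    have := hf.continuous_fderiv (by norm_num); fun_prop
  have hg' : Continuous (fun x => fderiv ℝ g x w) := by
    have := hg.continuous_fderiv (by norm_num); fun_prop
  have hgs' : HasCompactSupport (fun x => fderiv ℝ g x w) := hgs.fderiv_apply ℝ w
  apply integral_mul_fderiv_eq_neg_fderiv_mul_of_integrable
  · exact (hf'.mul hg.continuous).integrable_of_hasCompactSupport hgs.mul_left
  · exact (hf.continuous.mul hg').integrable_of_hasCompactSupport hgs'.mul_left
  · exact (hf.continuous.mul hg.continuous).integrable_of_hasCompactSupport hgs.mul_left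
  · intro x _; exact hf.differentiable (by norm_num) x
  · intro x _; exact hg.differentiable (by norm_num) x

lemma contDiff_dir {n : ℕ∞} (f : ℂ → ℝ) (hf : ContDiff ℝ (n + 1) f) (w : ℂ) : ContDiff ℝ n (fun x => fderiv ℝ f x w) :=
  (hf.fderiv_right le_rfl).clm_apply contDiff_const

lemma ibp_lap (f g : ℂ → ℝ) (hf : ContDiff ℝ 2 f) (hg : ContDiff ℝ 2 g) (hgs : HasCompactSupport g) :
    ∫ x, f x * lap g x = ∫ x, lap f x * g x := by
  have key : ∀ w : ℂ, ∫ x, f x * fderiv ℝ (fun y => fderiv ℝ g y w) x w =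
      ∫ x, fderiv ℝ (fun y => fderiv ℝ f y w) x w * g x := by
    intro w
    rw [ibp f _ (hf.of_le (by norm_num)) (contDiff_dir (n := 1) g hg w) (hgs.fderiv_apply ℝ w),
      ibp _ g (contDiff_dir (n := 1) f hf w) (hg.of_le (by norm_num)) hgs, neg_neg]
  have hc : ∀ (u : ℂ → ℝ) (_ : ContDiff ℝ 2 u) (w : ℂ), Continuous fun x => fderiv ℝ (fun y => fderiv ℝ u y w) x w := by
    intro u hu w
    exact (contDiff_dir (n := 0) _ (contDiff_dir (n := 1) u hu w) w).continuous
  have h2 : ∀ w : ℂ, HasCompactSupport (fun x => fderiv ℝ (fun y => fderiv ℝ g y w) x w) :=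
    fun w => (hgs.fderiv_apply ℝ w).fderiv_apply ℝ w
  simp_rw [lap_eq f hf, lap_eq g hg, mul_add, add_mul]
  rw [integral_add, integral_add, key, key]
  · exact ((hc f hf 1).mul hg.continuous).integrable_of_hasCompactSupport hgs.mul_left
  · exact ((hc f hf _).mul hg.continuous).integrable_of_hasCompactSupport hgs.mul_left
  · exact (hf.continuous.mul (hc g hg 1)).integrable_of_hasCompactSupport (h2 _).mul_left
  · exact (hf.continuous.mul (hc g hg _)).integrable_of_hasCompactSupport (h2 _).mul_left

lemma lap_cont (u : ℂ → ℝ) (hu : ContDiff ℝ 2 u) : Continuous (lap u) := by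
  have hc : ∀ (w : ℂ), Continuous fun x => fderiv ℝ (fun y => fderiv ℝ u y w) x w := by
    intro w
    exact (contDiff_dir (n := 0) _ (contDiff_dir (n := 1) u hu w) w).continuous
  rw [funext (lap_eq u hu)]
  exact (hc _).add (hc _)

lemma lap_supp (u : ℂ → ℝ) (hu : ContDiff ℝ 2 u) (hs : HasCompactSupport u) : HasCompactSupport (lap u) := by
  rw [funext (lap_eq u hu)]
  exact ((hs.fderiv_apply ℝ _).fderiv_apply ℝ _).add ((hs.fderiv_apply ℝ _).fderiv_apply ℝ _)

lemma radial_total : Integrable (fun z : ℂ => 2 * ((‖z‖ ^ 2 + 1)⁻¹) ^ 2) ∧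
    ∫ z : ℂ, 2 * ((‖z‖ ^ 2 + 1)⁻¹) ^ 2 = 2 * Real.pi := by
  have hd : ∀ x ∈ Set.Ici (0:ℝ), HasDerivAt (fun x : ℝ => -(x ^ 2 + 1)⁻¹) (2 * x * ((x ^ 2 + 1)⁻¹) ^ 2) x := by
    intro x _
    have h : HasDerivAt (fun x : ℝ => x ^ 2 + 1) (2 * x) x := by
      simpa using (hasDerivAt_pow 2 x).add_const 1
    have := (h.inv (by positivity)).neg
    refine this.congr_deriv ?_
    rw [inv_pow]; ring
  have ht : Tendsto (fun x : ℝ => -(x ^ 2 + 1)⁻¹) atTop (𝓝 0) := by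
    have h1 : Tendsto (fun x : ℝ => x ^ 2 + 1) atTop atTop :=
      tendsto_atTop_add_const_right _ _ (tendsto_pow_atTop (by norm_num))
    simpa using h1.inv_tendsto_atTop.neg
  have hp : ∀ x ∈ Set.Ioi (0:ℝ), 0 ≤ 2 * x * ((x ^ 2 + 1)⁻¹) ^ 2 := by
    intro x hx; have : 0 < x := hx; positivity
  have hi := integrableOn_Ioi_deriv_of_nonneg' hd hp ht
  have hv := integral_Ioi_of_hasDerivAt_of_nonneg' hd hp ht
  constructor
  · apply (integrable_fun_norm_addHaar (E := ℂ) volume (f := fun t : ℝ => 2 * ((t ^ 2 + 1)⁻¹) ^ 2)).2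
    rw [Complex.finrank_real_complex]
    refine hi.congr_fun (fun y hy => ?_) measurableSet_Ioi
    simp only [smul_eq_mul]
    rw [show (2 - 1 : ℕ) = 1 from rfl, pow_one]; ring
  · rw [integral_fun_norm_addHaar (E := ℂ) volume (f := fun t : ℝ => 2 * ((t ^ 2 + 1)⁻¹) ^ 2)]
    rw [Complex.finrank_real_complex]
    have : ∫ y in Set.Ioi (0:ℝ), y ^ (2 - 1) • (2 * ((y ^ 2 + 1)⁻¹) ^ 2) = 1 := by
      refine Eq.trans ?_ (hv.trans (by norm_num))
      congr 1; ext y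
      simp only [smul_eq_mul]
      rw [show (2 - 1 : ℕ) = 1 from rfl, pow_one]; ring
    rw [this]
    simp [Measure.real]

lemma inv_integrable_ball (x : ℂ) (ρ : ℝ) : IntegrableOn (fun y : ℂ => ‖x - y‖⁻¹) (ball 0 ρ) := by
  obtain ⟨C, _, hC⟩ := kint 1 (by norm_num) (by norm_num) ρ
  refine ⟨by fun_prop, ?_⟩
  rw [hasFiniteIntegral_iff_ofReal (Eventually.of_forall fun y => by positivity)]
  refine lt_of_le_of_lt (le_trans (le_of_eq ?_) (hC x)) ENNReal.ofReal_lt_top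
  congr 1; ext y
  rw [Real.rpow_neg_one, norm_sub_rev]

lemma inv_mul_integrable (x : ℂ) (ω : ℂ → ℝ) (hc : Continuous ω) (hi : Integrable ω) :
    Integrable (fun y : ℂ => ‖x - y‖⁻¹ * |ω y|) := by
  obtain ⟨C, hC⟩ := (isCompact_closedBall (0:ℂ) (‖x‖ + 1)).exists_bound_of_continuousOn hc.continuousOn
  have h1 := ((inv_integrable_ball x (‖x‖ + 1)).integrable_indicator measurableSet_ball).const_mul C
  refine (h1.add hi.norm).mono' (by fun_prop) (Eventually.of_forall fun y => ?_)
  simp only [Pi.add_apply, norm_mul, norm_inv, norm_norm, Real.norm_eq_abs, abs_abs, abs_norm]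
  by_cases hy : y ∈ ball (0:ℂ) (‖x‖ + 1)
  · rw [Set.indicator_of_mem hy]
    have := hC y (ball_subset_closedBall hy)
    rw [Real.norm_eq_abs] at this
    have h3 : ‖x - y‖⁻¹ * |ω y| ≤ ‖x - y‖⁻¹ * C := by gcongr
    nlinarith [abs_nonneg (ω y)]
  · rw [Set.indicator_of_notMem hy]
    simp only [mem_ball_zero_iff, not_lt] at hy
    have : 1 ≤ ‖x - y‖ := by
      have := norm_sub_norm_le y x; rw [norm_sub_rev] at this; linarith
    have h4 : ‖x - y‖⁻¹ ≤ 1 := inv_le_one_of_one_le₀ this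
    nlinarith [abs_nonneg (ω y)]

/-- the kernel -/
def kk (x y : ℂ) : ℝ := Real.log ‖x - y‖ - Real.log (1 + ‖y‖)

lemma kk_le (x y : ℂ) : kk x y ≤ Real.log (1 + ‖x‖) := by
  unfold kk
  by_cases h : x = y
  · simp only [h, sub_self, norm_zero, Real.log_zero]
    have := Real.log_nonneg (show 1 ≤ 1 + ‖y‖ by linarith [norm_nonneg y]); linarith
  · have hz' : 0 < ‖x - y‖ := norm_pos_iff.2 (sub_ne_zero.2 h)
    rw [sub_le_iff_le_add, ← Real.log_mul (by positivity) (by positivity)]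
    apply Real.log_le_log hz'
    have := norm_sub_le x y
    nlinarith [norm_nonneg x, norm_nonneg y]

lemma kk_ge (x y : ℂ) (h : x ≠ y) : -kk x y ≤ Real.log (1 + (1 + ‖x‖) * ‖x - y‖⁻¹) := by
  unfold kk
  have hz' : 0 < ‖x - y‖ := norm_pos_iff.2 (sub_ne_zero.2 h)
  rw [neg_sub, ← Real.log_div (by positivity) (by positivity)]
  apply Real.log_le_log (by positivity)
  rw [div_le_iff₀ hz']
  have : ‖y‖ ≤ ‖x‖ + ‖x - y‖ := by
    have := norm_sub_norm_le y x; rw [norm_sub_rev] at this; linarith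
  field_simp
  nlinarith

lemma kk_abs (x y : ℂ) (h : x ≠ y) : |kk x y| ≤ (1 + ‖x‖) * (1 + ‖x - y‖⁻¹) := by
  have hz' : 0 < ‖x - y‖ := norm_pos_iff.2 (sub_ne_zero.2 h)
  have h1 := kk_le x y
  have h2 := kk_ge x y h
  have h3 := Real.log_le_sub_one_of_pos (show 0 < 1 + ‖x‖ by positivity)
  have h4 := Real.log_le_sub_one_of_pos (show 0 < 1 + (1 + ‖x‖) * ‖x - y‖⁻¹ by positivity)
  have h5 : 0 < ‖x - y‖⁻¹ := by positivity
  have h6 : 0 ≤ ‖x‖ * ‖x - y‖⁻¹ := by positivity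
  rw [abs_le]; constructor <;> nlinarith [norm_nonneg x]

lemma ae_ne_c (x : ℂ) : ∀ᵐ y : ℂ, x ≠ y := by
  have : ∀ᵐ y : ℂ, y ∈ ({x}ᶜ : Set ℂ) := compl_mem_ae_iff.2 (by simp)
  filter_upwards [this] with y hy using fun h => hy (by simp [h])

lemma kk_meas : Measurable (fun p : ℂ × ℂ => kk p.1 p.2) := by unfold kk; fun_prop

lemma kk_integrable (x : ℂ) (ω : ℂ → ℝ) (hc : Continuous ω) (hi : Integrable ω) :
    Integrable (fun y : ℂ => kk x y * ω y) := by
  have h1 := (hi.norm.add (inv_mul_integrable x ω hc hi)).const_mul (1 + ‖x‖)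
  refine h1.mono' ?_ ?_
  · have := kk_meas.comp (measurable_prodMk_left (x := x))
    exact (this.aestronglyMeasurable.mul hc.aestronglyMeasurable)
  · filter_upwards [ae_ne_c x] with y hy
    rw [norm_mul, Real.norm_eq_abs, Real.norm_eq_abs]
    have := kk_abs x y hy
    simp only [Pi.add_apply, Real.norm_eq_abs]
    calc |kk x y| * |ω y| ≤ ((1 + ‖x‖) * (1 + ‖x - y‖⁻¹)) * |ω y| := by gcongr
      _ = _ := by ring

lemma log_integrable (x : ℂ) (ψ : ℂ → ℝ) (hc : Continuous ψ) (hs : HasCompactSupport ψ) :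
    Integrable (fun y : ℂ => Real.log ‖x - y‖ * ψ y) := by
  have h1 := kk_integrable x ψ hc (hc.integrable_of_hasCompactSupport hs)
  have h2 : Integrable (fun y : ℂ => Real.log (1 + ‖y‖) * ψ y) := by
    apply Continuous.integrable_of_hasCompactSupport _ hs.mul_left
    apply Continuous.mul _ hc
    apply Continuous.log (by fun_prop)
    intro y; positivity
  refine (h1.add h2).congr (Eventually.of_forall fun y => ?_)
  simp only [Pi.add_apply, kk]; ring

lemma fund0 (ψ : ℂ → ℝ) (hψ : ContDiff ℝ 2 ψ) (hs : HasCompactSupport ψ) :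
    ∫ y, Real.log ‖y‖ * lap ψ y = 2 * Real.pi * ψ 0 := by
  set e : ℕ → ℝ := fun n => 1 / ((n:ℝ) + 1) with he
  have hep : ∀ n, 0 < e n := fun n => by positivity
  have het : Tendsto e atTop (𝓝 0) := tendsto_one_div_add_atTop_nhds_zero_nat
  have hlc := lap_cont ψ hψ
  have hls := lap_supp ψ hψ hs
  have hLi : Integrable (fun y : ℂ => Real.log ‖y‖ * lap ψ y) := by
    simpa using log_integrable 0 (lap ψ) hlc hls
  have hII : Integrable (fun y : ℂ => ‖y‖⁻¹ * |lap ψ y|) := by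
    simpa using inv_mul_integrable 0 (lap ψ) hlc (hlc.integrable_of_hasCompactSupport hls)
  have hLe : ∀ n, Integrable (fun y : ℂ => Lr (e n) y * lap ψ y) := fun n =>
    ((Lr_contDiff _ (hep n)).continuous.mul hlc).integrable_of_hasCompactSupport hls.mul_left
  have hA : Tendsto (fun n => ∫ y, Lr (e n) y * lap ψ y) atTop (𝓝 (∫ y, Real.log ‖y‖ * lap ψ y)) := by
    rw [tendsto_iff_norm_sub_tendsto_zero]
    have h0 : Tendsto (fun n => e n * ∫ y : ℂ, ‖y‖⁻¹ * |lap ψ y|) atTop (𝓝 0) := by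
      simpa using het.mul_const (∫ y : ℂ, ‖y‖⁻¹ * |lap ψ y|)
    refine squeeze_zero (fun n => norm_nonneg _) (fun n => ?_) h0
    rw [← integral_sub (hLe n) hLi, ← integral_const_mul]
    refine norm_integral_le_of_norm_le (hII.const_mul _) ?_
    filter_upwards [ae_ne_c 0] with y hy
    rw [← sub_mul, norm_mul, Real.norm_eq_abs, Real.norm_eq_abs, ← mul_assoc]
    gcongr
    exact Lr_sub _ (hep n) y hy.symm
  have hB : ∀ n, ∫ y, Lr (e n) y * lap ψ y = ∫ z : ℂ, (2 * ((‖z‖ ^ 2 + 1)⁻¹) ^ 2) * ψ (e n • z) := by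
    intro n
    rw [ibp_lap _ ψ ((Lr_contDiff _ (hep n)).of_le (WithTop.coe_le_coe.2 (le_top : (2:ℕ∞) ≤ ⊤))) hψ hs]
    have h1 := Measure.integral_comp_smul (volume : Measure ℂ) (fun y => lap (Lr (e n)) y * ψ y) (e n)
    rw [Complex.finrank_real_complex] at h1
    have h2 : ∫ y, lap (Lr (e n)) y * ψ y = (e n) ^ 2 * ∫ z : ℂ, lap (Lr (e n)) (e n • z) * ψ (e n • z) := by
      rw [h1, abs_of_pos (by have := hep n; positivity), smul_eq_mul, mul_inv_cancel_left₀ (by have := hep n; positivity)]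
    rw [h2, ← integral_const_mul]
    congr 1; ext z
    rw [Lr_lap _ (hep n), norm_smul, Real.norm_eq_abs, abs_of_pos (hep n)]
    have := hep n
    have h4 : ‖z‖ ^ 2 + 1 ≠ 0 := by positivity
    have h3 : (e n * ‖z‖) ^ 2 + e n ^ 2 = e n ^ 2 * (‖z‖ ^ 2 + 1) := by ring
    rw [h3]
    field_simp
  obtain ⟨M, hM⟩ := hs.exists_bound_of_continuous hψ.continuous
  have hC : Tendsto (fun n => ∫ z : ℂ, (2 * ((‖z‖ ^ 2 + 1)⁻¹) ^ 2) * ψ (e n • z)) atTop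
      (𝓝 (∫ z : ℂ, (2 * ((‖z‖ ^ 2 + 1)⁻¹) ^ 2) * ψ 0)) := by
    refine tendsto_integral_of_dominated_convergence (fun z => (2 * ((‖z‖ ^ 2 + 1)⁻¹) ^ 2) * M) ?_ ?_ ?_ ?_
    · intro n
      apply Continuous.aestronglyMeasurable
      apply Continuous.mul
      · apply Continuous.mul continuous_const
        apply Continuous.pow
        apply Continuous.inv₀ (by fun_prop)
        intro x; positivity
      · exact hψ.continuous.comp (by fun_prop)
    · exact radial_total.1.mul_const M
    · intro n
      refine Eventually.of_forall fun z => ?_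
      rw [norm_mul, Real.norm_of_nonneg (by positivity)]
      gcongr
      exact hM _
    · refine Eventually.of_forall fun z => ?_
      apply Tendsto.const_mul
      have : Tendsto (fun n => e n • z) atTop (𝓝 0) := by simpa using het.smul_const z
      exact (hψ.continuous.tendsto 0).comp this
  rw [integral_mul_const, radial_total.2] at hC
  simp_rw [hB] at hA
  exact tendsto_nhds_unique hA hC

lemma fund (ψ : ℂ → ℝ) (hψ : ContDiff ℝ 2 ψ) (hs : HasCompactSupport ψ) (x : ℂ) :
    ∫ y, Real.log ‖x - y‖ * lap ψ y = 2 * Real.pi * ψ x := by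
  have h := fund0 (fun z => ψ (x + z)) (hψ.comp (by fun_prop)) (hs.comp_homeomorph (Homeomorph.addLeft x))
  rw [add_zero] at h
  rw [← h, ← integral_add_left_eq_self _ x]
  congr 1; ext y
  rw [show x - (x + y) = -y by ring, norm_neg]
  congr 1
  unfold lap
  rw [iteratedFDeriv_comp_add_left]

def Np (ω : ℂ → ℝ) (x : ℂ) : ℝ := (2 * Real.pi)⁻¹ * ∫ y, kk x y * ω y

lemma lap_congr {f g : ℂ → ℝ} {x : ℂ} (h : f =ᶠ[𝓝 x] g) : lap f x = lap g x := by
  unfold lap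
  rw [(Filter.EventuallyEq.iteratedFDeriv ℝ h 2).eq_of_nhds]

lemma holo_pot (e : ℂ → ℝ) (hi : Integrable e) (hm : Measurable e) (ρ : ℝ) (hρ : 0 < ρ)
    (h0 : ∀ y, ‖y‖ < 2 * ρ → e y = 0) :
    DifferentiableOn ℂ (fun x => ∫ y, Complex.log (1 - x / y) * (e y : ℂ)) (ball 0 ρ) := by
  intro x₀ hx₀
  have hi' : Integrable (fun y => (e y : ℂ)) := hi.ofReal
  have hmc : Measurable (fun y => (e y : ℂ)) := Complex.measurable_ofReal.comp hm
  have hhalf : ∀ x ∈ ball (0:ℂ) ρ, ∀ y : ℂ, 2 * ρ ≤ ‖y‖ → ‖x / y‖ ≤ 1 / 2 := by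
    intro x hx y hy
    rw [mem_ball_zero_iff] at hx
    rw [norm_div, div_le_iff₀ (by linarith)]; linarith
  have hslit : ∀ x ∈ ball (0:ℂ) ρ, ∀ y : ℂ, 2 * ρ ≤ ‖y‖ → 1 - x / y ∈ Complex.slitPlane := by
    intro x hx y hy
    left
    have := (Complex.re_le_norm (x / y)).trans (hhalf x hx y hy)
    simp only [Complex.sub_re, Complex.one_re]; linarith
  have hmeas : ∀ x : ℂ, Measurable (fun y => Complex.log (1 - x / y) * (e y : ℂ)) := fun x =>
    (Complex.measurable_log.comp (by fun_prop)).mul hmc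
  have key := hasDerivAt_integral_of_dominated_loc_of_deriv_le (μ := (volume : Measure ℂ)) (𝕜 := ℂ)
    (F := fun x y => Complex.log (1 - x / y) * (e y : ℂ))
    (F' := fun x y => (-(1 / y) / (1 - x / y)) * (e y : ℂ)) (x₀ := x₀) (s := ball 0 ρ)
    (bound := fun y => (1 / ρ) * |e y|)
    (isOpen_ball.mem_nhds hx₀) (Eventually.of_forall fun x => (hmeas x).aestronglyMeasurable) ?_ ?_ ?_
    (hi.norm.const_mul _) ?_
  · exact key.2.differentiableAt.differentiableWithinAt
  · refine (hi'.norm.const_mul 4).mono' (hmeas x₀).aestronglyMeasurable (Eventually.of_forall fun y => ?_)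
    rw [norm_mul]
    rcases lt_or_ge ‖y‖ (2 * ρ) with h | h
    · simp [h0 y h]
    · gcongr
      have h1 := hhalf x₀ hx₀ y h
      have h2 := Complex.norm_log_one_add_half_le_self (z := -(x₀ / y)) (by simpa using h1)
      rw [← sub_eq_add_neg, norm_neg] at h2
      linarith
  · exact ((by fun_prop : Measurable (fun y : ℂ => -(1 / y) / (1 - x₀ / y))).mul hmc).aestronglyMeasurable
  · refine Eventually.of_forall fun y x hx => ?_
    rw [norm_mul, Complex.norm_real, Real.norm_eq_abs]
    rcases lt_or_ge ‖y‖ (2 * ρ) with h | h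
    · simp [h0 y h]
    · gcongr
      have h1 := hhalf x hx y h
      have hy : 0 < ‖y‖ := by linarith
      rw [norm_div, norm_neg, norm_div, norm_one]
      have h2 : 1 / 2 ≤ ‖1 - x / y‖ := by
        have := norm_sub_norm_le (1:ℂ) (x / y); rw [norm_one] at this; linarith
      rw [div_div, div_le_div_iff₀ (by positivity) hρ]
      nlinarith
  · refine Eventually.of_forall fun y x hx => ?_
    rcases lt_or_ge ‖y‖ (2 * ρ) with h | h
    · simp only [h0 y h, Complex.ofReal_zero, mul_zero]; exact hasDerivAt_const _ _
    · apply HasDerivAt.mul_const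
      have h9 : HasDerivAt (fun x : ℂ => 1 - x / y) (-(1 / y)) x := ((hasDerivAt_id x).div_const y).const_sub 1
      exact h9.clog (hslit x hx y h)

lemma repr_loc (v : ℂ → ℝ) (hv : ContDiff ℝ (⊤ : ℕ∞) v) (hω : Integrable (lap v)) (ρ : ℝ) (hρ : 0 < ρ) :
    ∃ G : ℂ → ℂ, DifferentiableOn ℂ G (ball 0 ρ) ∧ ∀ x ∈ ball (0:ℂ) ρ, v x - Np (lap v) x = (G x).re := by
  have h2le : (2 : WithTop ℕ∞) ≤ ((⊤ : ℕ∞) : WithTop ℕ∞) := WithTop.coe_le_coe.2 (le_top : (2:ℕ∞) ≤ ⊤)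
  have hv2 : ContDiff ℝ 2 v := hv.of_le h2le
  let χ : ContDiffBump (0:ℂ) := ⟨2 * ρ, 3 * ρ, by linarith, by linarith⟩
  set ψ : ℂ → ℝ := fun x => χ x * v x with hψ
  have hψc : ContDiff ℝ 2 ψ := χ.contDiff.mul hv2
  have hψs : HasCompactSupport ψ := χ.hasCompactSupport.mul_right
  have hψi : Integrable (lap ψ) := (lap_cont ψ hψc).integrable_of_hasCompactSupport (lap_supp ψ hψc hψs)
  set e : ℂ → ℝ := fun y => lap ψ y - lap v y with he
  have hei : Integrable e := hψi.sub hω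
  have hem : Measurable e := ((lap_cont ψ hψc).sub (lap_cont v hv2)).measurable
  have h1 : ∀ y, ‖y‖ < 2 * ρ → ψ y = v y := by
    intro y hy
    simp only [hψ]
    rw [χ.one_of_mem_closedBall (by simpa using hy.le), one_mul]
  have h0 : ∀ y, ‖y‖ < 2 * ρ → e y = 0 := by
    intro y hy
    have : ψ =ᶠ[𝓝 y] v := by
      filter_upwards [isOpen_ball.mem_nhds (show y ∈ ball (0:ℂ) (2 * ρ) by simpa using hy)] with z hz
      exact h1 z (by simpa using hz)
    simp only [he, lap_congr this, sub_self]
  have hpi : 0 < 2 * Real.pi := by positivity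
  have hrep : ∀ x ∈ ball (0:ℂ) ρ, v x - Np (lap v) x =
      (2 * Real.pi)⁻¹ * ∫ y, (Real.log ‖x - y‖ * lap ψ y - kk x y * lap v y) := by
    intro x hx
    rw [mem_ball_zero_iff] at hx
    rw [integral_sub (log_integrable x _ (lap_cont ψ hψc) (lap_supp ψ hψc hψs))
      (kk_integrable x _ (lap_cont v hv2) hω), fund ψ hψc hψs, h1 x (by linarith), mul_sub]
    unfold Np
    rw [inv_mul_cancel_left₀ hpi.ne']
  refine ⟨fun x => ((v 0 - Np (lap v) 0 : ℝ) : ℂ) + ((2 * Real.pi)⁻¹ : ℝ) * ∫ y, Complex.log (1 - x / y) * (e y : ℂ),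
    ((holo_pot e hei hem ρ hρ h0).const_mul _).const_add _, ?_⟩
  intro x hx
  have hI : ∀ x, Integrable (fun y => Real.log ‖x - y‖ * lap ψ y - kk x y * lap v y) := fun x =>
    (log_integrable x _ (lap_cont ψ hψc) (lap_supp ψ hψc hψs)).sub (kk_integrable x _ (lap_cont v hv2) hω)
  have hx' := mem_ball_zero_iff.1 hx
  have hhalf : ∀ y : ℂ, 2 * ρ ≤ ‖y‖ → ‖x / y‖ ≤ 1 / 2 := by
    intro y hy
    rw [norm_div, div_le_iff₀ (by linarith)]; linarith
  have hlI : Integrable (fun y => Complex.log (1 - x / y) * (e y : ℂ)) := by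
    refine (hei.norm.const_mul 4).mono' ((Complex.measurable_log.comp (by fun_prop)).mul (Complex.measurable_ofReal.comp hem)).aestronglyMeasurable (Eventually.of_forall fun y => ?_)
    rw [norm_mul, Complex.norm_real]
    rcases lt_or_ge ‖y‖ (2 * ρ) with h | h
    · simp [h0 y h]
    · gcongr
      have h2 := Complex.norm_log_one_add_half_le_self (z := -(x / y)) (by simpa using hhalf y h)
      rw [← sub_eq_add_neg, norm_neg] at h2
      linarith [hhalf y h]
  rw [Complex.add_re, Complex.ofReal_re, Complex.re_ofReal_mul,
    show (∫ y, Complex.log (1 - x / y) * (e y : ℂ)).re = ∫ y, (Complex.log (1 - x / y) * (e y : ℂ)).re from (integral_re hlI).symm, ← sub_eq_iff_eq_add', hrep x hx, hrep 0 (by simpa using hρ), ← mul_sub,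
    ← integral_sub (hI x) (hI 0)]
  congr 2; ext y
  rw [Complex.re_mul_ofReal, Complex.log_re]
  rcases lt_or_ge ‖y‖ (2 * ρ) with h | h
  · have h5 : lap ψ y = lap v y := by have := h0 y h; simp only [he] at this; linarith
    rw [h0 y h, h5]; unfold kk; simp; ring
  · have hy : y ≠ 0 := by intro h'; rw [h', norm_zero] at h; linarith
    have h6 : ‖1 - x / y‖ = ‖x - y‖ / ‖y‖ := by
      rw [← norm_div, show (1 : ℂ) - x / y = -((x - y) / y) by field_simp; ring, norm_neg]
    have h7 : 0 < ‖x - y‖ := by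
      have := norm_sub_norm_le y x; rw [norm_sub_rev] at this; linarith
    rw [h6, Real.log_div h7.ne' (by simpa using hy)]
    simp only [he, kk]
    rw [zero_sub, norm_neg]
    ring

lemma repr_glob (v : ℂ → ℝ) (hv : ContDiff ℝ (⊤ : ℕ∞) v) (hω : Integrable (lap v)) :
    ∃ F : ℂ → ℂ, Differentiable ℂ F ∧ ∀ x, v x = Np (lap v) x + (F x).re := by
  have hh : InnerProductSpace.HarmonicOnNhd (fun x => v x - Np (lap v) x) Set.univ := by
    intro x _
    obtain ⟨G, hG, hGe⟩ := repr_loc v hv hω (‖x‖ + 1) (by positivity)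
    have hx : x ∈ ball (0:ℂ) (‖x‖ + 1) := by simp
    have hA : AnalyticAt ℂ G x := hG.analyticAt (isOpen_ball.mem_nhds hx)
    refine (InnerProductSpace.harmonicAt_congr_nhds ?_).2 hA.harmonicAt_re
    filter_upwards [isOpen_ball.mem_nhds hx] with z hz using hGe z hz
  obtain ⟨F, hF, hFe⟩ := hh.exists_analyticOnNhd_univ_re_eq
  refine ⟨F, fun x => (hF x trivial).differentiableAt, fun x => ?_⟩
  have : (F x).re = v x - Np (lap v) x := congrFun hFe x
  rw [this]; ring

lemma exists_log (g : ℂ → ℂ) (c : ℂ) (r : ℝ) (hr : 0 < r) (hg : DifferentiableOn ℂ g (ball c r))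
    (h0 : ∀ z ∈ ball c r, g z ≠ 0) :
    ∃ ψ : ℂ → ℂ, ψ c = Complex.log (g c) ∧ (∀ z ∈ ball c r, HasDerivAt ψ (deriv g z / g z) z) ∧
      ∀ z ∈ ball c r, Complex.exp (ψ z) = g z := by
  have hd : DifferentiableOn ℂ (fun z => deriv g z / g z) (ball c r) :=
    (hg.deriv isOpen_ball).div hg h0
  obtain ⟨ψ, hψc, hψ⟩ := hd.isExactOn_ball.with_val_at c (Complex.log (g c))
  refine ⟨ψ, hψc, hψ, ?_⟩
  have hcc : c ∈ ball c r := mem_ball_self hr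
  have hder : ∀ z ∈ ball c r, HasDerivAt (fun z => g z * Complex.exp (-ψ z)) 0 z := by
    intro z hz
    have h1 := (hg.differentiableAt (isOpen_ball.mem_nhds hz)).hasDerivAt
    have h2 := (hψ z hz).neg.cexp
    refine (h1.mul h2).congr_deriv ?_
    have := h0 z hz
    simp only [Pi.neg_apply]
    field_simp; ring
  intro z hz
  have hconst := (convex_ball c r).is_const_of_fderivWithin_eq_zero (𝕜 := ℂ) (f := fun z => g z * Complex.exp (-ψ z))
    (fun z hz => (hder z hz).differentiableAt.differentiableWithinAt)
    (fun z hz => by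
      rw [fderivWithin_of_isOpen isOpen_ball hz, (hder z hz).hasFDerivAt.fderiv]; ext; simp) hz hcc
  simp only [hψc, Complex.exp_neg, Complex.exp_log (h0 c hcc), mul_inv_cancel₀ (h0 c hcc)] at hconst
  rw [mul_inv_eq_one₀ (Complex.exp_ne_zero _)] at hconst
  exact hconst.symm

lemma blochB (ψ : ℂ → ℂ) (c : ℂ) (r : ℝ) (hr : 0 < r) (hψ : DifferentiableOn ℂ ψ (ball c r))
    (hinj : Set.InjOn (fun z => Complex.exp (ψ z)) (ball c r)) :
    ‖deriv ψ c‖ * r ≤ 512 * Real.pi := by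
  by_cases hz : deriv ψ c = 0
  · rw [hz]; simp; positivity
  have hzp : 0 < ‖deriv ψ c‖ := norm_pos_iff.2 hz
  set ρ := r / 2 with hρ
  have hρp : 0 < ρ := by positivity
  have hsub : closedBall c ρ ⊆ ball c r := closedBall_subset_ball (by rw [hρ]; linarith)
  have hdc : ContinuousOn (deriv ψ) (ball c r) := (hψ.deriv isOpen_ball).continuousOn
  obtain ⟨w, hw, hmax⟩ := (isCompact_closedBall c ρ).exists_isMaxOn ⟨c, mem_closedBall_self hρp.le⟩
    (f := fun w => ‖deriv ψ w‖ * (ρ - ‖w - c‖)) ((hdc.mono hsub).norm.mul (by fun_prop))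
  have hmax' : ∀ z ∈ closedBall c ρ, ‖deriv ψ z‖ * (ρ - ‖z - c‖) ≤ ‖deriv ψ w‖ * (ρ - ‖w - c‖) := hmax
  have h1 := hmax' c (mem_closedBall_self hρp.le)
  simp only [sub_self, norm_zero, sub_zero] at h1
  set A := ‖deriv ψ w‖ with hA
  set d := (ρ - ‖w - c‖) / 2 with hd
  have hA0 : 0 ≤ A := norm_nonneg _
  have hdp : 0 < d := by
    by_contra h; push Not at h
    have : 0 < ‖deriv ψ c‖ * ρ := by positivity
    have h2 : ρ - ‖w - c‖ = 2 * d := by rw [hd]; ring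
    rw [h2] at h1
    nlinarith
  have hAp : 0 < A := by
    rcases hA0.eq_or_lt with h | h
    · rw [← h] at h1; have : 0 < ‖deriv ψ c‖ * ρ := by positivity
      linarith
    · exact h
  have h2d : ρ - ‖w - c‖ = 2 * d := by rw [hd]; ring
  have hsub2 : closedBall w d ⊆ ball c r := by
    intro z hz
    rw [mem_closedBall, dist_eq_norm] at hz
    rw [mem_ball, dist_eq_norm]
    have := norm_sub_le_norm_sub_add_norm_sub z w c
    linarith
  have h2A : ∀ z ∈ closedBall w d, ‖deriv ψ z‖ ≤ 2 * A := by
    intro z hz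
    rw [mem_closedBall, dist_eq_norm] at hz
    have h3 := norm_sub_le_norm_sub_add_norm_sub z w c
    have h4 := hmax' z (by rw [mem_closedBall, dist_eq_norm]; linarith)
    rw [h2d] at h4
    have h5 : ‖deriv ψ z‖ * d ≤ ‖deriv ψ z‖ * (ρ - ‖z - c‖) := by
      gcongr; linarith
    have : ‖deriv ψ z‖ * d ≤ (2 * A) * d := by linarith
    exact le_of_mul_le_mul_right this hdp
  have hlip : ∀ z ∈ ball w (d / 8), ‖deriv ψ z - deriv ψ w‖ ≤ A / 2 := by
    intro z hz
    have h3 := Complex.dist_le_div_mul_dist_of_mapsTo_ball (f := deriv ψ) (c := w) (z := z) (R₁ := d) (R₂ := 3 * A)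
      ((hψ.deriv isOpen_ball).mono (ball_subset_closedBall.trans hsub2)) ?_ ?_
    · rw [dist_eq_norm, dist_eq_norm] at h3
      rw [mem_ball, dist_eq_norm] at hz
      have : 3 * A / d * ‖z - w‖ ≤ 3 * A / d * (d / 8) := by gcongr
      have h4 : 3 * A / d * (d / 8) = 3 * A / 8 := by field_simp
      linarith
    · intro y hy
      rw [mem_closedBall, dist_eq_norm]
      have := norm_sub_le (deriv ψ y) (deriv ψ w)
      have := h2A y (ball_subset_closedBall hy)
      linarith
    · exact ball_subset_ball (by linarith) hz
  have hlow : ∀ z ∈ ball w (d / 8), A / 2 * ‖z - w‖ ≤ ‖ψ z - ψ w‖ := by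
    intro z hz
    have hww : w ∈ ball w (d / 8) := mem_ball_self (by positivity)
    have hb8 : ball w (d / 8) ⊆ ball c r := (ball_subset_ball (by linarith)).trans (ball_subset_closedBall.trans hsub2)
    have h3 := (convex_ball w (d / 8)).norm_image_sub_le_of_norm_hasDerivWithin_le
      (f := fun z => ψ z - deriv ψ w * z) (f' := fun z => deriv ψ z - deriv ψ w) (C := A / 2)
      (fun y hy => ?_) hlip hww hz
    · have h4 : ψ z - ψ w = (ψ z - deriv ψ w * z - (ψ w - deriv ψ w * w)) + deriv ψ w * (z - w) := by ring
      have h5 : ‖deriv ψ w * (z - w)‖ = A * ‖z - w‖ := norm_mul _ _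
      have h6 := norm_sub_norm_le (deriv ψ w * (z - w)) (-(ψ z - deriv ψ w * z - (ψ w - deriv ψ w * w)))
      rw [sub_neg_eq_add, add_comm, ← h4, norm_neg, h5] at h6
      linarith
    · have h4 := (hψ.differentiableAt (isOpen_ball.mem_nhds (hb8 hy))).hasDerivAt
      have h5 : HasDerivAt (fun z => deriv ψ w * z) (deriv ψ w) y := by
        simpa using (hasDerivAt_id y).const_mul (deriv ψ w)
      exact (h4.sub h5).hasDerivWithinAt
  have hcl : closedBall w (d / 16) ⊆ ball c r := (closedBall_subset_closedBall (by linarith)).trans hsub2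
  have himg := DiffContOnCl.ball_subset_image_closedBall (f := ψ) (z₀ := w) (r := d / 16) (ε := A * d / 32)
    (hψ.diffContOnCl_ball hcl) (by positivity) ?_ ?_
  · by_contra hcon
    push Not at hcon
    have hAd : 128 * Real.pi < A * d := by
      rw [hρ] at h1; rw [h2d] at h1; linarith
    have hmem : ψ w + 2 * Real.pi * Complex.I ∈ ball (ψ w) (A * d / 32 / 2) := by
      rw [mem_ball, dist_eq_norm, add_sub_cancel_left]
      simp only [norm_mul, Complex.norm_I, mul_one, Complex.norm_real, Real.norm_eq_abs, abs_of_pos Real.pi_pos, Complex.norm_ofNat]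
      linarith
    obtain ⟨p, hp, hpe⟩ := himg hmem
    have hpw : p = w := by
      apply hinj (hcl hp) (hsub hw)
      simp only [hpe, Complex.exp_add, Complex.exp_two_pi_mul_I, mul_one]
    rw [hpw] at hpe
    have h7 : (2 * Real.pi * Complex.I : ℂ) = 0 := by simpa using hpe.symm
    simp [Real.pi_ne_zero] at h7
  · intro z hz
    have hz' : ‖z - w‖ = d / 16 := by rw [mem_sphere, dist_eq_norm] at hz; exact hz
    have := hlow z (by rw [mem_ball, dist_eq_norm, hz']; linarith)
    rw [hz'] at this; linarith
  · apply Eventually.frequently (f := 𝓝[≠] w) _ |>.filter_mono nhdsWithin_le_nhds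
    filter_upwards [self_mem_nhdsWithin, mem_nhdsWithin_of_mem_nhds (isOpen_ball.mem_nhds (mem_ball_self (show 0 < d / 8 by positivity)))] with z hz1 hz2
    have := hlow z hz2
    intro h
    rw [h, sub_self, norm_zero] at this
    have h3 : 0 < ‖z - w‖ := norm_pos_iff.2 (sub_ne_zero.2 hz1)
    have : 0 < A / 2 * ‖z - w‖ := by positivity
    linarith

/-- constant -/
def CK : ℝ := 512 * Real.pi

lemma CK_pos : 0 < CK := by unfold CK; positivity

lemma koebeK (H : ℂ → ℂ) (w y : ℂ) (ρ : ℝ) (hρ : 0 < ρ) (hH : DifferentiableOn ℂ H (ball w ρ))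
    (hinj : Set.InjOn H (ball w ρ)) (hy : ∀ z ∈ ball w ρ, H z ≠ y) :
    ‖deriv H w‖ * ρ ≤ CK * ‖H w - y‖ := by
  have hw : w ∈ ball w ρ := mem_ball_self hρ
  obtain ⟨ψ, _, hψ, hψe⟩ := exists_log (fun z => H z - y) w ρ hρ (hH.sub_const y) (fun z hz => sub_ne_zero.2 (hy z hz))
  have h1 := blochB ψ w ρ hρ (fun z hz => (hψ z hz).differentiableAt.differentiableWithinAt) (by
    intro a ha b hb hab
    simp only [hψe a ha, hψe b hb] at hab
    exact hinj ha hb (by simpa using hab))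
  rw [(hψ w hw).deriv, deriv_sub_const, norm_div, div_mul_eq_mul_div,
    div_le_iff₀ (norm_pos_iff.2 (sub_ne_zero.2 (hy w hw)))] at h1
  exact h1

lemma distD (H : ℂ → ℂ) (w : ℂ) (ρ : ℝ) (hρ : 0 < ρ) (hH : DifferentiableOn ℂ H (ball w ρ))
    (hinj : Set.InjOn H (ball w ρ)) (hd : deriv H w ≠ 0) :
    ‖deriv (deriv H) w‖ * ρ ≤ 4 * CK * ‖deriv H w‖ := by
  have hw : w ∈ ball w ρ := mem_ball_self hρ
  have hnh : ball w ρ ∈ 𝓝 w := isOpen_ball.mem_nhds hw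
  set q := dslope H w with hq
  have hqd : DifferentiableOn ℂ q (ball w ρ) := (Complex.differentiableOn_dslope hnh).2 hH
  have hqw : q w = deriv H w := dslope_same _ _
  have hdp : 0 < ‖deriv H w‖ := norm_pos_iff.2 hd
  have hlow : ∀ z ∈ ball w ρ, z ≠ w → ‖deriv H w‖ ≤ CK * ‖q z‖ := by
    intro z hz hzw
    have hp : 0 < ‖z - w‖ := norm_pos_iff.2 (sub_ne_zero.2 hzw)
    have hzρ : ‖z - w‖ < ρ := by rwa [mem_ball, dist_eq_norm] at hz
    have hs : ball w ‖z - w‖ ⊆ ball w ρ := ball_subset_ball hzρ.le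
    have h1 := koebeK H w (H z) ‖z - w‖ hp (hH.mono hs) (hinj.mono hs) (by
      intro a ha hab
      have := hinj (hs ha) hz hab
      rw [this, mem_ball, dist_eq_norm] at ha
      exact lt_irrefl _ ha)
    rw [hq, dslope_of_ne _ hzw, slope_def_field, norm_div, mul_div_assoc', le_div_iff₀ hp, norm_sub_rev (H z)]
    exact h1
  have hq0 : ∀ z ∈ ball w ρ, q z ≠ 0 := by
    intro z hz h
    by_cases hzw : z = w
    · rw [hzw, hqw] at h; exact hd h
    · have := hlow z hz hzw
      rw [h, norm_zero, mul_zero] at this; linarith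
  have hcl : closedBall w (ρ / 2) ⊆ ball w ρ := closedBall_subset_ball (by linarith)
  have hQ := Complex.norm_deriv_le_of_forall_mem_sphere_norm_le (f := fun z => (q z)⁻¹) (c := w) (R := ρ / 2)
    (C := CK / ‖deriv H w‖) (by positivity) ((hqd.inv hq0).diffContOnCl_ball hcl) (by
      intro z hz
      have hz2 := hcl (sphere_subset_closedBall hz)
      have hzw : z ≠ w := by
        rintro rfl; rw [mem_sphere, dist_self] at hz; linarith
      rw [norm_inv, inv_le_comm₀ (norm_pos_iff.2 (hq0 z hz2)) (by have := CK_pos; positivity), inv_div, div_le_iff₀ CK_pos, mul_comm]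
      exact hlow z hz2 hzw)
  have hqw' : HasDerivAt q (deriv q w) w := (hqd.differentiableAt hnh).hasDerivAt
  rw [show deriv (fun z => (q z)⁻¹) w = - deriv q w / q w ^ 2 from (hqw'.inv (hq0 w hw)).deriv, hqw, norm_div, norm_neg, norm_pow] at hQ
  have h2 : deriv (deriv H) w = 2 * deriv q w := by
    have he : deriv H =ᶠ[𝓝 w] fun z => q z + (z - w) * deriv q z := by
      filter_upwards [hnh] with z hz
      have h3 : HasDerivAt q (deriv q z) z := (hqd.differentiableAt (isOpen_ball.mem_nhds hz)).hasDerivAt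
      have h4 : H = fun z => H w + (z - w) * q z := by
        ext a
        have := sub_smul_dslope H w a
        rw [smul_eq_mul] at this
        rw [hq, this]; ring
      have h5 : HasDerivAt (fun z => H w + (z - w) * q z) (1 * q z + (z - w) * deriv q z) z :=
        (((hasDerivAt_id z).sub_const w).mul h3).const_add _
      rw [← h4] at h5
      rw [h5.deriv, one_mul]
    rw [he.deriv_eq]
    have h6 : HasDerivAt (deriv q) (deriv (deriv q) w) w :=
      (((hqd.deriv isOpen_ball).differentiableAt hnh)).hasDerivAt
    have h7 : HasDerivAt (fun z => q z + (z - w) * deriv q z) (deriv q w + (1 * deriv q w + (w - w) * deriv (deriv q) w)) w :=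
      hqw'.add (((hasDerivAt_id w).sub_const w).mul h6)
    rw [h7.deriv]; ring
  rw [h2, norm_mul, Complex.norm_ofNat]
  rw [div_div, div_le_div_iff₀ (by positivity) (by positivity)] at hQ
  have h8 : ‖deriv q w‖ * ρ * ‖deriv H w‖ ≤ 2 * CK * ‖deriv H w‖ * ‖deriv H w‖ := by nlinarith
  have := le_of_mul_le_mul_right h8 hdp
  linarith

lemma distE (H : ℂ → ℂ) (R : ℝ) (hR : 0 < R) (hH : DifferentiableOn ℂ H (ball 0 R))
    (hinj : Set.InjOn H (ball 0 R)) (hd : ∀ z ∈ ball (0:ℂ) R, deriv H z ≠ 0) (w : ℂ) (hw : w ∈ ball (0:ℂ) R) :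
    ‖deriv H 0‖ * (1 - ‖w‖ / R) ^ (4 * CK) ≤ ‖deriv H w‖ ∧
      ‖deriv H w‖ ≤ ‖deriv H 0‖ * (1 - ‖w‖ / R) ^ (-(4 * CK)) := by
  have h00 : (0:ℂ) ∈ ball (0:ℂ) R := mem_ball_self hR
  have hwR := mem_ball_zero_iff.1 hw
  have hd0 := hd 0 h00
  obtain ⟨ψ, hψ0, hψ, hψe⟩ := exists_log (fun z => deriv H z / deriv H 0) 0 R hR
    ((hH.deriv isOpen_ball).div_const _) (fun z hz => div_ne_zero (hd z hz) hd0)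
  simp only [div_self hd0, Complex.log_one] at hψ0
  have htw : ∀ t ∈ Set.Icc (0:ℝ) 1, ‖(t:ℂ) * w‖ ≤ t * ‖w‖ := by
    intro t ht; rw [norm_mul, Complex.norm_real, Real.norm_of_nonneg ht.1]
  have htm : ∀ t ∈ Set.Icc (0:ℝ) 1, (t:ℂ) * w ∈ ball (0:ℂ) R := by
    intro t ht
    rw [mem_ball_zero_iff]
    have := htw t ht
    have : t * ‖w‖ ≤ 1 * ‖w‖ := by gcongr; exact ht.2
    linarith
  have hpos : ∀ t ∈ Set.Icc (0:ℝ) 1, 0 < 1 - t * ‖w‖ / R := by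
    intro t ht
    rw [sub_pos, div_lt_one hR]
    have : t * ‖w‖ ≤ 1 * ‖w‖ := by gcongr; exact ht.2
    linarith
  have hder : ∀ t ∈ Set.Icc (0:ℝ) 1, HasDerivAt (fun t : ℝ => ψ (t * w)) ((deriv (fun z => deriv H z / deriv H 0) (t * w) / (deriv H (t * w) / deriv H 0)) * w) t := by
    intro t ht
    have h1 : HasDerivAt (fun t : ℝ => (t:ℂ) * w) w t := by
      simpa using (Complex.ofRealCLM.hasDerivAt (x := t)).mul_const w
    exact (hψ _ (htm t ht)).comp t h1
  have hB : ∀ t ∈ Set.Icc (0:ℝ) 1, HasDerivAt (fun t : ℝ => -(4 * CK) * Real.log (1 - t * ‖w‖ / R)) (-(4 * CK) * (-(‖w‖ / R) / (1 - t * ‖w‖ / R))) t := by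
    intro t ht
    have h1 : HasDerivAt (fun t : ℝ => 1 - t * ‖w‖ / R) (-(‖w‖ / R)) t := by
      simpa using (((hasDerivAt_id t).mul_const ‖w‖).div_const R).const_sub 1
    exact (h1.log (hpos t ht).ne').const_mul _
  have key := image_norm_le_of_norm_deriv_right_le_deriv_boundary' (a := 0) (b := 1)
    (f := fun t : ℝ => ψ (t * w)) (B := fun t : ℝ => -(4 * CK) * Real.log (1 - t * ‖w‖ / R))
    (fun t ht => (hder t ht).continuousAt.continuousWithinAt)
    (fun t ht => (hder t (Set.Ico_subset_Icc_self ht)).hasDerivWithinAt) (by simp [hψ0])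
    (fun t ht => (hB t ht).continuousAt.continuousWithinAt)
    (fun t ht => (hB t (Set.Ico_subset_Icc_self ht)).hasDerivWithinAt) (by
      intro t ht'
      have ht := Set.Ico_subset_Icc_self ht'
      have hm := htm t ht
      have hzR := mem_ball_zero_iff.1 hm
      set z := (t:ℂ) * w with hz
      have hrp : 0 < R - ‖z‖ := by linarith
      have hs : ball z (R - ‖z‖) ⊆ ball 0 R := by
        intro a ha
        rw [mem_ball, dist_eq_norm] at ha
        rw [mem_ball_zero_iff]
        have := norm_sub_norm_le a z
        linarith
      have h1 := distD H z (R - ‖z‖) hrp (hH.mono hs) (hinj.mono hs) (hd z hm)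
      have hdz : 0 < ‖deriv H z‖ := norm_pos_iff.2 (hd z hm)
      rw [deriv_div_const, div_div_div_cancel_right₀ hd0, norm_mul, norm_div]
      have h2 : ‖deriv (deriv H) z‖ / ‖deriv H z‖ ≤ 4 * CK / (R - ‖z‖) := by
        rw [div_le_div_iff₀ hdz hrp]; exact h1
      have h3 : ‖z‖ ≤ t * ‖w‖ := htw t ht
      have h4 := hpos t ht
      have h5 : 1 - t * ‖w‖ / R = (R - t * ‖w‖) / R := by field_simp
      have h6 : 0 < R - t * ‖w‖ := by
        rw [h5] at h4; exact (div_pos_iff_of_pos_right hR).1 h4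
      calc _ ≤ 4 * CK / (R - ‖z‖) * ‖w‖ := by gcongr
        _ ≤ 4 * CK / (R - t * ‖w‖) * ‖w‖ := by
          have := CK_pos
          gcongr
        _ = _ := by rw [h5]; field_simp) (Set.right_mem_Icc.2 zero_le_one)
  simp only [Complex.ofReal_one, one_mul] at key
  have hp1 : 0 < 1 - ‖w‖ / R := by simpa using hpos 1 (by simp)
  have he : ‖deriv H w‖ = ‖deriv H 0‖ * Real.exp (ψ w).re := by
    rw [← Complex.norm_exp, hψe w hw, norm_div, mul_div_cancel₀ _ (norm_ne_zero_iff.2 hd0)]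
  have h1 := (Complex.abs_re_le_norm (ψ w)).trans key
  rw [abs_le] at h1
  rw [he, Real.rpow_def_of_pos hp1, Real.rpow_def_of_pos hp1]
  constructor
  · gcongr; linarith
  · gcongr; linarith

def Lg (x y : ℂ) : ℝ := Real.log (1 + ‖x - y‖⁻¹)

lemma Lg_nonneg (x y : ℂ) : 0 ≤ Lg x y := Real.log_nonneg (by linarith [inv_nonneg.2 (norm_nonneg (x - y))])

lemma Lg_le (x y : ℂ) : Lg x y ≤ ‖x - y‖⁻¹ := by
  have := Real.log_le_sub_one_of_pos (show 0 < 1 + ‖x - y‖⁻¹ by positivity)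
  unfold Lg; linarith

lemma Lg_meas (x : ℂ) : Measurable (fun y => Lg x y) := by unfold Lg; fun_prop

lemma Lg_integrable (x : ℂ) (ω : ℂ → ℝ) (hc : Continuous ω) (hi : Integrable ω) :
    Integrable (fun y : ℂ => Lg x y * |ω y|) := by
  refine (inv_mul_integrable x ω hc hi).mono' ((Lg_meas x).mul (hc.measurable.norm)).aestronglyMeasurable
    (Eventually.of_forall fun y => ?_)
  rw [norm_mul, Real.norm_of_nonneg (Lg_nonneg x y), Real.norm_eq_abs, abs_abs]
  gcongr
  exact Lg_le x y

lemma kk_mul_le (x y : ℂ) (h : x ≠ y) (a : ℝ) : kk x y * a ≤ Real.log (1 + ‖x‖) * |a| + Lg x y * |a| := by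
  have hz' : 0 < ‖x - y‖ := norm_pos_iff.2 (sub_ne_zero.2 h)
  have h1 := kk_le x y
  have h2 := kk_ge x y h
  have h4 := Real.log_nonneg (show 1 ≤ 1 + ‖x‖ by linarith [norm_nonneg x])
  have h5 := Lg_nonneg x y
  have h3 : Real.log (1 + (1 + ‖x‖) * ‖x - y‖⁻¹) ≤ Real.log (1 + ‖x‖) + Lg x y := by
    unfold Lg
    rw [← Real.log_mul (by positivity) (by positivity)]
    apply Real.log_le_log (by positivity)
    have := norm_nonneg x
    nlinarith
  have h6 : |kk x y| ≤ Real.log (1 + ‖x‖) + Lg x y := by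
    rw [abs_le]; constructor <;> linarith
  calc kk x y * a ≤ |kk x y * a| := le_abs_self _
    _ = |kk x y| * |a| := abs_mul _ _
    _ ≤ (Real.log (1 + ‖x‖) + Lg x y) * |a| := by gcongr
    _ = _ := by ring

lemma Np_le (x : ℂ) (ω : ℂ → ℝ) (hc : Continuous ω) (hi : Integrable ω) :
    Np ω x ≤ (2 * Real.pi)⁻¹ * (∫ y, |ω y|) * Real.log (1 + ‖x‖) + (2 * Real.pi)⁻¹ * ∫ y, Lg x y * |ω y| := by
  unfold Np
  have : ∫ y, kk x y * ω y ≤ ∫ y, (Real.log (1 + ‖x‖) * |ω y| + Lg x y * |ω y|) := by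
    apply integral_mono_ae (kk_integrable x ω hc hi) ((hi.norm.const_mul _).add (Lg_integrable x ω hc hi))
    filter_upwards [ae_ne_c x] with y hy using kk_mul_le x y hy _
  rw [integral_add (hi.abs.const_mul _) (Lg_integrable x ω hc hi), integral_const_mul] at this
  have hp : 0 < (2 * Real.pi)⁻¹ := by positivity
  have h9 := mul_le_mul_of_nonneg_left this hp.le
  linarith [h9]

lemma exp_master (x : ℂ) (ω : ℂ → ℝ) (hc : Continuous ω) (hi : Integrable ω) (A : Set ℂ) (hA : MeasurableSet A)
    (q δ : ℝ) (hq : 0 ≤ q) (hδ : 0 < δ) (hδ2 : δ < 2) (hm : q * ∫ y in A, |ω y| ≤ δ) :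
    ENNReal.ofReal (Real.exp (q * ∫ y in A, Lg x y * |ω y|)) ≤
      1 + ENNReal.ofReal (4 / δ) * ∫⁻ y in A, (1 + ENNReal.ofReal (‖x - y‖ ^ (-δ))) * ENNReal.ofReal (q * |ω y|) := by
  have hm1 : Measurable (fun y => ENNReal.ofReal (q * |ω y|)) := (hc.measurable.norm.const_mul q).ennreal_ofReal
  set μ := (volume.restrict A).withDensity (fun y => ENNReal.ofReal (q * |ω y|)) with hμ
  have hlt : ∀ᵐ y ∂(volume.restrict A), ENNReal.ofReal (q * |ω y|) < ⊤ := Eventually.of_forall fun y => ENNReal.ofReal_lt_top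
  have hmass : μ Set.univ ≤ ENNReal.ofReal δ := by
    rw [hμ, withDensity_apply _ MeasurableSet.univ, Measure.restrict_univ, ← ofReal_integral_eq_lintegral_ofReal]
    · apply ENNReal.ofReal_le_ofReal
      rw [integral_const_mul]; exact hm
    · exact (hi.norm.const_mul q).integrableOn
    · exact Eventually.of_forall fun y => by positivity
  have hint : Integrable (fun y => Lg x y) μ := by
    rw [hμ, integrable_withDensity_iff_integrable_smul' hm1 hlt]
    refine ((Lg_integrable x ω hc hi).const_mul q).integrableOn.congr (Eventually.of_forall fun y => ?_)
    simp only [smul_eq_mul]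
    rw [ENNReal.toReal_ofReal (by positivity)]; ring
  have hval : ∫ y, Lg x y ∂μ = q * ∫ y in A, Lg x y * |ω y| := by
    rw [hμ, integral_withDensity_eq_integral_toReal_smul hm1 hlt, ← integral_const_mul]
    congr 1; ext y
    simp only [smul_eq_mul]
    rw [ENNReal.toReal_ofReal (by positivity)]; ring
  have h1 := expJ μ δ hδ hmass _ hint
  rw [hval] at h1
  refine h1.trans ?_
  have hle : ∀ y, ENNReal.ofReal (Real.exp (δ * Lg x y)) ≤ ENNReal.ofReal 4 * (1 + ENNReal.ofReal (‖x - y‖ ^ (-δ))) := by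
    intro y
    rw [← ENNReal.ofReal_one, ← ENNReal.ofReal_add (by norm_num) (by positivity), ← ENNReal.ofReal_mul (by norm_num)]
    apply ENNReal.ofReal_le_ofReal
    have hb : 0 ≤ ‖x - y‖⁻¹ := by positivity
    have e1 : Real.exp (δ * Lg x y) = (1 + ‖x - y‖⁻¹) ^ δ := by
      unfold Lg; rw [Real.rpow_def_of_pos (by positivity), mul_comm]
    have e2 : ‖x - y‖ ^ (-δ) = (‖x - y‖⁻¹) ^ δ := by
      rw [Real.rpow_neg (norm_nonneg _), Real.inv_rpow (norm_nonneg _)]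
    rw [e1, e2]
    set a := ‖x - y‖⁻¹ with ha
    have h4 : (2:ℝ) ^ δ ≤ 4 := by
      calc (2:ℝ) ^ δ ≤ 2 ^ (2:ℝ) := by
            apply Real.rpow_le_rpow_of_exponent_le (by norm_num) hδ2.le
        _ = 4 := by norm_num
    have h5 : 0 ≤ a ^ δ := by positivity
    rcases le_total a 1 with h | h
    · calc (1 + a) ^ δ ≤ 2 ^ δ := by apply Real.rpow_le_rpow (by positivity) (by linarith) hδ.le
        _ ≤ 4 * (1 + a ^ δ) := by linarith
    · calc (1 + a) ^ δ ≤ (2 * a) ^ δ := by apply Real.rpow_le_rpow (by positivity) (by linarith) hδ.le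
        _ = 2 ^ δ * a ^ δ := Real.mul_rpow (by norm_num) hb
        _ ≤ 4 * (1 + a ^ δ) := by nlinarith
  have hm2 : Measurable (fun y => 1 + ENNReal.ofReal (‖x - y‖ ^ (-δ))) := by fun_prop
  have h2 : ∫⁻ y, ENNReal.ofReal (Real.exp (δ * Lg x y)) ∂μ ≤ ENNReal.ofReal 4 *
      ∫⁻ y in A, (1 + ENNReal.ofReal (‖x - y‖ ^ (-δ))) * ENNReal.ofReal (q * |ω y|) := by
    refine (lintegral_mono hle).trans ?_
    rw [lintegral_const_mul _ hm2]
    refine mul_le_mul' le_rfl (le_of_eq ?_)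
    rw [hμ, lintegral_withDensity_eq_lintegral_mul _ hm1 hm2]
    congr 1; ext y; simp [mul_comm]
  calc _ ≤ 1 + ENNReal.ofReal (1 / δ) * (ENNReal.ofReal 4 * _) := by gcongr
    _ = _ := by
      rw [← mul_assoc, ← ENNReal.ofReal_mul (by positivity)]
      congr 3; ring

lemma confLen_nonneg (v : ℂ → ℝ) (γ : ℝ → ℂ) : 0 ≤ confLen v γ := by
  unfold confLen
  exact intervalIntegral.integral_nonneg (by norm_num) fun t _ => by positivity

lemma confDist_le (v : ℂ → ℝ) (S : Set ℂ) (x y : ℂ) (γ : ℝ → ℂ) (h : γ ∈ PathsIn S x y) :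
    confDist v S x y ≤ confLen v γ :=
  csInf_le ⟨0, by rintro _ ⟨γ, _, rfl⟩; exact confLen_nonneg v γ⟩ ⟨γ, h, rfl⟩

lemma confDist_ge (v : ℂ → ℝ) (hv : Continuous v) (l : ℂ) (ε m : ℝ) (hε : 0 < ε) (hm : 0 < m)
    (hb : ∀ z ∈ closedBall l ε, m ≤ Real.exp (v z)) (x : ℂ) (hx : ε ≤ ‖x - l‖) :
    m * ε ≤ confDist v Set.univ x l := by
  apply le_csInf
  · refine Set.Nonempty.image _ ⟨fun t => x + (t:ℂ) * (l - x), by simp, by simp, fun _ _ => trivial, ?_⟩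
    have : ContDiff ℝ 1 (fun t : ℝ => (t:ℂ)) := Complex.ofRealCLM.contDiff
    fun_prop
  rintro _ ⟨γ, ⟨h0, h1, -, hγ⟩, rfl⟩
  have hγc := hγ.continuous
  have hd : Continuous (deriv γ) := hγ.continuous_deriv (by norm_num)
  have hK : IsCompact {t ∈ Set.Icc (0:ℝ) 1 | ε ≤ ‖γ t - l‖} :=
    isCompact_Icc.inter_right (isClosed_le continuous_const (show Continuous (fun t => ‖γ t - l‖) by fun_prop))
  obtain ⟨t₀, ⟨⟨a0, a1⟩, ht₀⟩, hmax⟩ := hK.exists_isGreatest ⟨0, by simp, by simpa [h0] using hx⟩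
  have hlt : ∀ t ∈ Set.Ioo t₀ 1, ‖γ t - l‖ < ε := by
    intro t ht
    by_contra hc
    have := hmax ⟨⟨a0.trans ht.1.le, ht.2.le⟩, not_lt.1 hc⟩
    linarith [ht.1]
  have hci : ∀ a b, IntervalIntegrable (fun t => Real.exp (v (γ t)) * ‖deriv γ t‖) volume a b := fun a b =>
    (by fun_prop : Continuous (fun t => Real.exp (v (γ t)) * ‖deriv γ t‖)).intervalIntegrable a b
  have hci2 : IntervalIntegrable (fun t => m * ‖deriv γ t‖) volume t₀ 1 :=
    (by fun_prop : Continuous (fun t => m * ‖deriv γ t‖)).intervalIntegrable _ _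
  have e1 : ∫ t in t₀..1, deriv γ t = γ 1 - γ t₀ :=
    intervalIntegral.integral_deriv_eq_sub (fun t _ => (hγ.differentiable (by norm_num)) t) (hd.intervalIntegrable _ _)
  calc m * ε ≤ m * ‖∫ t in t₀..1, deriv γ t‖ := by
        rw [e1, h1, norm_sub_rev]; gcongr
    _ ≤ m * ∫ t in t₀..1, ‖deriv γ t‖ := by
        gcongr; exact intervalIntegral.norm_integral_le_integral_norm a1
    _ = ∫ t in t₀..1, m * ‖deriv γ t‖ := by rw [intervalIntegral.integral_const_mul]
    _ ≤ ∫ t in t₀..1, Real.exp (v (γ t)) * ‖deriv γ t‖ := by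
        apply intervalIntegral.integral_mono_on_of_le_Ioo a1 hci2 (hci _ _)
        intro t ht
        gcongr
        exact hb _ (by rw [mem_closedBall, dist_eq_norm]; exact (hlt t ht).le)
    _ ≤ confLen v γ := by
        unfold confLen
        rw [← intervalIntegral.integral_add_adjacent_intervals (hci 0 t₀) (hci t₀ 1)]
        have : 0 ≤ ∫ t in (0:ℝ)..t₀, Real.exp (v (γ t)) * ‖deriv γ t‖ :=
          intervalIntegral.integral_nonneg a0 fun t _ => by positivity
        linarith

lemma confDist_curve (v : ℂ → ℝ) (hv : Continuous v) (c : ℝ → ℂ) (s t : ℝ) 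
    (hc : ∀ τ ∈ Set.uIcc s t, ContDiffAt ℝ 1 c τ) :
    confDist v Set.univ (c s) (c t) ≤ |∫ τ in s..t, Real.exp (v (c τ)) * ‖deriv c τ‖| := by
  set σ : ℝ → ℝ := fun τ => s + (t - s) * (Real.sin (Real.pi / 2 * τ)) ^ 2 with hσ
  set σ' : ℝ → ℝ := fun τ => (t - s) * (2 * Real.sin (Real.pi / 2 * τ) * (Real.cos (Real.pi / 2 * τ) * (Real.pi / 2))) with hσ'
  have hσd : ∀ τ, HasDerivAt σ (σ' τ) τ := by
    intro τ
    have h1 : HasDerivAt (fun τ => Real.pi / 2 * τ) (Real.pi / 2) τ := by simpa using (hasDerivAt_id τ).const_mul (Real.pi / 2)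
    have := ((h1.sin.pow 2).const_mul (t - s)).const_add s
    have e : σ' τ = (t - s) * (((2:ℕ):ℝ) * Real.sin (Real.pi / 2 * τ) ^ (2 - 1) * (Real.cos (Real.pi / 2 * τ) * (Real.pi / 2))) := by
      simp [hσ']
    rw [e]
    exact this
  have hmem : ∀ τ, σ τ ∈ Set.uIcc s t := by
    intro τ
    have h1 := Real.sin_sq_le_one (Real.pi / 2 * τ)
    have h2 := sq_nonneg (Real.sin (Real.pi / 2 * τ))
    rw [Set.mem_uIcc]
    simp only [hσ]
    rcases le_total s t with h | h
    · left; constructor <;> nlinarith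
    · right; constructor <;> nlinarith
  have hσc : ContDiff ℝ 1 σ := by
    simp only [hσ]
    exact contDiff_const.add (contDiff_const.mul ((Real.contDiff_sin.comp (contDiff_const.mul contDiff_id)).pow 2))
  have hσ'c : Continuous σ' := by simp only [hσ']; fun_prop
  have hpath : c ∘ σ ∈ PathsIn Set.univ (c s) (c t) := by
    refine ⟨by simp [hσ], by simp [hσ], fun _ _ => trivial, ?_⟩
    rw [contDiff_iff_contDiffAt]
    intro τ
    exact (hc _ (hmem τ)).comp τ hσc.contDiffAt
  refine (confDist_le v _ _ _ _ hpath).trans ?_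
  have hg : ContinuousOn (fun τ => Real.exp (v (c τ)) * ‖deriv c τ‖) (Set.uIcc s t) := by
    intro τ hτ
    have h1 : ContinuousAt c τ := (hc τ hτ).continuousAt
    have h2 : ContinuousAt (deriv c) τ := by
      have := (hc τ hτ).fderiv_right (m := 0) (by norm_num)
      have h3 := this.continuousAt
      have : deriv c = fun x => fderiv ℝ c x 1 := by ext x; rw [fderiv_apply_one_eq_deriv]
      rw [this]
      exact h3.clm_apply continuousAt_const
    have h3 : ContinuousAt (fun τ => v (c τ)) τ := (hv.continuousAt).comp h1
    exact (h3.rexp.mul h2.norm).continuousWithinAt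
  have hsub : ∫ x in (0:ℝ)..1, ((fun τ => Real.exp (v (c τ)) * ‖deriv c τ‖) ∘ σ) x * σ' x
      = ∫ τ in s..t, Real.exp (v (c τ)) * ‖deriv c τ‖ := by
    rw [intervalIntegral.integral_comp_mul_deriv'' hσc.continuous.continuousOn
      (fun x _ => (hσd x).hasDerivWithinAt) hσ'c.continuousOn
      (hg.mono (by rintro _ ⟨x, _, rfl⟩; exact hmem x))]
    simp [hσ]
  have hlen : confLen v (c ∘ σ) = ∫ x in (0:ℝ)..1, |((fun τ => Real.exp (v (c τ)) * ‖deriv c τ‖) ∘ σ) x * σ' x| := by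
    unfold confLen
    congr 1; ext x
    have h1 : deriv (c ∘ σ) x = σ' x • deriv c (σ x) :=
      ((hc _ (hmem x)).differentiableAt (by norm_num)).hasDerivAt.scomp x (hσd x) |>.deriv
    rw [h1, norm_smul, abs_mul]
    simp only [Function.comp]
    rw [abs_of_nonneg (by positivity : 0 ≤ Real.exp (v (c (σ x))) * ‖deriv c (σ x)‖), Real.norm_eq_abs]; ring
  rw [hlen, ← hsub]
  have hsgn : ∀ x ∈ Set.uIcc (0:ℝ) 1, 0 ≤ Real.sin (Real.pi / 2 * x) * Real.cos (Real.pi / 2 * x) := by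
    intro x hx
    rw [Set.uIcc_of_le (by norm_num)] at hx
    have hp := Real.pi_pos
    apply mul_nonneg
    · apply Real.sin_nonneg_of_nonneg_of_le_pi
      · exact mul_nonneg (by positivity) hx.1
      · nlinarith [hx.2, hx.1]
    · apply Real.cos_nonneg_of_neg_pi_div_two_le_of_le <;> nlinarith [hx.2, hx.1]
  rcases le_total s t with h | h
  · rw [intervalIntegral.integral_congr (g := fun x => ((fun τ => Real.exp (v (c τ)) * ‖deriv c τ‖) ∘ σ) x * σ' x)]
    · exact le_abs_self _
    · intro x hx
      apply abs_of_nonneg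
      apply mul_nonneg
      · simp only [Function.comp]; positivity
      · simp only [hσ']
        have := hsgn x hx
        have h2 : 0 ≤ t - s := by linarith
        have : 0 ≤ (t - s) * ((Real.sin (Real.pi / 2 * x) * Real.cos (Real.pi / 2 * x)) * Real.pi) := by positivity
        linarith
  · rw [intervalIntegral.integral_congr (g := fun x => -(((fun τ => Real.exp (v (c τ)) * ‖deriv c τ‖) ∘ σ) x * σ' x))]
    · rw [intervalIntegral.integral_neg]; exact neg_le_abs _
    · intro x hx
      apply abs_of_nonpos
      apply mul_nonpos_of_nonneg_of_nonpos
      · simp only [Function.comp]; positivity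
      · simp only [hσ']
        have := hsgn x hx
        have h2 : 0 ≤ s - t := by linarith
        have : 0 ≤ (s - t) * ((Real.sin (Real.pi / 2 * x) * Real.cos (Real.pi / 2 * x)) * Real.pi) := by positivity
        linarith

lemma path_limit (v : ℂ → ℝ) (hv : Continuous v) (hcomp : ConfComplete v) (c : ℝ → ℂ)
    (hc : ∀ τ ∈ Set.Ico (0:ℝ) 1, ContDiffAt ℝ 1 c τ)
    (hi : IntervalIntegrable (fun τ => Real.exp (v (c τ)) * ‖deriv c τ‖) volume 0 1) :
    ∃ l, Tendsto (fun n : ℕ => c (1 - 1 / ((n:ℝ) + 1))) atTop (𝓝 l) := by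
  set g := fun τ => Real.exp (v (c τ)) * ‖deriv c τ‖ with hg
  set T : ℕ → ℝ := fun n => 1 - 1 / ((n:ℝ) + 1) with hT
  have hT01 : ∀ n, T n ∈ Set.Ico (0:ℝ) 1 := by
    intro n
    have : (0:ℝ) < 1 / ((n:ℝ) + 1) := by positivity
    have h2 : 1 / ((n:ℝ) + 1) ≤ 1 := by rw [div_le_one (by positivity)]; linarith [n.cast_nonneg (α := ℝ)]
    constructor <;> simp only [hT] <;> linarith
  have hTl : Tendsto T atTop (𝓝 1) := by
    have := (tendsto_one_div_add_atTop_nhds_zero_nat (𝕜 := ℝ)).const_sub 1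
    simpa [hT] using this
  have hG : ContinuousOn (fun t => ∫ τ in (0:ℝ)..t, g τ) (Set.uIcc 0 1) :=
    intervalIntegral.continuousOn_primitive_interval' hi (by simp)
  have hGl : Tendsto (fun n => ∫ τ in (0:ℝ)..(T n), g τ) atTop (𝓝 (∫ τ in (0:ℝ)..1, g τ)) := by
    have h1 := hG 1 (by simp)
    refine h1.tendsto.comp (tendsto_nhdsWithin_iff.2 ⟨hTl, Eventually.of_forall fun n => ?_⟩)
    rw [Set.uIcc_of_le (by norm_num)]
    exact ⟨(hT01 n).1, (hT01 n).2.le⟩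
  have hcau := hGl.cauchySeq
  have hsubI : ∀ a b, IntervalIntegrable g volume (T a) (T b) := by
    intro a b
    apply hi.mono_set
    rw [Set.uIcc_of_le (by norm_num : (0:ℝ) ≤ 1)]
    exact Set.uIcc_subset_Icc ⟨(hT01 a).1, (hT01 a).2.le⟩ ⟨(hT01 b).1, (hT01 b).2.le⟩
  have h0I : ∀ b, IntervalIntegrable g volume 0 (T b) := by
    intro b
    apply hi.mono_set
    rw [Set.uIcc_of_le (by norm_num : (0:ℝ) ≤ 1)]
    exact Set.uIcc_subset_Icc (by simp) ⟨(hT01 b).1, (hT01 b).2.le⟩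
  obtain ⟨l, hl⟩ := hcomp (fun n => c (T n)) (by
    intro ε hε
    obtain ⟨N, hN⟩ := Metric.cauchySeq_iff.1 hcau ε hε
    refine ⟨N, fun m hm n hn => ?_⟩
    have h1 := confDist_curve v hv c (T m) (T n) (by
      intro τ hτ
      rw [Set.mem_uIcc] at hτ
      apply hc
      have a1 := hT01 m
      have a2 := hT01 n
      rcases hτ with h | h
      · exact ⟨a1.1.trans h.1, h.2.trans_lt a2.2⟩
      · exact ⟨a2.1.trans h.1, h.2.trans_lt a1.2⟩)
    refine h1.trans_lt ?_
    have h2 := hN n hn m hm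
    rw [Real.dist_eq, intervalIntegral.integral_interval_sub_left (h0I n) (h0I m)] at h2
    exact h2)
  refine ⟨l, ?_⟩
  rw [Metric.tendsto_nhds]
  intro ε hε
  obtain ⟨z, hz, hmin⟩ := (isCompact_closedBall l ε).exists_isMinOn ⟨l, by simp [hε.le]⟩
    ((Real.continuous_exp.comp hv).continuousOn)
  have hm : 0 < Real.exp (v z) := Real.exp_pos _
  filter_upwards [hl.eventually (gt_mem_nhds (show 0 < Real.exp (v z) * ε by positivity))] with n hn
  by_contra hcon
  rw [dist_eq_norm, not_lt] at hcon
  have := confDist_ge v hv l ε _ hε hm (fun y hy => hmin hy) _ hcon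
  linarith

lemma Lkoebe (H : ℂ → ℂ) (R : ℝ) (hR : 0 < R) (hH : DifferentiableOn ℂ H (ball 0 R)) (hinj : Set.InjOn H (ball 0 R))
    (hd : ∀ w ∈ ball (0:ℂ) R, deriv H w ≠ 0) :
    ∃ c, 0 < c ∧ ∀ y, ∃ w' : ℂ, ∀ w ∈ ball (0:ℂ) R,
      c * (1 - ‖w‖ / R) ^ (4 * CK) * min (R - ‖w‖) ‖w - w'‖ ≤ ‖H w - y‖ := by
  have h0 : 0 < ‖deriv H 0‖ := norm_pos_iff.2 (hd 0 (by simpa using hR))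
  have hCK := CK_pos
  refine ⟨‖deriv H 0‖ / CK, by positivity, fun y => ?_⟩
  have key : ∀ w' : ℂ, (∀ z ∈ ball (0:ℂ) R, H z = y → z = w') → ∀ w ∈ ball (0:ℂ) R,
      ‖deriv H 0‖ / CK * (1 - ‖w‖ / R) ^ (4 * CK) * min (R - ‖w‖) ‖w - w'‖ ≤ ‖H w - y‖ := by
    intro w' hw' w hw
    have hwR : ‖w‖ < R := by simpa using hw
    rcases eq_or_ne w w' with rfl | hne
    · simp only [sub_self, norm_zero]
      rw [min_eq_right (by linarith), mul_zero]; positivity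
    have hρ : 0 < min (R - ‖w‖) ‖w - w'‖ := lt_min (by linarith) (norm_pos_iff.2 (sub_ne_zero.2 hne))
    have hsub : ball w (min (R - ‖w‖) ‖w - w'‖) ⊆ ball 0 R := by
      intro z hz
      rw [mem_ball_zero_iff]
      rw [mem_ball, dist_eq_norm] at hz
      have h1 := hz.trans_le (min_le_left _ _)
      have h2 : ‖z‖ ≤ ‖z - w‖ + ‖w‖ := by simpa using norm_add_le (z - w) w
      linarith
    have h1 := koebeK H w y _ hρ (hH.mono hsub) (hinj.mono hsub) (by
      intro z hz he
      have := hw' z (hsub hz) he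
      subst this
      rw [mem_ball, dist_eq_norm, norm_sub_rev] at hz
      exact absurd (hz.trans_le (min_le_right _ _)) (lt_irrefl _))
    have h2 := (distE H R hR hH hinj hd w hw).1
    rw [div_mul_eq_mul_div, div_mul_eq_mul_div, div_le_iff₀ hCK]
    calc _ ≤ ‖deriv H w‖ * min (R - ‖w‖) ‖w - w'‖ := by gcongr
      _ ≤ _ := h1
      _ = _ := mul_comm _ _
  by_cases h : ∃ z ∈ ball (0:ℂ) R, H z = y
  · obtain ⟨z, hz, hzy⟩ := h
    exact ⟨z, key z fun z' hz' he => hinj hz' hz (he.trans hzy.symm)⟩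
  · exact ⟨0, key 0 fun z' hz' he => absurd ⟨z', hz', he⟩ h⟩

lemma inv_int_bound (ρ : ℝ) : ∃ C, 0 < C ∧ ∀ x : ℂ, ∫ y in ball (0:ℂ) ρ, ‖x - y‖⁻¹ ≤ C := by
  obtain ⟨C, hC, h⟩ := kint 1 (by norm_num) (by norm_num) ρ
  refine ⟨C, hC, fun x => ?_⟩
  rw [integral_eq_lintegral_of_nonneg_ae (Eventually.of_forall fun y => by positivity)
    (inv_integrable_ball x ρ).aestronglyMeasurable]
  apply ENNReal.toReal_le_of_le_ofReal hC.le
  refine le_trans (le_of_eq ?_) (h x)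
  congr 1; ext y
  rw [Real.rpow_neg_one, norm_sub_rev]

lemma tail_small (ω : ℂ → ℝ) (hi : Integrable ω) (δ : ℝ) (hδ : 0 < δ) :
    ∃ R₀ : ℝ, ∫ y in (ball (0:ℂ) R₀)ᶜ, |ω y| ≤ δ := by
  have h := tendsto_setIntegral_of_antitone (μ := volume) (s := fun n : ℕ => (ball (0:ℂ) n)ᶜ) (f := fun y => |ω y|)
    (fun n => measurableSet_ball.compl) (by
      intro a b hab
      exact Set.compl_subset_compl.2 (ball_subset_ball (by exact_mod_cast hab))) ⟨0, hi.abs.integrableOn⟩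
  have he : (⋂ n : ℕ, (ball (0:ℂ) n)ᶜ) = ∅ := by
    rw [← Set.compl_iUnion, iUnion_ball_nat, Set.compl_univ]
  rw [he, setIntegral_empty] at h
  obtain ⟨n, hn⟩ := (h.eventually (gt_mem_nhds hδ)).exists
  exact ⟨n, hn.le⟩

lemma Lg_split (x : ℂ) (ω : ℂ → ℝ) (hc : Continuous ω) (hi : Integrable ω) (B : Set ℂ) (hB : MeasurableSet B) :
    ∫ y, Lg x y * |ω y| = (∫ y in B, Lg x y * |ω y|) + ∫ y in Bᶜ, Lg x y * |ω y| :=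
  (integral_add_compl hB (Lg_integrable x ω hc hi)).symm

lemma Lg_inner (ω : ℂ → ℝ) (hc : Continuous ω) (hi : Integrable ω) (ρ : ℝ) :
    ∃ C, ∀ x, ∫ y in ball (0:ℂ) ρ, Lg x y * |ω y| ≤ C := by
  obtain ⟨S, hS⟩ := (isCompact_closedBall (0:ℂ) ρ).exists_bound_of_continuousOn hc.continuousOn
  obtain ⟨C, hC, h⟩ := inv_int_bound ρ
  refine ⟨C * |S|, fun x => ?_⟩
  calc ∫ y in ball (0:ℂ) ρ, Lg x y * |ω y| ≤ ∫ y in ball (0:ℂ) ρ, ‖x - y‖⁻¹ * |S| := by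
        apply setIntegral_mono_on (Lg_integrable x ω hc hi).integrableOn ((inv_integrable_ball x ρ).mul_const _) measurableSet_ball
        intro y hy
        have h1 := (hS y (ball_subset_closedBall hy)).trans (le_abs_self S)
        exact mul_le_mul (Lg_le x y) h1 (abs_nonneg _) (by positivity)
    _ = (∫ y in ball (0:ℂ) ρ, ‖x - y‖⁻¹) * |S| := integral_mul_const _ _
    _ ≤ _ := by gcongr; exact h x

lemma speed_bound (v : ℂ → ℝ) (ω : ℂ → ℝ) (hc : Continuous ω) (hi : Integrable ω) (F : ℂ → ℂ)
    (hv : ∀ x, v x = Np ω x + (F x).re) (n : ℕ) (hn : (2 * Real.pi)⁻¹ * ∫ y, |ω y| ≤ n)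
    (H : ℂ → ℂ) (R : ℝ) (hR : 0 < R) (hH : DifferentiableOn ℂ H (ball 0 R)) (hinj : Set.InjOn H (ball 0 R))
    (hd : ∀ w ∈ ball (0:ℂ) R, deriv H w ≠ 0) (hH0 : H 0 = 0)
    (hrel : ∀ w ∈ ball (0:ℂ) R, H w ^ n * Complex.exp (F (H w)) * deriv H w = w ^ n) (R₀ : ℝ) :
    ∃ C, 0 < C ∧ ∀ w ∈ ball (0:ℂ) R, R / 4 ≤ ‖w‖ → Real.exp (v (H w)) * ‖deriv H w‖ ≤
      C * Real.exp ((2 * Real.pi)⁻¹ * ∫ y in (ball (0:ℂ) R₀)ᶜ, Lg (H w) y * |ω y|) := by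
  have h0 : 0 < ‖deriv H 0‖ := norm_pos_iff.2 (hd 0 (by simpa using hR))
  have hCK := CK_pos
  obtain ⟨C1, hC1⟩ := Lg_inner ω hc hi R₀
  set c₀ := ‖deriv H 0‖ * (R / 4) / CK with hc₀
  have hc₀p : 0 < c₀ := by positivity
  refine ⟨R ^ n * (1 + c₀⁻¹) ^ n * Real.exp ((2 * Real.pi)⁻¹ * C1), by positivity, fun w hw hw4 => ?_⟩
  have hwR : ‖w‖ < R := by simpa using hw
  have hHw : c₀ ≤ ‖H w‖ := by
    have hsub : ball (0:ℂ) (R/4) ⊆ ball 0 R := ball_subset_ball (by linarith)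
    have := koebeK H 0 (H w) (R/4) (by positivity) (hH.mono hsub) (hinj.mono hsub) (by
      intro z hz he
      have := hinj (hsub hz) hw he
      subst this
      rw [mem_ball_zero_iff] at hz
      linarith)
    rw [hH0, zero_sub, norm_neg] at this
    rw [hc₀, div_le_iff₀ hCK]; linarith
  have hx : 0 < ‖H w‖ := hc₀p.trans_le hHw
  have hr := congrArg norm (hrel w hw)
  rw [norm_mul, norm_mul, norm_pow, norm_pow, Complex.norm_exp] at hr
  have e1 : Real.exp ((F (H w)).re) * ‖deriv H w‖ = ‖w‖ ^ n * (‖H w‖⁻¹) ^ n := by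
    rw [← hr, inv_pow]; field_simp
  have h1 := Np_le (H w) ω hc hi
  rw [Lg_split (H w) ω hc hi _ (measurableSet_ball (x := (0:ℂ)) (ε := R₀))] at h1
  have hlog : 0 ≤ Real.log (1 + ‖H w‖) := Real.log_nonneg (by linarith)
  have h2 : Np ω (H w) ≤ n * Real.log (1 + ‖H w‖) + (2 * Real.pi)⁻¹ * C1 +
      (2 * Real.pi)⁻¹ * ∫ y in (ball (0:ℂ) R₀)ᶜ, Lg (H w) y * |ω y| := by
    have a1 := mul_le_mul_of_nonneg_right hn hlog
    have a2 := mul_le_mul_of_nonneg_left (hC1 (H w)) (show 0 ≤ (2 * Real.pi)⁻¹ by positivity)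
    linarith
  have h3 : Real.exp (Np ω (H w)) ≤ (1 + ‖H w‖) ^ n * Real.exp ((2 * Real.pi)⁻¹ * C1) *
      Real.exp ((2 * Real.pi)⁻¹ * ∫ y in (ball (0:ℂ) R₀)ᶜ, Lg (H w) y * |ω y|) := by
    refine (Real.exp_le_exp.2 h2).trans (le_of_eq ?_)
    rw [Real.exp_add, Real.exp_add, Real.exp_nat_mul, Real.exp_log (by positivity)]
  rw [hv, Real.exp_add, mul_assoc, e1]
  have h4 : (1 + ‖H w‖) * ‖H w‖⁻¹ ≤ 1 + c₀⁻¹ := by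
    rw [add_mul, one_mul, mul_inv_cancel₀ hx.ne', add_comm]
    gcongr
  calc _ ≤ ((1 + ‖H w‖) ^ n * Real.exp ((2 * Real.pi)⁻¹ * C1) *
      Real.exp ((2 * Real.pi)⁻¹ * ∫ y in (ball (0:ℂ) R₀)ᶜ, Lg (H w) y * |ω y|)) * (R ^ n * (‖H w‖⁻¹) ^ n) := by gcongr
    _ = R ^ n * ((1 + ‖H w‖) * ‖H w‖⁻¹) ^ n * Real.exp ((2 * Real.pi)⁻¹ * C1) *
      Real.exp ((2 * Real.pi)⁻¹ * ∫ y in (ball (0:ℂ) R₀)ᶜ, Lg (H w) y * |ω y|) := by rw [mul_pow]; ring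
    _ ≤ _ := by gcongr

def Wp (w₀ s : ℂ) (t : ℝ) : ℂ := (t:ℂ) * w₀ + ((1 - t : ℝ) : ℂ) * s

lemma Wp_norm (w₀ s : ℂ) (R t : ℝ) (hR : 0 < R) (hw : ‖w₀‖ = R) (hs : s ∈ ball (w₀ / 2) (R / 4)) (ht : t ∈ Set.Ico (0:ℝ) 1) :
    ‖Wp w₀ s t‖ ≤ R - (1 - t) * (R / 4) ∧ R / 4 ≤ ‖Wp w₀ s t‖ := by
  have e : Wp w₀ s t = (((1 + t) / 2 : ℝ) : ℂ) * w₀ + ((1 - t : ℝ) : ℂ) * (s - w₀ / 2) := by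
    unfold Wp; push_cast; ring
  rw [mem_ball, dist_eq_norm] at hs
  have h1 : ‖(((1 + t) / 2 : ℝ) : ℂ) * w₀‖ = (1 + t) / 2 * R := by
    rw [norm_mul, hw, Complex.norm_real, Real.norm_of_nonneg (by linarith [ht.1])]
  have h2 : ‖((1 - t : ℝ) : ℂ) * (s - w₀ / 2)‖ ≤ (1 - t) * (R / 4) := by
    rw [norm_mul, Complex.norm_real, Real.norm_of_nonneg (by linarith [ht.2])]
    have : 0 ≤ 1 - t := by linarith [ht.2]
    gcongr
  rw [e]
  constructor
  · refine (norm_add_le _ _).trans ?_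
    rw [h1]; nlinarith
  · have h3 := norm_sub_norm_le ((((1 + t) / 2 : ℝ) : ℂ) * w₀) (-(((1 - t : ℝ) : ℂ) * (s - w₀ / 2)))
    rw [sub_neg_eq_add, norm_neg, h1] at h3
    nlinarith [ht.1]

lemma avg_bound (H : ℂ → ℂ) (R : ℝ) (hR : 0 < R) (hH : DifferentiableOn ℂ H (ball 0 R)) (hinj : Set.InjOn H (ball 0 R))
    (hd : ∀ w ∈ ball (0:ℂ) R, deriv H w ≠ 0) (w₀ : ℂ) (hw : ‖w₀‖ = R) (δ : ℝ) (hδ : δ = (2 * (4 * CK + 1))⁻¹) :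
    ∃ K, 0 < K ∧ ∀ y, ∀ t ∈ Set.Ico (0:ℝ) 1,
      ∫⁻ s in ball (w₀ / 2) (R / 4), ENNReal.ofReal (‖H (Wp w₀ s t) - y‖ ^ (-δ)) ≤ ENNReal.ofReal (K * (1 - t) ^ (-(1/2):ℝ)) := by
  obtain ⟨c, hc, hL⟩ := Lkoebe H R hR hH hinj hd
  have hCK := CK_pos
  have hδ0 : 0 < δ := by rw [hδ]; positivity
  have hδ1 : δ < 2 := by
    rw [hδ]; apply inv_lt_of_inv_lt₀ (by norm_num); linarith
  obtain ⟨K1, hK1, hk⟩ := kint δ hδ0.le hδ1 R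
  have hsub : ball (w₀ / 2) (R / 4) ⊆ ball 0 R := by
    apply ball_subset_ball'
    rw [dist_zero_right, norm_div, hw]; norm_num; linarith
  obtain ⟨K2, hK2, hk2⟩ := kint 0 le_rfl (by norm_num) R
  set a := c * (1 / 4) ^ (4 * CK) with ha
  have hap : 0 < a := by positivity
  refine ⟨a ^ (-δ) * ((R/4) ^ (-δ) * K2 + K1), by positivity, fun y t ht => ?_⟩
  obtain ⟨w', hw'⟩ := hL y
  have h1t : 0 < 1 - t := by linarith [ht.2]
  set s' : ℂ := (w' - (t:ℂ) * w₀) / ((1 - t : ℝ) : ℂ) with hs'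
  have hne : ((1 - t : ℝ) : ℂ) ≠ 0 := by exact_mod_cast h1t.ne'
  have hpt : ∀ s ∈ ball (w₀ / 2) (R / 4), s' ≠ s → ‖H (Wp w₀ s t) - y‖ ^ (-δ) ≤
      a ^ (-δ) * (1 - t) ^ (-(1/2):ℝ) * ((R/4) ^ (-δ) * ‖s - 0‖ ^ (-(0:ℝ)) + ‖s - s'‖ ^ (-δ)) := by
    intro s hs hss
    obtain ⟨n1, n2⟩ := Wp_norm w₀ s R t hR hw hs ht
    have hwb : Wp w₀ s t ∈ ball (0:ℂ) R := by
      rw [mem_ball_zero_iff]; nlinarith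
    have h1 := hw' _ hwb
    have e1 : ‖Wp w₀ s t - w'‖ = (1 - t) * ‖s - s'‖ := by
      have : Wp w₀ s t - w' = ((1 - t : ℝ) : ℂ) * (s - s') := by
        rw [hs', mul_sub, mul_div_cancel₀ _ hne]; unfold Wp; ring
      rw [this, norm_mul, Complex.norm_real, Real.norm_of_nonneg h1t.le]
    have hp : 0 < ‖s - s'‖ := norm_pos_iff.2 (sub_ne_zero.2 hss.symm)
    have hm : 0 < min (R / 4) ‖s - s'‖ := lt_min (by positivity) hp
    have e2 : (1 - t) * min (R / 4) ‖s - s'‖ ≤ min (R - ‖Wp w₀ s t‖) ‖Wp w₀ s t - w'‖ := by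
      apply le_min
      · have := mul_le_mul_of_nonneg_left (min_le_left (R/4) ‖s - s'‖) h1t.le
        linarith
      · rw [e1]; exact mul_le_mul_of_nonneg_left (min_le_right _ _) h1t.le
    have e3 : (1 - t) * (1 / 4) ≤ 1 - ‖Wp w₀ s t‖ / R := by
      have h5 : ‖Wp w₀ s t‖ / R ≤ 1 - (1 - t) * (1 / 4) := by
        rw [div_le_iff₀ hR]; nlinarith
      linarith
    have e30 : 0 ≤ 1 - ‖Wp w₀ s t‖ / R := by linarith
    have e4 : a * (1 - t) ^ (4 * CK + 1) * min (R / 4) ‖s - s'‖ ≤ ‖H (Wp w₀ s t) - y‖ := by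
      refine le_trans ?_ h1
      rw [Real.rpow_add_one h1t.ne']
      calc _ = c * ((1 - t) * (1/4)) ^ (4 * CK) * ((1 - t) * min (R / 4) ‖s - s'‖) := by
            rw [Real.mul_rpow h1t.le (by norm_num)]; ring
        _ ≤ _ := by gcongr
    have hpp : 0 < a * (1 - t) ^ (4 * CK + 1) * min (R / 4) ‖s - s'‖ := by positivity
    refine (Real.rpow_le_rpow_of_nonpos hpp e4 (by linarith)).trans ?_
    rw [Real.mul_rpow (by positivity) hm.le, Real.mul_rpow hap.le (by positivity), ← Real.rpow_mul h1t.le]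
    have e5 : (4 * CK + 1) * -δ = (-(1/2):ℝ) := by rw [hδ]; field_simp
    rw [e5]
    have hs0 : ‖s - 0‖ ^ (-(0:ℝ)) = 1 := by simp
    rw [hs0, mul_one]
    gcongr
    rcases min_choice (R / 4) ‖s - s'‖ with h | h <;> rw [h]
    · linarith [Real.rpow_nonneg (norm_nonneg (s - s')) (-δ)]
    · linarith [Real.rpow_nonneg (show 0 ≤ R / 4 by positivity) (-δ)]
  have hmono : ∫⁻ s in ball (w₀ / 2) (R / 4), ENNReal.ofReal (‖H (Wp w₀ s t) - y‖ ^ (-δ)) ≤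
      ∫⁻ s in ball (w₀ / 2) (R / 4), ENNReal.ofReal (a ^ (-δ) * (1 - t) ^ (-(1/2):ℝ)) *
        (ENNReal.ofReal ((R/4) ^ (-δ)) * ENNReal.ofReal (‖s - 0‖ ^ (-(0:ℝ))) + ENNReal.ofReal (‖s - s'‖ ^ (-δ))) := by
    apply lintegral_mono_ae
    filter_upwards [ae_restrict_mem measurableSet_ball, ae_restrict_of_ae (ae_ne_c s')] with s hs hss
    rw [← ENNReal.ofReal_mul (by positivity), ← ENNReal.ofReal_add (by positivity) (by positivity),
      ← ENNReal.ofReal_mul (by positivity)]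
    exact ENNReal.ofReal_le_ofReal (hpt s hs hss)
  refine hmono.trans ?_
  rw [lintegral_const_mul _ (by fun_prop), lintegral_add_left (by fun_prop), lintegral_const_mul _ (by fun_prop)]
  have e1 := (lintegral_mono_set (μ := volume) (f := fun s : ℂ => ENNReal.ofReal (‖s - s'‖ ^ (-δ))) hsub).trans (hk s')
  have e2 := (lintegral_mono_set (μ := volume) (f := fun s : ℂ => ENNReal.ofReal (‖s - 0‖ ^ (-(0:ℝ)))) hsub).trans (hk2 0)
  calc _ ≤ ENNReal.ofReal (a ^ (-δ) * (1 - t) ^ (-(1/2):ℝ)) * (ENNReal.ofReal ((R/4) ^ (-δ)) * ENNReal.ofReal K2 + ENNReal.ofReal K1) := by gcongr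
    _ = _ := by
      rw [← ENNReal.ofReal_mul (by positivity), ← ENNReal.ofReal_add (by positivity) (by positivity),
      ← ENNReal.ofReal_mul (by positivity)]
      congr 1; ring

lemma half_int : ∫⁻ t in Set.Ioo (0:ℝ) 1, ENNReal.ofReal ((1 - t) ^ (-(1/2):ℝ)) < ⊤ := by
  have h : IntervalIntegrable (fun t : ℝ => t ^ (-(1/2):ℝ)) volume 0 1 := intervalIntegral.intervalIntegrable_rpow' (by norm_num)
  have h2 := (h.comp_sub_left 1).symm
  simp only [sub_zero, sub_self] at h2
  rw [intervalIntegrable_iff_integrableOn_Ioo_of_le (by norm_num)] at h2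
  exact h2.lintegral_lt_top

set_option maxHeartbeats 400000 in
open scoped Classical in
lemma fin_len (v : ℂ → ℝ) (hvc : Continuous v) (ω : ℂ → ℝ) (hc : Continuous ω) (hi : Integrable ω) (F : ℂ → ℂ)
    (hv : ∀ x, v x = Np ω x + (F x).re) (n : ℕ) (hn : (2 * Real.pi)⁻¹ * ∫ y, |ω y| ≤ n)
    (H : ℂ → ℂ) (R : ℝ) (hR : 0 < R) (hH : DifferentiableOn ℂ H (ball 0 R)) (hinj : Set.InjOn H (ball 0 R))
    (hd : ∀ w ∈ ball (0:ℂ) R, deriv H w ≠ 0) (hH0 : H 0 = 0)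
    (hrel : ∀ w ∈ ball (0:ℂ) R, H w ^ n * Complex.exp (F (H w)) * deriv H w = w ^ n)
    (hcomp : ConfComplete v) (w₀ : ℂ) (hw : ‖w₀‖ = R) :
    ∃ (p : ℕ → ℂ) (l : ℂ), (∀ j, p j ∈ ball (0:ℂ) R) ∧ Tendsto p atTop (𝓝 w₀) ∧
      Tendsto (fun j => H (p j)) atTop (𝓝 l) := by
  have hCK := CK_pos
  obtain ⟨δ, hδ⟩ : ∃ δ : ℝ, δ = (2 * (4 * CK + 1))⁻¹ := ⟨_, rfl⟩
  have hδ0 : 0 < δ := by rw [hδ]; positivity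
  have hδ1 : δ < 2 := by
    rw [hδ]; apply inv_lt_of_inv_lt₀ (by norm_num); linarith
  set q := (2 * Real.pi)⁻¹ with hq
  have hqp : 0 < q := by positivity
  obtain ⟨R₀, hR₀⟩ := tail_small ω hi (δ / q) (by positivity)
  set A := (ball (0:ℂ) R₀)ᶜ with hA
  have hAm : MeasurableSet A := measurableSet_ball.compl
  obtain ⟨C, hC, hsp⟩ := speed_bound v ω hc hi F hv n hn H R hR hH hinj hd hH0 hrel R₀
  obtain ⟨K, hK, havg⟩ := avg_bound H R hR hH hinj hd w₀ hw δ hδ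
  set S := ball (w₀ / 2) (R / 4) with hS
  set B : ℂ → ℝ≥0∞ := fun x => 1 + ENNReal.ofReal (4 / δ) *
    ∫⁻ y in A, (1 + ENNReal.ofReal (‖x - y‖ ^ (-δ))) * ENNReal.ofReal (q * |ω y|) with hB
  have hωm : Measurable ω := hc.measurable
  have hBm : Measurable B := by
    refine Measurable.const_add (Measurable.const_mul ?_ _) _
    apply Measurable.lintegral_prod_right'
      (f := fun z : ℂ × ℂ => (1 + ENNReal.ofReal (‖z.1 - z.2‖ ^ (-δ))) * ENNReal.ofReal (q * |ω z.2|))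
    have : Measurable (fun z : ℂ × ℂ => |ω z.2|) := (hωm.comp measurable_snd).norm
    fun_prop
  have hmaster : ∀ x, ENNReal.ofReal (Real.exp (q * ∫ y in A, Lg x y * |ω y|)) ≤ B x := fun x =>
    exp_master x ω hc hi A hAm q δ hqp.le hδ0 hδ1 (by
      rw [le_div_iff₀ hqp] at hR₀; linarith)
  -- measurable version of H
  set Ht : ℂ → ℂ := (ball (0:ℂ) R).piecewise H (fun _ => 0) with hHt
  have hHtm : Measurable Ht := hH.continuousOn.measurable_piecewise continuousOn_const measurableSet_ball
  have hHte : ∀ w ∈ ball (0:ℂ) R, Ht w = H w := fun w hw => Set.piecewise_eq_of_mem _ _ _ hw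
  have hWb : ∀ s ∈ S, ∀ t ∈ Set.Ico (0:ℝ) 1, Wp w₀ s t ∈ ball (0:ℂ) R := by
    intro s hs t ht
    have := (Wp_norm w₀ s R t hR hw hs ht).1
    rw [mem_ball_zero_iff]; nlinarith [ht.2]
  have hWm : Measurable (fun z : ℂ × ℝ => Wp w₀ z.1 z.2) := by
    unfold Wp; fun_prop
  have hm1 : Measurable (fun z : ℂ × ℝ => B (Ht (Wp w₀ z.1 z.2))) := hBm.comp (hHtm.comp hWm)
  set I := ∫⁻ y in A, ENNReal.ofReal (q * |ω y|) with hI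
  have hIfin : I < ⊤ := ((hi.abs.const_mul q).integrableOn).lintegral_lt_top
  have hSfin : volume S < ⊤ := measure_ball_lt_top
  have hin : ∀ t ∈ Set.Ioo (0:ℝ) 1, ∫⁻ s in S, B (Ht (Wp w₀ s t)) ≤
      volume S + ENNReal.ofReal (4 / δ) * ((volume S + ENNReal.ofReal K * ENNReal.ofReal ((1 - t) ^ (-(1/2):ℝ))) * I) := by
    intro t ht
    have ht' : t ∈ Set.Ico (0:ℝ) 1 := ⟨ht.1.le, ht.2⟩
    have hWt : Measurable (fun s => Wp w₀ s t) := by unfold Wp; fun_prop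
    have hm2 : Measurable (fun z : ℂ × ℂ => (1 + ENNReal.ofReal (‖Ht (Wp w₀ z.1 t) - z.2‖ ^ (-δ))) * ENNReal.ofReal (q * |ω z.2|)) := by
      have h1 : Measurable (fun z : ℂ × ℂ => |ω z.2|) := (hωm.comp measurable_snd).norm
      have h2 : Measurable (fun z : ℂ × ℂ => Ht (Wp w₀ z.1 t)) := hHtm.comp (hWt.comp measurable_fst)
      fun_prop
    simp only [hB]
    rw [lintegral_add_left measurable_const, lintegral_const_mul _ (Measurable.lintegral_prod_right' hm2),
      lintegral_one, Measure.restrict_apply_univ]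
    gcongr
    rw [lintegral_lintegral_swap hm2.aemeasurable, hI, ← lintegral_const_mul _ (by
      have := hωm.norm; simp only [Real.norm_eq_abs] at this; fun_prop)]
    apply lintegral_mono
    intro y
    have hm3 : Measurable (fun s => ENNReal.ofReal (‖Ht (Wp w₀ s t) - y‖ ^ (-δ))) := by
      have h2 : Measurable (fun s => Ht (Wp w₀ s t)) := hHtm.comp hWt
      fun_prop
    dsimp only
    rw [lintegral_mul_const _ (hm3.const_add 1), lintegral_add_left measurable_const, lintegral_one,
      Measure.restrict_apply_univ]
    gcongr
    rw [← ENNReal.ofReal_mul hK.le]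
    refine le_trans (le_of_eq ?_) (havg y t ht')
    apply setLIntegral_congr_fun measurableSet_ball
    intro s hs
    dsimp only
    rw [hHte _ (hWb s hs t ht')]
  have hfin : ∫⁻ s in S, ∫⁻ t in Set.Ioo (0:ℝ) 1, B (Ht (Wp w₀ s t)) < ⊤ := by
    rw [lintegral_lintegral_swap hm1.aemeasurable]
    refine (setLIntegral_mono' measurableSet_Ioo hin).trans_lt ?_
    rw [lintegral_add_left measurable_const, lintegral_const_mul _ (by fun_prop), lintegral_mul_const _ (by fun_prop),
      lintegral_add_left measurable_const, lintegral_const_mul _ (by fun_prop)]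
    have h3 := half_int
    simp only [lintegral_const, Measure.restrict_apply_univ, Real.volume_Ioo, sub_zero, ENNReal.ofReal_one, mul_one]
    exact ENNReal.add_lt_top.2 ⟨hSfin, ENNReal.mul_lt_top ENNReal.ofReal_lt_top (ENNReal.mul_lt_top
      (ENNReal.add_lt_top.2 ⟨hSfin, ENNReal.mul_lt_top ENNReal.ofReal_lt_top h3⟩) hIfin)⟩
  have hae := ae_lt_top (Measurable.lintegral_prod_right' hm1) hfin.ne
  obtain ⟨s, hsf, hsS⟩ : ∃ s, (∫⁻ t in Set.Ioo (0:ℝ) 1, B (Ht (Wp w₀ s t)) < ⊤) ∧ s ∈ S := by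
    have h1 : (volume.restrict S) ≠ 0 := by
      rw [Ne, Measure.restrict_eq_zero]
      exact (measure_ball_pos volume _ (by positivity)).ne'
    have : (ae (volume.restrict S)).NeBot := ae_neBot.2 h1
    exact (hae.and (ae_restrict_mem measurableSet_ball)).exists
  -- the curve
  set c : ℝ → ℂ := fun t => H (Wp w₀ s t) with hcdef
  have hWd : ∀ t, HasDerivAt (fun t => Wp w₀ s t) (w₀ - s) t := by
    intro t
    have h1 : HasDerivAt (fun t : ℝ => (t:ℂ)) 1 t := Complex.ofRealCLM.hasDerivAt
    have h2 : HasDerivAt (fun t : ℝ => s + (t:ℂ) * (w₀ - s)) (1 * (w₀ - s)) t := (h1.mul_const _).const_add _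
    rw [one_mul] at h2
    convert h2 using 1
    ext t; unfold Wp; push_cast; ring
  have hWcd : ContDiff ℝ 1 (fun t => Wp w₀ s t) := by
    have : ContDiff ℝ 1 (fun t : ℝ => (t:ℂ)) := Complex.ofRealCLM.contDiff
    unfold Wp; push_cast; fun_prop
  have hcd : ∀ t ∈ Set.Ico (0:ℝ) 1, ContDiffAt ℝ 1 c t := by
    intro t ht
    have h1 : ContDiffAt ℂ 1 H (Wp w₀ s t) :=
      (hH.analyticAt (isOpen_ball.mem_nhds (hWb s hsS t ht))).contDiffAt
    exact (h1.restrict_scalars ℝ).comp t hWcd.contDiffAt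
  have hder : ∀ t ∈ Set.Ico (0:ℝ) 1, deriv c t = (w₀ - s) * deriv H (Wp w₀ s t) := by
    intro t ht
    have h1 : HasDerivAt H (deriv H (Wp w₀ s t)) (Wp w₀ s t) :=
      (hH.differentiableAt (isOpen_ball.mem_nhds (hWb s hsS t ht))).hasDerivAt
    have := (h1.scomp t (hWd t)).deriv
    rw [smul_eq_mul] at this
    exact this
  have hgcont : ContinuousOn (fun t => Real.exp (v (c t)) * ‖deriv c t‖) (Set.Ioo 0 1) := by
    intro t ht
    have ht' : t ∈ Set.Ico (0:ℝ) 1 := ⟨ht.1.le, ht.2⟩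
    have h1 : ContinuousAt c t := (hcd t ht').continuousAt
    have h2 : ContinuousAt (deriv c) t := by
      have h3 := ((hcd t ht').fderiv_right (m := 0) (by norm_num)).continuousAt
      have : deriv c = fun x => fderiv ℝ c x 1 := by ext x; rw [fderiv_apply_one_eq_deriv]
      rw [this]
      exact h3.clm_apply continuousAt_const
    have h3 : ContinuousAt (fun τ => v (c τ)) t := (hvc.continuousAt).comp h1
    exact (h3.rexp.mul h2.norm).continuousWithinAt
  have hint : IntervalIntegrable (fun t => Real.exp (v (c t)) * ‖deriv c t‖) volume 0 1 := by
    rw [intervalIntegrable_iff_integrableOn_Ioo_of_le (by norm_num)]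
    refine ⟨hgcont.aestronglyMeasurable measurableSet_Ioo, ?_⟩
    rw [hasFiniteIntegral_iff_ofReal (Eventually.of_forall fun t => by positivity)]
    have hle : ∀ t ∈ Set.Ioo (0:ℝ) 1, ENNReal.ofReal (Real.exp (v (c t)) * ‖deriv c t‖) ≤
        ENNReal.ofReal (‖w₀ - s‖ * C) * B (Ht (Wp w₀ s t)) := by
      intro t ht
      have ht' : t ∈ Set.Ico (0:ℝ) 1 := ⟨ht.1.le, ht.2⟩
      have h1 := hsp _ (hWb s hsS t ht') (Wp_norm w₀ s R t hR hw hsS ht').2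
      rw [hHte _ (hWb s hsS t ht')]
      refine le_trans ?_ (mul_le_mul_right (hmaster _) _)
      rw [← ENNReal.ofReal_mul (by positivity)]
      apply ENNReal.ofReal_le_ofReal
      rw [hder t ht', norm_mul]
      calc _ = ‖w₀ - s‖ * (Real.exp (v (c t)) * ‖deriv H (Wp w₀ s t)‖) := by ring
        _ ≤ ‖w₀ - s‖ * (C * _) := by gcongr
        _ = _ := by ring
    refine (setLIntegral_mono' measurableSet_Ioo hle).trans_lt ?_
    have hm5 : Measurable (fun t => B (Ht (Wp w₀ s t))) := hBm.comp (hHtm.comp hWcd.continuous.measurable)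
    rw [lintegral_const_mul _ hm5]
    exact ENNReal.mul_lt_top ENNReal.ofReal_lt_top hsf
  obtain ⟨l, hl⟩ := path_limit v hvc hcomp c hcd hint
  refine ⟨fun j => Wp w₀ s (1 - 1 / ((j:ℝ) + 1)), l, fun j => ?_, ?_, hl⟩
  · apply hWb s hsS
    have : (0:ℝ) < 1 / ((j:ℝ) + 1) := by positivity
    have h2 : 1 / ((j:ℝ) + 1) ≤ 1 := by rw [div_le_one (by positivity)]; linarith [j.cast_nonneg (α := ℝ)]
    constructor <;> linarith
  · have h1 : Tendsto (fun n : ℕ => 1 - 1 / ((n:ℝ) + 1)) atTop (𝓝 1) := by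
      simpa using (tendsto_one_div_add_atTop_nhds_zero_nat (𝕜 := ℝ)).const_sub 1
    have h2 := (hWcd.continuous.tendsto 1).comp h1
    have h3 : Wp w₀ s 1 = w₀ := by simp [Wp]
    rw [h3] at h2
    exact h2

lemma locinv (f : ℂ → ℂ) (a : ℂ) (hf : AnalyticAt ℂ f a) (hd : deriv f a ≠ 0) :
    ∃ Ψ : ℂ → ℂ, AnalyticAt ℂ Ψ (f a) ∧ Ψ (f a) = a ∧ (∀ᶠ x in 𝓝 a, Ψ (f x) = x) ∧ ∀ᶠ y in 𝓝 (f a), f (Ψ y) = y :=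
  ⟨_, hf.analyticAt_localInverse hd, HasStrictFDerivAt.localInverse_apply_image ..,
    HasStrictDerivAt.eventually_left_inverse .., HasStrictDerivAt.eventually_right_inverse ..⟩

lemma germ (n : ℕ) (F Φ : ℂ → ℂ) (hF : Differentiable ℂ F)
    (hΦ : ∀ z, HasDerivAt Φ (z ^ n * Complex.exp (F z)) z) (hΦ0 : Φ 0 = 0) :
    ∃ ρ, 0 < ρ ∧ ∃ H₀ : ℂ → ℂ, DifferentiableOn ℂ H₀ (ball 0 ρ) ∧ H₀ 0 = 0 ∧ deriv H₀ 0 ≠ 0 ∧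
      ∀ w ∈ ball (0:ℂ) ρ, (n + 1) * Φ (H₀ w) = w ^ (n + 1) := by
  have hΦd : Differentiable ℂ Φ := fun z => (hΦ z).differentiableAt
  have hΦa : AnalyticAt ℂ Φ 0 := hΦd.analyticAt 0
  have hderΦ : deriv Φ = fun z => z ^ n * Complex.exp (F z) := by ext z; exact (hΦ z).deriv
  have hfa : AnalyticAt ℂ (fun z => z ^ n * Complex.exp (F z)) 0 := by
    have : Differentiable ℂ (fun z => z ^ n * Complex.exp (F z)) := by fun_prop
    exact this.analyticAt 0
  have hordf : analyticOrderAt (fun z => z ^ n * Complex.exp (F z)) 0 = n := by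
    rw [hfa.analyticOrderAt_eq_natCast]
    refine ⟨fun z => Complex.exp (F z), ?_, Complex.exp_ne_zero _, by simp⟩
    have : Differentiable ℂ (fun z => Complex.exp (F z)) := by fun_prop
    exact this.analyticAt 0
  obtain ⟨E, hE, hE0, hEe⟩ : ∃ E : ℂ → ℂ, AnalyticAt ℂ E 0 ∧ E 0 ≠ 0 ∧ ∀ᶠ z in 𝓝 0, Φ z = z ^ (n + 1) * E z := by
    have hnt : analyticOrderAt Φ 0 ≠ ⊤ := by
      intro h
      rw [analyticOrderAt_eq_top] at h
      have h1 : Φ =ᶠ[𝓝 0] fun _ => 0 := h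
      have h2 := h1.deriv
      rw [hderΦ] at h2
      have h3 : analyticOrderAt (fun z => z ^ n * Complex.exp (F z)) 0 = ⊤ := by
        rw [analyticOrderAt_eq_top]
        filter_upwards [h2] with z hz
        rw [hz]; simp
      rw [hordf] at h3
      exact absurd h3 (ENat.natCast_ne_top n)
    obtain ⟨m, hm⟩ := ENat.ne_top_iff_exists.1 hnt
    obtain ⟨E, hE, hE0, hEe⟩ := hΦa.analyticOrderAt_eq_natCast.1 hm.symm
    simp only [sub_zero, smul_eq_mul] at hEe
    have hm0 : m ≠ 0 := by
      rintro rfl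
      have := hEe.self_of_nhds
      rw [hΦ0, pow_zero, one_mul] at this
      exact hE0 this.symm
    obtain ⟨k, rfl⟩ := Nat.exists_eq_succ_of_ne_zero hm0
    have hd : ∀ᶠ z in 𝓝 (0:ℂ), z ^ n * Complex.exp (F z) = (z - 0) ^ k • ((k + 1) * E z + z * deriv E z) := by
      have h1 : Φ =ᶠ[𝓝 0] fun z => z ^ (k + 1) * E z := hEe
      have h2 := h1.deriv
      rw [hderΦ] at h2
      filter_upwards [h2, hE.eventually_analyticAt] with z hz hza
      rw [hz]
      have h3 : HasDerivAt (fun z => z ^ (k + 1) * E z) (((k + 1 : ℕ) : ℂ) * z ^ k * E z + z ^ (k + 1) * deriv E z) z :=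
        (hasDerivAt_pow (k + 1) z).mul hza.differentiableAt.hasDerivAt
      rw [h3.deriv, smul_eq_mul, sub_zero]; push_cast; ring
    have h4 : analyticOrderAt (fun z => z ^ n * Complex.exp (F z)) 0 = k := by
      rw [hfa.analyticOrderAt_eq_natCast]
      refine ⟨_, ?_, ?_, hd⟩
      · have := hE.deriv; fun_prop
      · simp only [zero_mul, add_zero]
        exact mul_ne_zero (by exact_mod_cast (Nat.succ_ne_zero k)) hE0
    rw [hordf] at h4
    have h5 : n = k := by exact_mod_cast h4
    subst h5
    exact ⟨E, hE, hE0, hEe⟩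
  obtain ⟨α, hα⟩ := IsAlgClosed.exists_pow_nat_eq (((n:ℂ) + 1) * E 0) (Nat.succ_pos n)
  have hn1 : ((n:ℂ) + 1) ≠ 0 := by exact_mod_cast Nat.succ_ne_zero n
  have hα0 : α ≠ 0 := by
    rintro rfl
    rw [Nat.succ_eq_add_one, zero_pow (Nat.succ_ne_zero n)] at hα
    exact mul_ne_zero hn1 hE0 hα.symm
  set L : ℂ → ℂ := fun z => α * Complex.exp (Complex.log (E z / E 0) / (n + 1)) with hL
  have hE1 : E 0 / E 0 = 1 := div_self hE0
  have hLa : AnalyticAt ℂ L 0 := by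
    have h1 : AnalyticAt ℂ (fun z => E z / E 0) 0 := hE.div analyticAt_const hE0
    have h2 : AnalyticAt ℂ (fun z => Complex.log (E z / E 0)) 0 := h1.clog (by rw [hE1]; exact Complex.one_mem_slitPlane)
    exact analyticAt_const.mul ((h2.div analyticAt_const hn1).cexp)
  have hL0 : L 0 = α := by simp [hL, hE1]
  set G : ℂ → ℂ := fun z => z * L z with hG
  have hGa : AnalyticAt ℂ G 0 := analyticAt_id.mul hLa
  have hG0 : G 0 = 0 := by simp [hG]
  have hGd : deriv G 0 = α := by
    have : HasDerivAt G (1 * L 0 + 0 * deriv L 0) 0 := (hasDerivAt_id 0).mul hLa.differentiableAt.hasDerivAt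
    rw [this.deriv, hL0]; ring
  have hGe : ∀ᶠ z in 𝓝 0, G z ^ (n + 1) = (n + 1) * Φ z := by
    filter_upwards [hEe, hE.continuousAt.eventually_ne hE0] with z hz hz0
    have h1 : Complex.exp (Complex.log (E z / E 0) / (n + 1)) ^ (n + 1) = E z / E 0 := by
      rw [← Complex.exp_nat_mul]
      push_cast
      rw [mul_div_cancel₀ _ hn1, Complex.exp_log (div_ne_zero hz0 hE0)]
    simp only [hG, hL]
    rw [mul_pow, mul_pow, h1, ← Nat.succ_eq_add_one, hα, hz, Nat.succ_eq_add_one]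
    field_simp
  obtain ⟨H₀, ha, h00, hl, hr⟩ := locinv G 0 hGa (by rw [hGd]; exact hα0)
  rw [hG0] at ha h00 hr
  have hc : Tendsto H₀ (𝓝 0) (𝓝 0) := by
    have := ha.continuousAt.tendsto; rwa [h00] at this
  obtain ⟨ρ, hρ, hb⟩ := Metric.eventually_nhds_iff_ball.1 ((ha.eventually_analyticAt.and hr).and (hc.eventually hGe))
  refine ⟨ρ, hρ, H₀, fun w hw => (hb w hw).1.1.differentiableAt.differentiableWithinAt, h00, ?_, ?_⟩
  · intro hd0
    have h1 : HasDerivAt (fun y => G (H₀ y)) (deriv G 0 * deriv H₀ 0) 0 := by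
      have : HasDerivAt G (deriv G 0) (H₀ 0) := by rw [h00]; exact hGa.differentiableAt.hasDerivAt
      exact this.comp 0 ha.differentiableAt.hasDerivAt
    have h2 : HasDerivAt (fun y => G (H₀ y)) 1 0 := (hasDerivAt_id 0).congr_of_eventuallyEq hr
    have := h1.unique h2
    rw [hd0, mul_zero] at this
    exact zero_ne_one this
  · intro w hw
    rw [← (hb w hw).2, (hb w hw).1.2]

/-- identity theorem on open preconnected sets -/
lemma ident (U : Set ℂ) (hU : IsOpen U) (hp : IsPreconnected U) (f g : ℂ → ℂ) (hf : DifferentiableOn ℂ f U)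
    (hg : DifferentiableOn ℂ g U) (z : ℂ) (hz : z ∈ U) (h : f =ᶠ[𝓝 z] g) : Set.EqOn f g U :=
  (hf.analyticOnNhd hU).eqOn_of_preconnected_of_eventuallyEq (hg.analyticOnNhd hU) hp hz h

structure DevP (n : ℕ) (F Φ H₀ : ℂ → ℂ) : Prop where
  hF : Differentiable ℂ F
  hΦ : ∀ z, HasDerivAt Φ (z ^ n * Complex.exp (F z)) z
  hΦ0 : Φ 0 = 0
  h0 : H₀ 0 = 0
  hd0 : deriv H₀ 0 ≠ 0
  heq : ∀ᶠ w in 𝓝 (0:ℂ), (n + 1) * Φ (H₀ w) = w ^ (n + 1)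

lemma dev_props (n : ℕ) (F Φ H₀ : ℂ → ℂ) (hD : DevP n F Φ H₀) (H : ℂ → ℂ) (R : ℝ) (hR : 0 < R)
    (hH : DifferentiableOn ℂ H (ball 0 R)) (he : H =ᶠ[𝓝 0] H₀) :
    H 0 = 0 ∧ (∀ w ∈ ball (0:ℂ) R, (n + 1) * Φ (H w) = w ^ (n + 1)) ∧
    (∀ w ∈ ball (0:ℂ) R, H w ^ n * Complex.exp (F (H w)) * deriv H w = w ^ n) ∧
    (∀ w ∈ ball (0:ℂ) R, deriv H w ≠ 0) ∧ Set.InjOn H (ball 0 R) := by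
  obtain ⟨hF, hΦ, hΦ0, h0, hd0, heq⟩ := hD
  have hn1 : ((n:ℂ) + 1) ≠ 0 := by exact_mod_cast Nat.succ_ne_zero n
  have hΦd : Differentiable ℂ Φ := fun z => (hΦ z).differentiableAt
  have h00 : (0:ℂ) ∈ ball (0:ℂ) R := mem_ball_self hR
  have hpre : IsPreconnected (ball (0:ℂ) R) := (convex_ball 0 R).isPreconnected
  have hda : ∀ w ∈ ball (0:ℂ) R, DifferentiableAt ℂ H w := fun w hw => hH.differentiableAt (isOpen_ball.mem_nhds hw)
  have hE : ∀ w ∈ ball (0:ℂ) R, (n + 1) * Φ (H w) = w ^ (n + 1) := by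
    apply ident (ball 0 R) isOpen_ball hpre (fun w => (n + 1) * Φ (H w)) (fun w => w ^ (n + 1)) ?_ ?_ 0 h00
    · filter_upwards [he, heq] with w h1 h2
      rw [h1, h2]
    · exact (hΦd.comp_differentiableOn hH).const_mul _
    · fun_prop
  have hrel : ∀ w ∈ ball (0:ℂ) R, H w ^ n * Complex.exp (F (H w)) * deriv H w = w ^ n := by
    intro w hw
    have h1 : HasDerivAt (fun w => (n + 1) * Φ (H w)) ((n + 1) * (H w ^ n * Complex.exp (F (H w)) * deriv H w)) w :=
      ((hΦ (H w)).comp w (hda w hw).hasDerivAt).const_mul _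
    have h2 : HasDerivAt (fun w : ℂ => w ^ (n + 1)) (((n + 1 : ℕ) : ℂ) * w ^ n) w := hasDerivAt_pow (n + 1) w
    have h3 : (fun w => (n + 1) * Φ (H w)) =ᶠ[𝓝 w] (fun w : ℂ => w ^ (n + 1)) := by
      filter_upwards [isOpen_ball.mem_nhds hw] with z hz using hE z hz
    have h4 := h1.unique (h2.congr_of_eventuallyEq h3)
    push_cast at h4
    exact mul_left_cancel₀ hn1 h4
  have hd : ∀ w ∈ ball (0:ℂ) R, deriv H w ≠ 0 := by
    intro w hw h
    rcases eq_or_ne w 0 with rfl | hne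
    · exact hd0 (by rw [← he.deriv_eq]; exact h)
    · have := hrel w hw
      rw [h, mul_zero] at this
      exact pow_ne_zero n hne this.symm
  have hH0 : H 0 = 0 := by rw [he.self_of_nhds, h0]
  refine ⟨hH0, hE, hrel, hd, ?_⟩
  intro w hw w' hw' hww
  have e1 : w ^ (n + 1) = w' ^ (n + 1) := by rw [← hE w hw, ← hE w' hw', hww]
  rcases eq_or_ne w 0 with rfl | hne
  · rw [zero_pow (Nat.succ_ne_zero n)] at e1
    exact (pow_eq_zero_iff (Nat.succ_ne_zero n)).1 e1.symm |>.symm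
  set ζ := w' / w with hζ
  have hζ1 : ζ ^ (n + 1) = 1 := by rw [hζ, div_pow, ← e1, div_self (pow_ne_zero _ hne)]
  have hζn : ‖ζ‖ = 1 := by
    have := congrArg norm hζ1
    rw [norm_pow, norm_one] at this
    exact (pow_eq_one_iff_of_nonneg (norm_nonneg _) (Nat.succ_ne_zero n)).1 this
  have hζw : ζ * w = w' := by rw [hζ]; field_simp
  have hmaps : ∀ z ∈ ball (0:ℂ) R, ζ * z ∈ ball (0:ℂ) R := by
    intro z hz
    rw [mem_ball_zero_iff] at hz ⊢
    rwa [norm_mul, hζn, one_mul]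
  have hKd : DifferentiableOn ℂ (fun z => H (ζ * z)) (ball 0 R) :=
    hH.comp (by fun_prop) hmaps
  have hHw : H w ^ n * Complex.exp (F (H w)) ≠ 0 := by
    intro h
    have := hrel w hw
    rw [h, zero_mul] at this
    exact pow_ne_zero n hne this.symm
  obtain ⟨Ψ, -, -, hl, -⟩ := locinv Φ (H w) (hΦd.analyticAt _) (by rw [(hΦ _).deriv]; exact hHw)
  have c1 : Tendsto H (𝓝 w) (𝓝 (H w)) := (hda w hw).continuousAt
  have c2 : Tendsto (fun z => H (ζ * z)) (𝓝 w) (𝓝 (H w)) := by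
    have := (hKd.differentiableAt (isOpen_ball.mem_nhds hw)).continuousAt.tendsto
    rwa [hζw, ← hww] at this
  have hev : (fun z => H (ζ * z)) =ᶠ[𝓝 w] H := by
    filter_upwards [c1.eventually hl, c2.eventually hl, isOpen_ball.mem_nhds hw] with z h1 h2 hz
    rw [← h1, ← h2]
    congr 1
    apply mul_left_cancel₀ hn1
    rw [hE _ (hmaps z hz), hE z hz, mul_pow, hζ1, one_mul]
  have hall := ident _ isOpen_ball hpre _ _ hKd hH w hw hev
  have hev0 : (fun z => H (ζ * z)) =ᶠ[𝓝 0] H := by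
    filter_upwards [isOpen_ball.mem_nhds h00] with z hz using hall hz
  have h1 : HasDerivAt (fun z => H (ζ * z)) (deriv H 0 * (ζ * 1)) 0 := by
    have h2 : HasDerivAt H (deriv H 0) (ζ * 0) := by rw [mul_zero]; exact (hda 0 h00).hasDerivAt
    exact h2.comp 0 ((hasDerivAt_id (0:ℂ)).const_mul ζ)
  have h2 := h1.unique ((hda 0 h00).hasDerivAt.congr_of_eventuallyEq hev0)
  have h3 : ζ = 1 := by
    have h4 : deriv H 0 * ζ = deriv H 0 * 1 := by rw [mul_one] at h2; rw [h2, mul_one]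
    exact mul_left_cancel₀ (hd 0 h00) h4
  rw [← hζw, h3, one_mul]

lemma local_ext (n : ℕ) (F Φ H₀ : ℂ → ℂ) (hD : DevP n F Φ H₀) (H : ℂ → ℂ) (R : ℝ) (hR : 0 < R)
    (hH : DifferentiableOn ℂ H (ball 0 R)) (he : H =ᶠ[𝓝 0] H₀) (w₀ : ℂ) (hw : ‖w₀‖ = R)
    (p : ℕ → ℂ) (l : ℂ) (hp : ∀ j, p j ∈ ball (0:ℂ) R) (hpl : Tendsto p atTop (𝓝 w₀))
    (hl : Tendsto (fun j => H (p j)) atTop (𝓝 l)) :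
    ∃ η, 0 < η ∧ ∃ H₁ : ℂ → ℂ, DifferentiableOn ℂ H₁ (ball w₀ η) ∧ ∀ z ∈ ball w₀ η, z ∈ ball (0:ℂ) R → H₁ z = H z := by
  obtain ⟨h0, hE, -, -, -⟩ := dev_props n F Φ H₀ hD H R hR hH he
  obtain ⟨hF, hΦ, hΦ0, -, -, -⟩ := hD
  have hn1 : ((n:ℂ) + 1) ≠ 0 := by exact_mod_cast Nat.succ_ne_zero n
  have hΦd : Differentiable ℂ Φ := fun z => (hΦ z).differentiableAt
  have e1 : (n + 1) * Φ l = w₀ ^ (n + 1) := by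
    have t1 : Tendsto (fun j => (n + 1) * Φ (H (p j))) atTop (𝓝 ((n + 1) * Φ l)) :=
      ((hΦd.continuous.tendsto l).comp hl).const_mul _
    have t2 : Tendsto (fun j => (p j) ^ (n + 1)) atTop (𝓝 (w₀ ^ (n + 1))) := hpl.pow _
    have : (fun j => (n + 1) * Φ (H (p j))) = (fun j => (p j) ^ (n + 1)) := by ext j; exact hE _ (hp j)
    rw [this] at t1
    exact tendsto_nhds_unique t1 t2
  have hw0 : w₀ ≠ 0 := by intro h; rw [h, norm_zero] at hw; linarith
  have hl0 : l ≠ 0 := by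
    rintro rfl
    rw [hΦ0, mul_zero] at e1
    exact pow_ne_zero _ hw0 e1.symm
  obtain ⟨Ψ, hΨa, hΨ, hleft, -⟩ := locinv Φ l (hΦd.analyticAt _) (by
    rw [(hΦ _).deriv]; exact mul_ne_zero (pow_ne_zero _ hl0) (Complex.exp_ne_zero _))
  have e2 : w₀ ^ (n + 1) / (n + 1) = Φ l := by rw [← e1]; field_simp
  set P : ℂ → ℂ := fun w => w ^ (n + 1) / (n + 1) with hP
  have hPd : Differentiable ℂ P := by simp only [hP]; fun_prop
  have hPt : Tendsto P (𝓝 w₀) (𝓝 (Φ l)) := by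
    have := hPd.continuous.tendsto w₀
    rwa [show P w₀ = Φ l from e2] at this
  obtain ⟨η, hη, hb⟩ := Metric.eventually_nhds_iff_ball.1 (hPt.eventually hΨa.eventually_analyticAt)
  have hd1 : DifferentiableOn ℂ (fun w => Ψ (P w)) (ball w₀ η) := fun w hw =>
    ((hb w hw).differentiableAt.comp w (hPd w)).differentiableWithinAt
  refine ⟨η, hη, fun w => Ψ (P w), hd1, ?_⟩
  have hev : ∀ᶠ j in atTop, p j ∈ ball w₀ η ∧ ∀ᶠ x in 𝓝 (H (p j)), Ψ (Φ x) = x :=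
    (hpl.eventually (ball_mem_nhds w₀ hη)).and (hl.eventually hleft.eventually_nhds)
  obtain ⟨j, hj1, hj2⟩ := hev.exists
  have hcj : Tendsto H (𝓝 (p j)) (𝓝 (H (p j))) := (hH.differentiableAt (isOpen_ball.mem_nhds (hp j))).continuousAt
  have hid := ident (ball w₀ η ∩ ball 0 R) (isOpen_ball.inter isOpen_ball)
    ((convex_ball w₀ η).inter (convex_ball 0 R)).isPreconnected (fun w => Ψ (P w)) H (hd1.mono Set.inter_subset_left)
    (hH.mono Set.inter_subset_right) (p j) ⟨hj1, hp j⟩ (by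
      filter_upwards [hcj.eventually hj2, isOpen_ball.mem_nhds (hp j)] with z hz hzR
      rw [← hz]
      congr 1
      simp only [hP]
      rw [← hE z hzR]; field_simp)
  intro z hz hzR
  exact hid ⟨hz, hzR⟩

lemma glue (H : ℂ → ℂ) (R : ℝ) (hR : 0 < R) (hH : DifferentiableOn ℂ H (ball 0 R))
    (hx : ∀ w₀ : ℂ, ‖w₀‖ = R → ∃ η, 0 < η ∧ ∃ H₁ : ℂ → ℂ, DifferentiableOn ℂ H₁ (ball w₀ η) ∧
      ∀ z ∈ ball w₀ η, z ∈ ball (0:ℂ) R → H₁ z = H z) :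
    ∃ R', R < R' ∧ ∃ Ht : ℂ → ℂ, DifferentiableOn ℂ Ht (ball 0 R') ∧ ∀ z ∈ ball (0:ℂ) R, Ht z = H z := by
  classical
  choose! η hη H₁ hd1 he1 using hx
  obtain ⟨δ, hδ, hleb⟩ := lebesgue_number_lemma_of_metric (s := sphere (0:ℂ) R) (ι := sphere (0:ℂ) R)
    (c := fun w => ball (w:ℂ) (η w)) (isCompact_sphere 0 R) (fun _ => isOpen_ball) (by
      intro w hw
      exact Set.mem_iUnion.2 ⟨⟨w, hw⟩, mem_ball_self (hη w (by simpa using hw))⟩)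
  have hloc : ∀ x : ℂ, ‖x‖ = R → ∃ K : ℂ → ℂ, DifferentiableOn ℂ K (ball x δ) ∧ ∀ z ∈ ball x δ, z ∈ ball (0:ℂ) R → K z = H z := by
    intro x hx
    obtain ⟨⟨w, hw⟩, hsub⟩ := hleb x (by simpa using hx)
    have hw' : ‖w‖ = R := by simpa using hw
    exact ⟨H₁ w, (hd1 w hw').mono hsub, fun z hz hzR => he1 w hw' z (hsub hz) hzR⟩
  choose! K hKd hKe using hloc
  -- compatibility
  have hcompat : ∀ x x' : ℂ, ‖x‖ = R → ‖x'‖ = R → ‖x - x'‖ < δ → ∀ z ∈ ball x δ, z ∈ ball x' δ → K x z = K x' z := by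
    intro x x' hxR hxR' hdist z hz hz'
    have hopen : IsOpen (ball x δ ∩ ball x' δ) := isOpen_ball.inter isOpen_ball
    have hx'mem : x' ∈ ball x δ ∩ ball x' δ := ⟨by rw [mem_ball, dist_eq_norm, norm_sub_rev]; exact hdist, mem_ball_self hδ⟩
    have ht : Tendsto (fun t : ℝ => (t:ℂ) * x') (𝓝[<] (1:ℝ)) (𝓝 x') := by
      have : Continuous (fun t : ℝ => (t:ℂ) * x') := by fun_prop
      have h2 := this.tendsto 1
      simp only [Complex.ofReal_one, one_mul] at h2
      exact h2.mono_left nhdsWithin_le_nhds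
    have hev : ∀ᶠ t : ℝ in 𝓝[<] (1:ℝ), (t:ℂ) * x' ∈ ball x δ ∩ ball x' δ := ht.eventually (hopen.mem_nhds hx'mem)
    have hev2 : ∀ᶠ t in 𝓝[<] (1:ℝ), t ∈ Set.Ioo (0:ℝ) 1 := Ioo_mem_nhdsLT (by norm_num)
    obtain ⟨t, h1, h2⟩ := (hev.and hev2).exists
    have hin : (t:ℂ) * x' ∈ ball (0:ℂ) R := by
      rw [mem_ball_zero_iff, norm_mul, Complex.norm_real, Real.norm_of_nonneg h2.1.le, hxR']
      nlinarith [h2.2]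
    apply ident _ hopen ((convex_ball x δ).inter (convex_ball x' δ)).isPreconnected (K x) (K x')
      ((hKd x hxR).mono Set.inter_subset_left) ((hKd x' hxR').mono Set.inter_subset_right) ((t:ℂ) * x') h1 ?_ ⟨hz, hz'⟩
    filter_upwards [hopen.mem_nhds h1, isOpen_ball.mem_nhds hin] with y hy hyR
    rw [hKe x hxR y hy.1 hyR, hKe x' hxR' y hy.2 hyR]
  set pr : ℂ → ℂ := fun p => ((R / ‖p‖ : ℝ) : ℂ) * p with hpr
  have hprn : ∀ p, R ≤ ‖p‖ → ‖pr p‖ = R ∧ ‖p - pr p‖ = ‖p‖ - R := by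
    intro p hp
    have hp0 : 0 < ‖p‖ := hR.trans_le hp
    constructor
    · simp only [hpr]
      rw [norm_mul, Complex.norm_real, Real.norm_of_nonneg (by positivity)]; field_simp
    · have : p - pr p = ((1 - R / ‖p‖ : ℝ) : ℂ) * p := by simp only [hpr]; push_cast; ring
      rw [this, norm_mul, Complex.norm_real, Real.norm_of_nonneg]
      · field_simp
      · rw [sub_nonneg, div_le_one hp0]; exact hp
  set Ht : ℂ → ℂ := fun p => if ‖p‖ < R then H p else K (pr p) p with hHt
  refine ⟨R + δ / 4, by linarith, Ht, ?_, ?_⟩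
  · intro p hp
    rw [mem_ball_zero_iff] at hp
    apply DifferentiableAt.differentiableWithinAt
    by_cases hpR : ‖p‖ < R
    · have hpm : p ∈ ball (0:ℂ) R := by simpa using hpR
      apply (hH.differentiableAt (isOpen_ball.mem_nhds hpm)).congr_of_eventuallyEq
      filter_upwards [isOpen_ball.mem_nhds hpm] with z hz
      simp only [hHt]
      rw [if_pos (by simpa using hz)]
    · obtain ⟨q1, q2⟩ := hprn p (not_lt.1 hpR)
      have hpm : p ∈ ball (pr p) δ := by rw [mem_ball, dist_eq_norm]; linarith
      apply ((hKd _ q1).differentiableAt (isOpen_ball.mem_nhds hpm)).congr_of_eventuallyEq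
      filter_upwards [ball_mem_nhds p (show 0 < δ / 4 by positivity)] with z hz
      rw [mem_ball, dist_eq_norm] at hz
      have hz1 : ‖z - pr p‖ < δ / 2 := by
        have := norm_add_le (z - p) (p - pr p)
        rw [sub_add_sub_cancel] at this; linarith
      have hzm : z ∈ ball (pr p) δ := by rw [mem_ball, dist_eq_norm]; linarith
      simp only [hHt]
      split_ifs with hzR
      · exact (hKe _ q1 z hzm (by simpa using hzR)).symm
      · obtain ⟨r1, r2⟩ := hprn z (not_lt.1 hzR)
        have hzn : ‖z‖ < R + δ / 2 := by
          have := norm_add_le (z - p) p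
          rw [sub_add_cancel] at this; linarith
        apply hcompat _ _ r1 q1 ?_ z (by rw [mem_ball, dist_eq_norm]; linarith) hzm
        have := norm_sub_le (z - pr p) (z - pr z)
        rw [sub_sub_sub_cancel_left] at this; linarith
  · intro z hz
    simp only [hHt]
    rw [if_pos (by simpa using hz)]

lemma extend_all (H₀ : ℂ → ℂ) (ρ : ℝ) (hρ : 0 < ρ) (h0 : DifferentiableOn ℂ H₀ (ball 0 ρ))
    (hx : ∀ (R : ℝ) (H : ℂ → ℂ), 0 < R → DifferentiableOn ℂ H (ball 0 R) → H =ᶠ[𝓝 0] H₀ →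
      ∃ R', R < R' ∧ ∃ Ht : ℂ → ℂ, DifferentiableOn ℂ Ht (ball 0 R') ∧ ∀ z ∈ ball (0:ℂ) R, Ht z = H z) (R : ℝ) :
    ∃ H : ℂ → ℂ, DifferentiableOn ℂ H (ball 0 R) ∧ H =ᶠ[𝓝 0] H₀ := by
  by_contra hcon
  set S : Set ℝ := {r | 0 < r ∧ ∃ H : ℂ → ℂ, DifferentiableOn ℂ H (ball 0 r) ∧ H =ᶠ[𝓝 0] H₀} with hS
  have hρS : ρ ∈ S := ⟨hρ, H₀, h0, EventuallyEq.rfl⟩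
  have hbd : BddAbove S := by
    refine ⟨R, fun r hr => ?_⟩
    by_contra hlt
    obtain ⟨_, H, hH, he⟩ := hr
    exact hcon ⟨H, hH.mono (ball_subset_ball (not_le.1 hlt).le), he⟩
  set Rs := sSup S with hRs
  have hRsp : 0 < Rs := hρ.trans_le (le_csSup hbd hρS)
  have hlt : ∀ r, r < Rs → ∃ H : ℂ → ℂ, DifferentiableOn ℂ H (ball 0 r) ∧ H =ᶠ[𝓝 0] H₀ := by
    intro r hr
    obtain ⟨r', ⟨_, H, hH, he⟩, hr'⟩ := exists_lt_of_lt_csSup ⟨ρ, hρS⟩ hr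
    exact ⟨H, hH.mono (ball_subset_ball hr'.le), he⟩
  choose! G hG hGe using hlt
  have huniq : ∀ r r', 0 < r → r ≤ r' → r' < Rs → ∀ z ∈ ball (0:ℂ) r, G r z = G r' z := by
    intro r r' hr0 hr hr'
    exact ident (ball 0 r) isOpen_ball (convex_ball 0 r).isPreconnected _ _ (hG r (by linarith))
      ((hG r' hr').mono (ball_subset_ball hr)) 0 (mem_ball_self hr0)
      ((hGe r (by linarith)).trans (hGe r' hr').symm)
  set Hs : ℂ → ℂ := fun w => G ((‖w‖ + Rs) / 2) w with hHs
  have hHsG : ∀ r, 0 < r → r < Rs → ∀ z ∈ ball (0:ℂ) r, Hs z = G r z := by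
    intro r hr hr2 z hz
    rw [mem_ball_zero_iff] at hz
    have hn := norm_nonneg z
    have hz2 : ‖z‖ < (‖z‖ + Rs) / 2 := by linarith
    rcases le_total r ((‖z‖ + Rs) / 2) with h | h
    · exact (huniq r _ hr h (by linarith) z (by simpa using hz)).symm
    · exact huniq _ r (by linarith) h hr2 z (by simpa using hz2)
  obtain ⟨R', hR', Ht, hHt, hHte⟩ := hx Rs Hs hRsp (by
    intro z hz
    rw [mem_ball_zero_iff] at hz
    have hn := norm_nonneg z
    have hzr : z ∈ ball (0:ℂ) ((‖z‖ + Rs) / 2) := by rw [mem_ball_zero_iff]; linarith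
    apply DifferentiableAt.differentiableWithinAt
    apply ((hG ((‖z‖ + Rs) / 2) (by linarith)).differentiableAt (isOpen_ball.mem_nhds hzr)).congr_of_eventuallyEq
    filter_upwards [isOpen_ball.mem_nhds hzr] with y hy
    exact hHsG _ (by linarith) (by linarith) y hy) (by
    filter_upwards [ball_mem_nhds (0:ℂ) (show 0 < Rs / 2 by positivity), hGe (Rs/2) (by linarith)] with z hz h2
    rw [hHsG (Rs/2) (by linarith) (by linarith) z hz, h2])
  have : R' ∈ S := by
    refine ⟨by linarith, Ht, hHt, ?_⟩
    filter_upwards [ball_mem_nhds (0:ℂ) (show 0 < Rs / 2 by positivity), hGe (Rs/2) (by linarith)] with z hz h2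
    rw [hHte z (ball_subset_ball (by linarith) hz), hHsG (Rs/2) (by linarith) (by linarith) z hz, h2]
  linarith [le_csSup hbd this]

lemma F_const (v : ℂ → ℝ) (hvc : Continuous v) (ω : ℂ → ℝ) (hc : Continuous ω) (hi : Integrable ω) (F : ℂ → ℂ)
    (hF : Differentiable ℂ F) (hv : ∀ x, v x = Np ω x + (F x).re) (hcomp : ConfComplete v) : ∀ z, F z = F 0 := by
  obtain ⟨n, hn⟩ := exists_nat_ge ((2 * Real.pi)⁻¹ * ∫ y, |ω y|)
  obtain ⟨Φ, hΦ, hΦ0⟩ : ∃ Φ : ℂ → ℂ, (∀ z, HasDerivAt Φ (z ^ n * Complex.exp (F z)) z) ∧ Φ 0 = 0 := by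
    have hd : Differentiable ℂ (fun z => z ^ n * Complex.exp (F z)) := by fun_prop
    obtain ⟨Φ, hΦ⟩ := hd.isExactOn_univ
    refine ⟨fun z => Φ z - Φ 0, fun z => (hΦ z trivial).sub_const _, by simp⟩
  obtain ⟨ρ, hρ, H₀, hH₀, h00, hd0, hE0⟩ := germ n F Φ hF hΦ hΦ0
  have hD : DevP n F Φ H₀ := ⟨hF, hΦ, hΦ0, h00, hd0, by
    filter_upwards [ball_mem_nhds (0:ℂ) hρ] with w hw using hE0 w hw⟩
  have hall := extend_all H₀ ρ hρ hH₀ (by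
    intro R H hR hH he
    apply glue H R hR hH
    intro w₀ hw
    obtain ⟨p1, p2, p3, p4, p5⟩ := dev_props n F Φ H₀ hD H R hR hH he
    obtain ⟨p, l, a1, a2, a3⟩ := fin_len v hvc ω hc hi F hv n hn H R hR hH p5 p4 p1 p3 hcomp w₀ hw
    exact local_ext n F Φ H₀ hD H R hR hH he w₀ hw p l a1 a2 a3)
  have hCK := CK_pos
  obtain ⟨p1, p2, p3, p4, p5⟩ := dev_props n F Φ H₀ hD H₀ ρ hρ hH₀ EventuallyEq.rfl
  have hdd : ∀ w ∈ ball (0:ℂ) ρ, deriv (deriv H₀) w = 0 := by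
    intro w hw
    have hwρ : ‖w‖ < ρ := by simpa using hw
    have hbound : ∀ r, 0 < r → ‖deriv (deriv H₀) w‖ * r ≤ 4 * CK * ‖deriv H₀ w‖ := by
      intro r hr
      obtain ⟨H, hH, he⟩ := hall (ρ + r)
      have hR : 0 < ρ + r := by linarith
      obtain ⟨q1, q2, q3, q4, q5⟩ := dev_props n F Φ H₀ hD H (ρ + r) hR hH he
      have hsub : ball w r ⊆ ball 0 (ρ + r) := by
        apply ball_subset_ball'; rw [dist_zero_right]; linarith
      have hloc : H =ᶠ[𝓝 w] H₀ := by
        have := ident (ball 0 ρ) isOpen_ball (convex_ball 0 ρ).isPreconnected H H₀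
          (hH.mono (ball_subset_ball (by linarith))) hH₀ 0 (mem_ball_self hρ) he
        filter_upwards [isOpen_ball.mem_nhds hw] with z hz using this hz
      have := distD H w r hr (hH.mono hsub) (q5.mono hsub) (q4 w (hsub (mem_ball_self hr)))
      rwa [hloc.deriv_eq, hloc.deriv.deriv_eq] at this
    by_contra hne
    have hpos : 0 < ‖deriv (deriv H₀) w‖ := norm_pos_iff.2 hne
    have h1 := hbound ((4 * CK * ‖deriv H₀ w‖ + 1) / ‖deriv (deriv H₀) w‖) (by positivity)
    rw [mul_div_cancel₀ _ hpos.ne'] at h1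
    linarith
  have hdc : ∀ w ∈ ball (0:ℂ) ρ, deriv H₀ w = deriv H₀ 0 := by
    intro w hw
    exact isOpen_ball.is_const_of_deriv_eq_zero (convex_ball 0 ρ).isPreconnected (hH₀.deriv isOpen_ball)
      hdd hw (mem_ball_self hρ)
  set a := deriv H₀ 0 with ha
  have hlin : ∀ w ∈ ball (0:ℂ) ρ, H₀ w = a * w := by
    intro w hw
    have h1 : Set.EqOn (deriv (fun w => H₀ w - a * w)) 0 (ball 0 ρ) := by
      intro z hz
      have h2 : HasDerivAt (fun w => H₀ w - a * w) (deriv H₀ z - a * 1) z :=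
        (hH₀.differentiableAt (isOpen_ball.mem_nhds hz)).hasDerivAt.sub ((hasDerivAt_id z).const_mul a)
      rw [h2.deriv, hdc z hz]; simp
    have h3 := isOpen_ball.is_const_of_deriv_eq_zero (convex_ball 0 ρ).isPreconnected
      (hH₀.sub (by fun_prop : DifferentiableOn ℂ (fun w => a * w) (ball 0 ρ))) h1 hw (mem_ball_self hρ)
    simp only [Pi.sub_apply] at h3
    rw [h00, mul_zero, sub_zero] at h3
    exact sub_eq_zero.1 h3
  have hexp : ∀ w ∈ ball (0:ℂ) ρ, w ≠ 0 → Complex.exp (F (a * w)) = (a ^ (n + 1))⁻¹ := by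
    intro w hw hw0
    have := p3 w hw
    rw [hlin w hw, hdc w hw, mul_pow] at this
    have hwn : w ^ n ≠ 0 := pow_ne_zero n hw0
    apply eq_inv_of_mul_eq_one_left
    apply mul_left_cancel₀ hwn
    rw [mul_one]
    calc _ = a ^ n * w ^ n * Complex.exp (F (a * w)) * a := by ring
      _ = _ := this
  have hglob : ∀ w, Complex.exp (F (a * w)) = (a ^ (n + 1))⁻¹ := by
    have hd : Differentiable ℂ (fun w => Complex.exp (F (a * w))) := by fun_prop
    have hfr : ∃ᶠ z in 𝓝[≠] (0:ℂ), Complex.exp (F (a * z)) = (a ^ (n + 1))⁻¹ := by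
      apply Eventually.frequently
      have h1 : ball (0:ℂ) ρ ∈ 𝓝[≠] (0:ℂ) := mem_nhdsWithin_of_mem_nhds (ball_mem_nhds _ hρ)
      filter_upwards [h1, self_mem_nhdsWithin] with z hz hz0 using hexp z hz hz0
    have := (hd.differentiableOn.analyticOnNhd isOpen_univ).eqOn_of_preconnected_of_frequently_eq
      (g := fun _ => (a ^ (n + 1))⁻¹) analyticOnNhd_const isPreconnected_univ (Set.mem_univ 0) hfr
    exact fun w => this (Set.mem_univ w)
  have hexpc : ∀ z, Complex.exp (F z) = (a ^ (n + 1))⁻¹ := by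
    intro z
    have := hglob (z / a)
    rwa [mul_div_cancel₀ _ hd0] at this
  intro z
  refine is_const_of_deriv_eq_zero hF (fun x => ?_) z 0
  have h1 : HasDerivAt (fun z => Complex.exp (F z)) (Complex.exp (F x) * deriv F x) x := (hF x).hasDerivAt.cexp
  have h2 : (fun z => Complex.exp (F z)) = fun _ => (a ^ (n + 1))⁻¹ := funext hexpc
  rw [h2] at h1
  have := h1.unique (hasDerivAt_const x _)
  exact (mul_eq_zero.1 this).resolve_left (Complex.exp_ne_zero _)

lemma jensenE (ν : Measure ℂ) (f : ℂ → ℝ≥0∞) (hf : Measurable f) (p : ℝ) (hp : 1 < p) :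
    (∫⁻ y, f y ∂ν) ^ p ≤ ν Set.univ ^ (p - 1) * ∫⁻ y, f y ^ p ∂ν := by
  have hpq : p.HolderConjugate (p / (p - 1)) := Real.HolderConjugate.conjExponent hp
  have h := ENNReal.lintegral_mul_le_Lp_mul_Lq ν hpq hf.aemeasurable (measurable_const (a := (1:ℝ≥0∞))).aemeasurable
  simp only [Pi.mul_apply, mul_one, ENNReal.one_rpow, lintegral_const, one_mul] at h
  have h2 := ENNReal.rpow_le_rpow h (by linarith : 0 ≤ p)
  refine h2.trans (le_of_eq ?_)
  rw [ENNReal.mul_rpow_of_nonneg _ _ (by linarith), ← ENNReal.rpow_mul, ← ENNReal.rpow_mul, mul_comm]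
  have h1 : 1 / p * p = 1 := by field_simp
  have h3 : 1 / (p / (p - 1)) * p = p - 1 := by
    have : p - 1 ≠ 0 := by linarith
    field_simp
  rw [h1, h3, ENNReal.rpow_one]

lemma core_nu (p : ℝ) (hp : 1 < p) (hp2 : p < 2) (ρ Λ : ℝ) : ∃ C : ℝ, 0 < C ∧ ∀ ν : Measure ℂ, IsFiniteMeasure ν →
    ν Set.univ ≤ ENNReal.ofReal Λ →
    ∫⁻ x in ball (0:ℂ) ρ, (∫⁻ y, (1 + ENNReal.ofReal (‖x - y‖⁻¹)) ∂ν) ^ p ≤ ENNReal.ofReal C := by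
  obtain ⟨C₀, hC₀, h⟩ := kint p (by linarith) hp2 ρ
  set B : ℝ≥0∞ := ENNReal.ofReal Λ ^ (p - 1) * ((2 ^ (p - 1) * (volume (ball (0:ℂ) ρ) + ENNReal.ofReal C₀)) * ENNReal.ofReal Λ) with hB
  have hBf : B ≠ ⊤ := by
    have h1 : ENNReal.ofReal Λ ^ (p - 1) ≠ ⊤ := ENNReal.rpow_ne_top_of_nonneg (by linarith) ENNReal.ofReal_ne_top
    have h2 : (2:ℝ≥0∞) ^ (p - 1) ≠ ⊤ := ENNReal.rpow_ne_top_of_nonneg (by linarith) (by norm_num)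
    have h3 : volume (ball (0:ℂ) ρ) ≠ ⊤ := measure_ball_lt_top.ne
    exact ENNReal.mul_ne_top h1 (ENNReal.mul_ne_top (ENNReal.mul_ne_top h2 (ENNReal.add_ne_top.2 ⟨h3, ENNReal.ofReal_ne_top⟩)) ENNReal.ofReal_ne_top)
  refine ⟨B.toReal + 1, by positivity, fun ν hν hνΛ => ?_⟩
  have hle : B ≤ ENNReal.ofReal (B.toReal + 1) := by
    rw [← ENNReal.ofReal_toReal hBf]; apply ENNReal.ofReal_le_ofReal
    rw [ENNReal.toReal_ofReal ENNReal.toReal_nonneg]; linarith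
  refine le_trans ?_ hle
  calc ∫⁻ x in ball (0:ℂ) ρ, (∫⁻ y, (1 + ENNReal.ofReal (‖x - y‖⁻¹)) ∂ν) ^ p
      ≤ ∫⁻ x in ball (0:ℂ) ρ, ENNReal.ofReal Λ ^ (p - 1) * ∫⁻ y, (1 + ENNReal.ofReal (‖x - y‖⁻¹)) ^ p ∂ν := by
        apply lintegral_mono
        intro x; beta_reduce
        refine (jensenE ν _ (by fun_prop) p hp).trans ?_
        gcongr
        try linarith
    _ = ENNReal.ofReal Λ ^ (p - 1) * ∫⁻ x in ball (0:ℂ) ρ, ∫⁻ y, (1 + ENNReal.ofReal (‖x - y‖⁻¹)) ^ p ∂ν := by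
        rw [lintegral_const_mul' _ _ (ENNReal.rpow_ne_top_of_nonneg (by linarith) ENNReal.ofReal_ne_top)]
    _ = ENNReal.ofReal Λ ^ (p - 1) * ∫⁻ y, (∫⁻ x in ball (0:ℂ) ρ, (1 + ENNReal.ofReal (‖x - y‖⁻¹)) ^ p) ∂ν := by
        rw [lintegral_lintegral_swap]
        exact Measurable.aemeasurable (by unfold Function.uncurry; fun_prop)
    _ ≤ ENNReal.ofReal Λ ^ (p - 1) * ∫⁻ y, (2 ^ (p - 1) * (volume (ball (0:ℂ) ρ) + ENNReal.ofReal C₀)) ∂ν := by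
        gcongr with y
        calc ∫⁻ x in ball (0:ℂ) ρ, (1 + ENNReal.ofReal (‖x - y‖⁻¹)) ^ p
            ≤ ∫⁻ x in ball (0:ℂ) ρ, 2 ^ (p - 1) * (1 + ENNReal.ofReal (‖x - y‖ ^ (-p))) := by
              apply lintegral_mono
              intro x; beta_reduce
              refine (ENNReal.rpow_add_le_mul_rpow_add_rpow _ _ hp.le).trans (le_of_eq ?_)
              rw [ENNReal.one_rpow, ENNReal.ofReal_rpow_of_nonneg (by positivity) (by linarith), Real.inv_rpow (norm_nonneg _),
                Real.rpow_neg (norm_nonneg _)]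
          _ = 2 ^ (p - 1) * (volume (ball (0:ℂ) ρ) + ∫⁻ x in ball (0:ℂ) ρ, ENNReal.ofReal (‖x - y‖ ^ (-p))) := by
              rw [lintegral_const_mul' _ _ (ENNReal.rpow_ne_top_of_nonneg (by linarith) (by norm_num)),
                lintegral_add_left measurable_const]
              simp
          _ ≤ _ := by gcongr; exact h y
    _ ≤ B := by
        rw [lintegral_const, hB]; gcongr

def GG (ω : ℂ → ℝ) (x : ℂ) : ℝ := ∫ y, (1 + ‖x - y‖⁻¹) * |ω y|

lemma GG_int (x : ℂ) (ω : ℂ → ℝ) (hc : Continuous ω) (hi : Integrable ω) :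
    Integrable (fun y : ℂ => (1 + ‖x - y‖⁻¹) * |ω y|) := by
  have := hi.norm.add (inv_mul_integrable x ω hc hi)
  refine this.congr (Eventually.of_forall fun y => ?_)
  simp only [Pi.add_apply, Real.norm_eq_abs]; ring

lemma GG_nonneg (ω : ℂ → ℝ) (x : ℂ) : 0 ≤ GG ω x := integral_nonneg fun y => by positivity

lemma GG_E (x : ℂ) (ω : ℂ → ℝ) (hc : Continuous ω) (hi : Integrable ω) :
    ENNReal.ofReal (GG ω x) = ∫⁻ y, (1 + ENNReal.ofReal (‖x - y‖⁻¹)) ∂(volume.withDensity (fun y => ENNReal.ofReal |ω y|)) := by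
  have hm : Measurable (fun y => ENNReal.ofReal |ω y|) := hc.measurable.abs.ennreal_ofReal
  rw [lintegral_withDensity_eq_lintegral_mul _ hm (by fun_prop), GG,
    ofReal_integral_eq_lintegral_ofReal (GG_int x ω hc hi) (Eventually.of_forall fun y => by positivity)]
  apply lintegral_congr
  intro y
  rw [Pi.mul_apply, ENNReal.ofReal_mul (by positivity), ENNReal.ofReal_add zero_le_one (by positivity), ENNReal.ofReal_one, mul_comm]

lemma GG_meas (ω : ℂ → ℝ) (hc : Continuous ω) (hi : Integrable ω) : Measurable (GG ω) := by
  have h1 : GG ω = fun x => (ENNReal.ofReal (GG ω x)).toReal := by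
    ext x; rw [ENNReal.toReal_ofReal (GG_nonneg ω x)]
  rw [h1]
  apply Measurable.ennreal_toReal
  simp_rw [GG_E _ ω hc hi]
  have : SFinite (volume.withDensity (fun y => ENNReal.ofReal |ω y|)) := inferInstance
  exact Measurable.lintegral_prod_right' (f := fun z : ℂ × ℂ => 1 + ENNReal.ofReal (‖z.1 - z.2‖⁻¹)) (by fun_prop)

lemma core_GG (p : ℝ) (hp : 1 < p) (hp2 : p < 2) (ρ Λ : ℝ) : ∃ C : ℝ, 0 < C ∧ ∀ ω : ℂ → ℝ, Continuous ω → Integrable ω →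
    ∫ y, |ω y| ≤ Λ → ∫⁻ x in ball (0:ℂ) ρ, ENNReal.ofReal (GG ω x) ^ p ≤ ENNReal.ofReal C := by
  obtain ⟨C, hC, h⟩ := core_nu p hp hp2 ρ Λ
  refine ⟨C, hC, fun ω hc hi hω => ?_⟩
  simp_rw [GG_E _ ω hc hi]
  have hu : (volume.withDensity (fun y => ENNReal.ofReal |ω y|)) Set.univ ≤ ENNReal.ofReal Λ := by
    rw [withDensity_apply _ MeasurableSet.univ, Measure.restrict_univ,
      ← ofReal_integral_eq_lintegral_ofReal hi.abs (Eventually.of_forall fun y => abs_nonneg _)]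
    exact ENNReal.ofReal_le_ofReal hω
  exact h _ ⟨hu.trans_lt ENNReal.ofReal_lt_top⟩ hu

lemma twopi_inv_le : (2 * Real.pi)⁻¹ ≤ 1 / 2 := by
  rw [inv_le_comm₀ (by positivity) (by norm_num)]; linarith [Real.pi_gt_three]

lemma Np_abs (x : ℂ) (hx : ‖x‖ ≤ 1) (ω : ℂ → ℝ) (hc : Continuous ω) (hi : Integrable ω) : |Np ω x| ≤ GG ω x := by
  unfold Np
  rw [abs_mul, abs_of_nonneg (by positivity : 0 ≤ (2 * Real.pi)⁻¹)]
  have h1 : |∫ y, kk x y * ω y| ≤ ∫ y, 2 * ((1 + ‖x - y‖⁻¹) * |ω y|) := by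
    refine (abs_integral_le_integral_abs).trans ?_
    apply integral_mono_ae (kk_integrable x ω hc hi).abs ((GG_int x ω hc hi).const_mul 2)
    filter_upwards [ae_ne_c x] with y hy
    rw [abs_mul]
    have := kk_abs x y hy
    have h2 : |kk x y| ≤ 2 * (1 + ‖x - y‖⁻¹) := this.trans (by gcongr; linarith)
    calc _ ≤ 2 * (1 + ‖x - y‖⁻¹) * |ω y| := by gcongr
      _ = _ := by ring
  rw [integral_const_mul] at h1
  have h3 := twopi_inv_le
  have h4 := GG_nonneg ω x
  calc (2 * Real.pi)⁻¹ * |∫ y, kk x y * ω y| ≤ 1 / 2 * (2 * GG ω x) := by gcongr; exact h1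
    _ = _ := by ring

lemma log_diff (a b : ℝ) (ha : 0 < a) (hb : 0 < b) : |Real.log a - Real.log b| ≤ |a - b| * (a⁻¹ + b⁻¹) := by
  have key : ∀ a b : ℝ, 0 < a → 0 < b → Real.log a - Real.log b ≤ |a - b| * (a⁻¹ + b⁻¹) := by
    intro a b ha hb
    rw [← Real.log_div ha.ne' hb.ne']
    have h1 := Real.log_le_sub_one_of_pos (div_pos ha hb)
    have h2 : a / b - 1 = (a - b) * b⁻¹ := by field_simp
    have h3 : (a - b) * b⁻¹ ≤ |a - b| * b⁻¹ := by gcongr; exact le_abs_self _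
    have h4 : 0 ≤ |a - b| * a⁻¹ := by positivity
    rw [mul_add]; linarith
  rw [abs_le]
  constructor
  · have := key b a hb ha
    rw [abs_sub_comm, add_comm] at this; linarith
  · exact key a b ha hb

lemma Np_diff (x x' : ℂ) (ω : ℂ → ℝ) (hc : Continuous ω) (hi : Integrable ω) :
    |Np ω x' - Np ω x| ≤ ‖x' - x‖ * (GG ω x' + GG ω x) := by
  unfold Np
  rw [← mul_sub, ← integral_sub (kk_integrable x' ω hc hi) (kk_integrable x ω hc hi), abs_mul,
    abs_of_nonneg (by positivity : 0 ≤ (2 * Real.pi)⁻¹)]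
  have h1 : |∫ y, (kk x' y * ω y - kk x y * ω y)| ≤ ∫ y, ‖x' - x‖ * ((1 + ‖x' - y‖⁻¹) * |ω y| + (1 + ‖x - y‖⁻¹) * |ω y|) := by
    refine (abs_integral_le_integral_abs).trans ?_
    apply integral_mono_ae ((kk_integrable x' ω hc hi).sub (kk_integrable x ω hc hi)).abs
      (((GG_int x' ω hc hi).add (GG_int x ω hc hi)).const_mul _)
    filter_upwards [ae_ne_c x, ae_ne_c x'] with y hy hy'
    simp only [Pi.add_apply, Pi.sub_apply]
    rw [← sub_mul, abs_mul]
    have h2 := log_diff ‖x' - y‖ ‖x - y‖ (norm_pos_iff.2 (sub_ne_zero.2 hy')) (norm_pos_iff.2 (sub_ne_zero.2 hy))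
    have h3 : |‖x' - y‖ - ‖x - y‖| ≤ ‖x' - x‖ := by
      have := abs_norm_sub_norm_le (x' - y) (x - y); simpa using this
    have h4 : |kk x' y - kk x y| ≤ ‖x' - x‖ * ((1 + ‖x' - y‖⁻¹) + (1 + ‖x - y‖⁻¹)) := by
      unfold kk
      rw [sub_sub_sub_cancel_right]
      refine h2.trans ?_
      gcongr <;> linarith
    calc _ ≤ ‖x' - x‖ * ((1 + ‖x' - y‖⁻¹) + (1 + ‖x - y‖⁻¹)) * |ω y| := by gcongr
      _ = _ := by ring
  rw [integral_const_mul, integral_add (GG_int x' ω hc hi) (GG_int x ω hc hi)] at h1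
  have h3 := twopi_inv_le
  have h5 : 0 ≤ |∫ y, (kk x' y * ω y - kk x y * ω y)| := abs_nonneg _
  calc _ ≤ 1 * |∫ y, (kk x' y * ω y - kk x y * ω y)| := by gcongr; linarith
    _ ≤ _ := by rw [one_mul]; exact h1

lemma Np_Lp (p : ℝ) (hp : 1 < p) (hp2 : p < 2) (Λ : ℝ) : ∃ C : ℝ, 0 < C ∧ ∀ ω : ℂ → ℝ, Continuous ω → Integrable ω →
    ∫ y, |ω y| ≤ Λ → ∫⁻ x in ball (0:ℂ) 1, ENNReal.ofReal |Np ω x| ^ p ≤ ENNReal.ofReal C := by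
  obtain ⟨C, hC, h⟩ := core_GG p hp hp2 1 Λ
  refine ⟨C, hC, fun ω hc hi hω => le_trans ?_ (h ω hc hi hω)⟩
  apply setLIntegral_mono' measurableSet_ball
  intro x hx
  gcongr
  exact Np_abs x (by simpa using (mem_ball_zero_iff.1 hx).le) ω hc hi

lemma grad_Lp (p : ℝ) (hp : 1 < p) (hp2 : p < 2) (Λ : ℝ) : ∃ C : ℝ, 0 < C ∧ ∀ ω : ℂ → ℝ, Continuous ω → Integrable ω →
    ∫ y, |ω y| ≤ Λ → ∀ v : ℂ → ℝ, ContDiff ℝ 1 v → ∀ c : ℝ, (∀ x, v x = c + Np ω x) → ∀ w : ℂ, ‖w‖ = 1 →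
    ∫⁻ x in ball (0:ℂ) 1, ENNReal.ofReal |fderiv ℝ v x w| ^ p ≤ ENNReal.ofReal C := by
  obtain ⟨C, hC, h⟩ := core_GG p hp hp2 2 Λ
  refine ⟨2 ^ (p - 1) * (C + C), by positivity, fun ω hc hi hω v hv c hvc w hw => ?_⟩
  have hGm := GG_meas ω hc hi
  set s : ℕ → ℝ := fun n => 1 / ((n:ℝ) + 1) with hs
  have hs0 : ∀ n, 0 < s n := fun n => by rw [hs]; positivity
  have hs1 : ∀ n, s n ≤ 1 := fun n => by rw [hs]; simp only; rw [div_le_one (by positivity)]; linarith [Nat.cast_nonneg (α := ℝ) n]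
  set f : ℕ → ℂ → ℝ≥0∞ := fun n x => ENNReal.ofReal |(s n)⁻¹ * (v (x + s n • w) - v x)| ^ p with hf
  have hfm : ∀ n, Measurable (f n) := by
    intro n
    have : Continuous v := hv.continuous
    have h1 : Continuous fun x => |(s n)⁻¹ * (v (x + s n • w) - v x)| := by fun_prop
    exact h1.measurable.ennreal_ofReal.pow_const p
  have hlim : ∀ x, Tendsto (fun n => f n x) atTop (𝓝 (ENNReal.ofReal |fderiv ℝ v x w| ^ p)) := by
    intro x
    have h1 : HasFDerivAt v (fderiv ℝ v x) x := (hv.differentiable (by norm_num) x).hasFDerivAt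
    have h2 : Tendsto s atTop (𝓝 0) := tendsto_one_div_add_atTop_nhds_zero_nat
    have h3 := h1.hasLineDerivAt w
    have h4 : HasDerivAt (fun t : ℝ => v (x + t • w)) (fderiv ℝ v x w) 0 := h3
    rw [hasDerivAt_iff_tendsto_slope] at h4
    have h5 : Tendsto s atTop (𝓝[≠] 0) := tendsto_nhdsWithin_iff.2 ⟨h2, Eventually.of_forall fun n => (hs0 n).ne'⟩
    have h6 := h4.comp h5
    have h7 : (fun n => f n x) = fun n => ENNReal.ofReal |(slope (fun t : ℝ => v (x + t • w)) 0 ∘ s) n| ^ p := by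
      ext n
      simp only [hf, Function.comp, slope_def_field, zero_smul, add_zero, sub_zero]
      rw [div_eq_inv_mul]
    rw [h7]
    exact (ENNReal.continuous_rpow_const.tendsto _).comp ((ENNReal.continuous_ofReal.tendsto _).comp ((continuous_abs.tendsto _).comp h6))
  have hbd : ∀ n, ∫⁻ x in ball (0:ℂ) 1, f n x ≤ ENNReal.ofReal (2 ^ (p - 1) * (C + C)) := by
    intro n
    have hG2 := h ω hc hi hω
    have hGp : Measurable fun x => ENNReal.ofReal (GG ω x) ^ p := hGm.ennreal_ofReal.pow_const p
    have htr : ∫⁻ x in ball (0:ℂ) 1, ENNReal.ofReal (GG ω (x + s n • w)) ^ p ≤ ∫⁻ x in ball (0:ℂ) 2, ENNReal.ofReal (GG ω x) ^ p := by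
      have htr0 := lintegral_add_right_eq_self (μ := volume) ((ball (0:ℂ) 2).indicator (fun x => ENNReal.ofReal (GG ω x) ^ p)) (s n • w)
      rw [← lintegral_indicator measurableSet_ball (fun x => ENNReal.ofReal (GG ω x) ^ p),
        ← htr0, ← lintegral_indicator measurableSet_ball]
      apply lintegral_mono
      intro x; beta_reduce
      by_cases hx : x ∈ ball (0:ℂ) 1
      · have hx2 : x + s n • w ∈ ball (0:ℂ) 2 := by
          rw [mem_ball_zero_iff] at hx ⊢
          calc ‖x + s n • w‖ ≤ ‖x‖ + ‖s n • w‖ := norm_add_le _ _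
            _ < 2 := by rw [norm_smul, hw, Real.norm_of_nonneg (hs0 n).le]; linarith [hs1 n]
        rw [Set.indicator_of_mem hx, Set.indicator_of_mem hx2]
      · rw [Set.indicator_of_notMem hx]; exact zero_le
    have hmono : ∫⁻ x in ball (0:ℂ) 1, ENNReal.ofReal (GG ω x) ^ p ≤ ∫⁻ x in ball (0:ℂ) 2, ENNReal.ofReal (GG ω x) ^ p :=
      lintegral_mono_set (ball_subset_ball (by norm_num))
    calc ∫⁻ x in ball (0:ℂ) 1, f n x ≤ ∫⁻ x in ball (0:ℂ) 1, 2 ^ (p - 1) * (ENNReal.ofReal (GG ω (x + s n • w)) ^ p + ENNReal.ofReal (GG ω x) ^ p) := by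
          apply lintegral_mono
          intro x; beta_reduce
          refine le_trans ?_ (ENNReal.rpow_add_le_mul_rpow_add_rpow _ _ hp.le)
          simp only [hf]
          rw [← ENNReal.ofReal_add (GG_nonneg _ _) (GG_nonneg _ _)]
          gcongr
          have h1 := Np_diff x (x + s n • w) ω hc hi
          rw [add_sub_cancel_left, norm_smul, hw, Real.norm_of_nonneg (hs0 n).le, mul_one] at h1
          rw [hvc, hvc, add_sub_add_left_eq_sub, abs_mul, abs_of_pos (inv_pos.2 (hs0 n)), inv_mul_le_iff₀ (hs0 n)]
          exact h1
      _ = 2 ^ (p - 1) * ((∫⁻ x in ball (0:ℂ) 1, ENNReal.ofReal (GG ω (x + s n • w)) ^ p) + ∫⁻ x in ball (0:ℂ) 1, ENNReal.ofReal (GG ω x) ^ p) := by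
          rw [lintegral_const_mul' _ _ (ENNReal.rpow_ne_top_of_nonneg (by linarith) (by norm_num)), lintegral_add_right _ hGp]
      _ ≤ 2 ^ (p - 1) * (ENNReal.ofReal C + ENNReal.ofReal C) := by
          gcongr
          · exact htr.trans hG2
          · exact hmono.trans hG2
      _ = _ := by
          rw [ENNReal.ofReal_mul (by positivity), ENNReal.ofReal_add hC.le hC.le, ← ENNReal.ofReal_rpow_of_pos (by norm_num)]
          norm_num
  calc ∫⁻ x in ball (0:ℂ) 1, ENNReal.ofReal |fderiv ℝ v x w| ^ p = ∫⁻ x in ball (0:ℂ) 1, liminf (fun n => f n x) atTop := by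
        apply lintegral_congr; intro x; rw [(hlim x).liminf_eq]
    _ ≤ liminf (fun n => ∫⁻ x in ball (0:ℂ) 1, f n x) atTop := lintegral_liminf_le hfm
    _ ≤ liminf (fun _ : ℕ => ENNReal.ofReal (2 ^ (p - 1) * (C + C))) atTop := liminf_le_liminf (Eventually.of_forall hbd)
    _ = _ := by simp

lemma Lr_lip (ε : ℝ) (hε : 0 < ε) (a b : ℂ) : |Lr ε a - Lr ε b| ≤ ε⁻¹ * ‖a - b‖ := by
  have h := Convex.norm_image_sub_le_of_norm_fderiv_le (𝕜 := ℝ) (f := Lr ε) (C := ε⁻¹) (s := Set.univ) (x := b) (y := a)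
    (fun x _ => (Lr_contDiff ε hε).differentiable (by simp) x) (fun x _ => ?_) convex_univ trivial trivial
  · simpa using h
  apply ContinuousLinearMap.opNorm_le_bound _ (by positivity)
  intro w
  rw [Lr_fderiv ε hε, Real.norm_eq_abs, abs_mul, abs_of_pos (by positivity : 0 < (‖x‖ ^ 2 + ε ^ 2)⁻¹), ← div_eq_mul_inv,
    div_le_iff₀ (by positivity)]
  have h1 := dotC_le x w
  have h2 : ‖x‖ ≤ ε⁻¹ * (‖x‖ ^ 2 + ε ^ 2) := by
    rw [inv_mul_eq_div, le_div_iff₀ hε]; nlinarith [sq_nonneg (‖x‖ - ε), norm_nonneg x]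
  calc |dotC x w| ≤ ‖x‖ * ‖w‖ := h1
    _ ≤ ε⁻¹ * (‖x‖ ^ 2 + ε ^ 2) * ‖w‖ := by gcongr
    _ = _ := by ring

def ke (ε : ℝ) (x y : ℂ) : ℝ := Lr ε (x - y) - Real.log (1 + ‖y‖)

lemma ke_bd (ε : ℝ) (hε : 0 < ε) (hε1 : ε ≤ 1) (x y : ℂ) (hx : ‖x‖ ≤ 1) : |ke ε x y| ≤ 1 / 2 * Real.log (8 / ε ^ 2) := by
  unfold ke Lr
  have hy : 0 < 1 + ‖y‖ := by positivity
  have h1 : Real.log (1 + ‖y‖) = 1 / 2 * Real.log ((1 + ‖y‖) ^ 2) := by rw [Real.log_pow]; push_cast; ring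
  have hA : 0 < ‖x - y‖ ^ 2 + ε ^ 2 := by positivity
  have hB : 0 < (1 + ‖y‖) ^ 2 := by positivity
  have hyx : ‖y‖ ≤ 1 + ‖x - y‖ := by
    have := norm_sub_le x (x - y); rw [sub_sub_cancel] at this; linarith
  have hxy : ‖x - y‖ ≤ 1 + ‖y‖ := (norm_sub_le x y).trans (by linarith)
  have hd : 0 ≤ ‖x - y‖ := norm_nonneg _
  have hε2 : ε ^ 2 ≤ 1 := by nlinarith
  have he : 0 < 8 / ε ^ 2 := by positivity
  have h2 : (1 + ‖y‖) ^ 2 ≤ 8 / ε ^ 2 * (‖x - y‖ ^ 2 + ε ^ 2) := by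
    have h3 : (1 + ‖y‖) ^ 2 ≤ 8 + 2 * ‖x - y‖ ^ 2 := by nlinarith [sq_nonneg (‖x - y‖ - 2), norm_nonneg y]
    have h4 : 8 / ε ^ 2 * (‖x - y‖ ^ 2 + ε ^ 2) = 8 + 8 / ε ^ 2 * ‖x - y‖ ^ 2 := by field_simp; ring
    have h5 : 2 ≤ 8 / ε ^ 2 := by rw [le_div_iff₀ (by positivity)]; linarith
    rw [h4]; nlinarith [sq_nonneg ‖x - y‖]
  have h3 : ‖x - y‖ ^ 2 + ε ^ 2 ≤ 8 / ε ^ 2 * (1 + ‖y‖) ^ 2 := by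
    have h5 : 2 ≤ 8 / ε ^ 2 := by rw [le_div_iff₀ (by positivity)]; linarith
    nlinarith [norm_nonneg y]
  have l2 := Real.log_le_log hB h2
  have l3 := Real.log_le_log hA h3
  rw [Real.log_mul he.ne' hA.ne'] at l2
  rw [Real.log_mul he.ne' hB.ne'] at l3
  rw [h1, abs_le]; constructor <;> linarith

lemma ke_meas (ε : ℝ) (hε : 0 < ε) (x : ℂ) : Measurable (fun y => ke ε x y) := by unfold ke Lr; fun_prop

lemma ke_int (ε : ℝ) (hε : 0 < ε) (hε1 : ε ≤ 1) (x : ℂ) (hx : ‖x‖ ≤ 1) (ω : ℂ → ℝ) (hi : Integrable ω) :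
    Integrable (fun y => ke ε x y * ω y) := by
  refine hi.bdd_mul (c := 1 / 2 * Real.log (8 / ε ^ 2)) (ke_meas ε hε x).aestronglyMeasurable (Eventually.of_forall fun y => ?_)
  exact ke_bd ε hε hε1 x y hx

def Nre (ε : ℝ) (ω : ℂ → ℝ) (x : ℂ) : ℝ := (2 * Real.pi)⁻¹ * ∫ y, ke ε x y * ω y

lemma twopi_mul_le (a b : ℝ) (h : |a| ≤ b) : |(2 * Real.pi)⁻¹ * a| ≤ b := by
  rw [abs_mul, abs_of_nonneg (by positivity : 0 ≤ (2 * Real.pi)⁻¹)]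
  have h3 := twopi_inv_le
  calc _ ≤ 1 * |a| := by gcongr; linarith
    _ ≤ b := by rw [one_mul]; exact h

lemma Nre_bd (ε : ℝ) (hε : 0 < ε) (hε1 : ε ≤ 1) (x : ℂ) (hx : ‖x‖ ≤ 1) (ω : ℂ → ℝ) (hi : Integrable ω) :
    |Nre ε ω x| ≤ 1 / 2 * Real.log (8 / ε ^ 2) * ∫ y, |ω y| := by
  apply twopi_mul_le
  refine (abs_integral_le_integral_abs).trans ?_
  rw [← integral_const_mul]
  apply integral_mono (ke_int ε hε hε1 x hx ω hi).abs (hi.abs.const_mul _)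
  intro y; beta_reduce
  rw [abs_mul]; gcongr; exact ke_bd ε hε hε1 x y hx

lemma Nre_lip (ε : ℝ) (hε : 0 < ε) (hε1 : ε ≤ 1) (x x' : ℂ) (hx : ‖x‖ ≤ 1) (hx' : ‖x'‖ ≤ 1) (ω : ℂ → ℝ) (hi : Integrable ω) :
    |Nre ε ω x - Nre ε ω x'| ≤ ε⁻¹ * ‖x - x'‖ * ∫ y, |ω y| := by
  unfold Nre
  rw [← mul_sub, ← integral_sub (ke_int ε hε hε1 x hx ω hi) (ke_int ε hε hε1 x' hx' ω hi)]
  apply twopi_mul_le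
  refine (abs_integral_le_integral_abs).trans ?_
  rw [← integral_const_mul]
  apply integral_mono ((ke_int ε hε hε1 x hx ω hi).sub (ke_int ε hε hε1 x' hx' ω hi)).abs (hi.abs.const_mul _)
  intro y; beta_reduce
  simp only [Pi.sub_apply]
  rw [← sub_mul, abs_mul]; gcongr
  have := Lr_lip ε hε (x - y) (x' - y)
  rw [sub_sub_sub_cancel_right] at this
  unfold ke; rwa [sub_sub_sub_cancel_right]

lemma Nre_sub (ε : ℝ) (hε : 0 < ε) (hε1 : ε ≤ 1) (x : ℂ) (hx : ‖x‖ ≤ 1) (ω : ℂ → ℝ) (hc : Continuous ω) (hi : Integrable ω) :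
    |Nre ε ω x - Np ω x| ≤ ε * GG ω x := by
  unfold Nre Np
  rw [← mul_sub, ← integral_sub (ke_int ε hε hε1 x hx ω hi) (kk_integrable x ω hc hi)]
  apply twopi_mul_le
  refine (abs_integral_le_integral_abs).trans ?_
  unfold GG
  rw [← integral_const_mul]
  apply integral_mono_ae ((ke_int ε hε hε1 x hx ω hi).sub (kk_integrable x ω hc hi)).abs ((GG_int x ω hc hi).const_mul _)
  filter_upwards [ae_ne_c x] with y hy
  simp only [Pi.sub_apply]
  rw [← sub_mul, abs_mul, ← mul_assoc]; gcongr
  have := Lr_sub ε hε (x - y) (sub_ne_zero.2 hy)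
  unfold ke kk; rw [sub_sub_sub_cancel_right]
  refine this.trans ?_
  gcongr; linarith

lemma GG_L1 (Λ : ℝ) : ∃ C : ℝ, 0 < C ∧ ∀ ω : ℂ → ℝ, Continuous ω → Integrable ω →
    ∫ y, |ω y| ≤ Λ → ∫⁻ x in ball (0:ℂ) 1, ENNReal.ofReal (GG ω x) ≤ ENNReal.ofReal C := by
  obtain ⟨C, hC, h⟩ := core_GG (3/2) (by norm_num) (by norm_num) 1 Λ
  refine ⟨(volume (ball (0:ℂ) 1)).toReal + C, by positivity, fun ω hc hi hω => ?_⟩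
  calc ∫⁻ x in ball (0:ℂ) 1, ENNReal.ofReal (GG ω x) ≤ ∫⁻ x in ball (0:ℂ) 1, (1 + ENNReal.ofReal (GG ω x) ^ (3/2:ℝ)) := by
        apply lintegral_mono; intro x; beta_reduce
        rcases le_total (ENNReal.ofReal (GG ω x)) 1 with h1 | h1
        · exact h1.trans le_self_add
        · refine le_trans ?_ le_add_self
          calc ENNReal.ofReal (GG ω x) = ENNReal.ofReal (GG ω x) ^ (1:ℝ) := (ENNReal.rpow_one _).symm
            _ ≤ _ := ENNReal.rpow_le_rpow_of_exponent_le h1 (by norm_num)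
    _ = volume (ball (0:ℂ) 1) + ∫⁻ x in ball (0:ℂ) 1, ENNReal.ofReal (GG ω x) ^ (3/2:ℝ) := by
        rw [lintegral_add_left measurable_const]; simp
    _ ≤ _ := by
        rw [ENNReal.ofReal_add ENNReal.toReal_nonneg hC.le, ENNReal.ofReal_toReal measure_ball_lt_top.ne]
        gcongr
        exact h ω hc hi hω

lemma compact_pre (Λ : ℝ) (ω : ℕ → ℂ → ℝ) (hi : ∀ k, Integrable (ω k)) (hω : ∀ k, ∫ y, |ω k y| ≤ Λ)
    (e : ℕ → ℝ) (he : ∀ m, 0 < e m) (he1 : ∀ m, e m ≤ 1) :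
    ∃ φ : ℕ → ℕ, StrictMono φ ∧ ∀ m, ∀ x ∈ ball (0:ℂ) 1, ∃ l, Tendsto (fun k => Nre (e m) (ω (φ k)) x) atTop (𝓝 l) := by
  classical
  have hΛ : 0 ≤ Λ := le_trans (integral_nonneg fun y => abs_nonneg _) (hω 0)
  set d : ℕ → ℂ := TopologicalSpace.denseSeq ℂ with hd
  set M : ℕ → ℝ := fun m => 1 / 2 * Real.log (8 / e m ^ 2) * Λ with hM
  have hlog : ∀ m, 0 ≤ 1 / 2 * Real.log (8 / e m ^ 2) := fun m => (abs_nonneg _).trans (ke_bd (e m) (he m) (he1 m) 0 0 (by simp))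
  have hM0 : ∀ m, 0 ≤ M m := fun m => mul_nonneg (hlog m) hΛ
  set z : ℕ → (ℕ × ℕ → ℝ) := fun k i => if ‖d i.2‖ ≤ 1 then Nre (e i.1) (ω k) (d i.2) else 0 with hz
  have hcpt : IsCompact (Set.pi Set.univ (fun i : ℕ × ℕ => Set.Icc (-M i.1) (M i.1))) := isCompact_univ_pi fun i => isCompact_Icc
  have hmem : ∀ k, z k ∈ Set.pi Set.univ (fun i : ℕ × ℕ => Set.Icc (-M i.1) (M i.1)) := by
    intro k i _
    simp only [hz]
    rw [Set.mem_Icc, ← abs_le]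
    split_ifs with h
    · refine (Nre_bd (e i.1) (he _) (he1 _) _ h _ (hi k)).trans ?_
      exact mul_le_mul_of_nonneg_left (hω k) (hlog _)
    · simpa using hM0 i.1
  obtain ⟨l, -, φ, hφ, hl⟩ := hcpt.tendsto_subseq hmem
  refine ⟨φ, hφ, fun m x hx => ?_⟩
  apply cauchySeq_tendsto_of_complete
  rw [Metric.cauchySeq_iff]
  intro η hη
  set L := (e m)⁻¹ * Λ with hL
  have hL0 : 0 ≤ L := mul_nonneg (inv_nonneg.2 (he m).le) hΛ
  obtain ⟨y, hy, j, rfl⟩ : ∃ y ∈ ball (0:ℂ) 1 ∩ ball x (η / (4 * (L + 1))), y ∈ Set.range d :=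
    (TopologicalSpace.denseRange_denseSeq ℂ).inter_open_nonempty _ (isOpen_ball.inter isOpen_ball) ⟨x, hx, mem_ball_self (by positivity)⟩
  have hdj : ‖d j‖ ≤ 1 := (mem_ball_zero_iff.1 hy.1).le
  have hxn : ‖x‖ ≤ 1 := (mem_ball_zero_iff.1 hx).le
  have hconv : Tendsto (fun k => Nre (e m) (ω (φ k)) (d j)) atTop (𝓝 (l (m, j))) := by
    have := (tendsto_pi_nhds.1 hl) (m, j)
    simpa [hz, Function.comp_def, hdj] using this
  have hcau := hconv.cauchySeq
  rw [Metric.cauchySeq_iff] at hcau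
  obtain ⟨N, hN⟩ := hcau (η / 2) (by positivity)
  refine ⟨N, fun a ha b hb => ?_⟩
  have h1 := hN a ha b hb
  have hdist : ‖x - d j‖ < η / (4 * (L + 1)) := by
    have := hy.2; rwa [mem_ball, dist_eq_norm, norm_sub_rev] at this
  have hlip : ∀ k, |Nre (e m) (ω k) x - Nre (e m) (ω k) (d j)| < η / 4 := by
    intro k
    refine (Nre_lip (e m) (he m) (he1 m) x (d j) hxn hdj _ (hi k)).trans_lt ?_
    have hem := inv_pos.2 (he m)
    calc (e m)⁻¹ * ‖x - d j‖ * ∫ y, |ω k y| ≤ (e m)⁻¹ * ‖x - d j‖ * Λ := by gcongr; exact hω k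
      _ = L * ‖x - d j‖ := by rw [hL]; ring
      _ ≤ L * (η / (4 * (L + 1))) := by gcongr
      _ < (L + 1) * (η / (4 * (L + 1))) := by gcongr; linarith
      _ = η / 4 := by field_simp
  have h2 := hlip (φ a)
  have h3 := hlip (φ b)
  rw [Real.dist_eq] at h1 ⊢
  rw [abs_lt] at *
  constructor <;> linarith

lemma compact_L1 (Λ : ℝ) (ω : ℕ → ℂ → ℝ) (hc : ∀ k, Continuous (ω k)) (hi : ∀ k, Integrable (ω k)) (hω : ∀ k, ∫ y, |ω k y| ≤ Λ)
    (hN : ∀ k, Continuous (Np (ω k))) :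
    ∃ φ : ℕ → ℕ, StrictMono φ ∧ ∃ N : ℂ → ℝ, Measurable N ∧ IntegrableOn N (ball 0 1) ∧
      Tendsto (fun k => ∫⁻ x in ball (0:ℂ) 1, ENNReal.ofReal |Np (ω (φ k)) x - N x|) atTop (𝓝 0) ∧
      ∀ᵐ x ∂(volume.restrict (ball (0:ℂ) 1)), Tendsto (fun k => Np (ω (φ k)) x) atTop (𝓝 (N x)) := by
  obtain ⟨C, hC, hGG⟩ := GG_L1 Λ
  set μ := volume.restrict (ball (0:ℂ) 1) with hμ
  have : IsFiniteMeasure μ := ⟨by simp [hμ, measure_ball_lt_top]⟩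
  set e : ℕ → ℝ := fun m => 1 / ((m:ℝ) + 1) with he_def
  have he : ∀ n, 0 < e n := fun n => by rw [he_def]; positivity
  have he1 : ∀ n, e n ≤ 1 := fun n => by rw [he_def]; simp only; rw [div_le_one (by positivity)]; linarith [Nat.cast_nonneg (α := ℝ) n]
  obtain ⟨φ, hφ, hconv⟩ := compact_pre Λ ω hi hω e he he1
  choose! G hG using hconv
  have hball : ∀ᵐ x ∂μ, x ∈ ball (0:ℂ) 1 := ae_restrict_mem measurableSet_ball
  have hNm : ∀ m k, AEMeasurable (Nre (e m) (ω k)) μ := by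
    intro m k
    have : ContinuousOn (Nre (e m) (ω k)) (ball 0 1) := by
      apply LipschitzOnWith.continuousOn (K := ((e m)⁻¹ * ∫ y, |ω k y|).toNNReal)
      apply LipschitzOnWith.of_dist_le_mul
      intro x hx y hy
      rw [Real.coe_toNNReal _ (mul_nonneg (inv_nonneg.2 (he m).le) (integral_nonneg fun y => abs_nonneg _)), Real.dist_eq, dist_eq_norm]
      refine (Nre_lip (e m) (he m) (he1 m) x y (mem_ball_zero_iff.1 hx).le (mem_ball_zero_iff.1 hy).le _ (hi k)).trans (le_of_eq ?_)
      ring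
    exact this.aemeasurable measurableSet_ball
  have hae : ∀ m, ∀ᵐ x ∂μ, Tendsto (fun k => Nre (e m) (ω (φ k)) x) atTop (𝓝 (G m x)) := by
    intro m; filter_upwards [hball] with x hx using hG m x hx
  have hGm : ∀ m, AEMeasurable (G m) μ := fun m => aemeasurable_of_tendsto_metrizable_ae atTop (fun k => hNm m (φ k)) (hae m)
  have hE : ∀ m, Tendsto (fun k => ∫⁻ x, ENNReal.ofReal |Nre (e m) (ω (φ k)) x - G m x| ∂μ) atTop (𝓝 0) := by
    intro m
    set B := 1 / 2 * Real.log (8 / e m ^ 2) * Λ with hB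
    have hbd : ∀ k, ∀ x ∈ ball (0:ℂ) 1, |Nre (e m) (ω k) x| ≤ B := by
      intro k x hx
      refine (Nre_bd (e m) (he m) (he1 m) x (mem_ball_zero_iff.1 hx).le _ (hi k)).trans ?_
      exact mul_le_mul_of_nonneg_left (hω k) ((abs_nonneg _).trans (ke_bd (e m) (he m) (he1 m) 0 0 (by simp)))
    have := tendsto_lintegral_of_dominated_convergence' (μ := μ) (F := fun k x => ENNReal.ofReal |Nre (e m) (ω (φ k)) x - G m x|)
      (f := fun _ => 0) (fun _ => ENNReal.ofReal (B + B)) (fun k => ((hNm m (φ k)).sub (hGm m)).abs.ennreal_ofReal)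
      (fun k => by
        filter_upwards [hball] with x hx
        apply ENNReal.ofReal_le_ofReal
        have h1 : |G m x| ≤ B := le_of_tendsto' (hG m x hx).abs (fun k => hbd (φ k) x hx)
        exact (abs_sub _ _).trans (add_le_add (hbd _ x hx) h1))
      (by simp [ENNReal.mul_eq_top, measure_ne_top])
      (by
        filter_upwards [hae m] with x hx
        have h2 : Tendsto (fun k => |Nre (e m) (ω (φ k)) x - G m x|) atTop (𝓝 0) := by
          have := (hx.sub_const (G m x)).abs; simpa using this
        have := (ENNReal.continuous_ofReal.tendsto _).comp h2
        simpa [Function.comp_def] using this)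
    simpa using this
  have hsub : ∀ m k, ∫⁻ x, ENNReal.ofReal |Np (ω k) x - Nre (e m) (ω k) x| ∂μ ≤ ENNReal.ofReal (e m * C) := by
    intro m k
    calc _ ≤ ∫⁻ x, ENNReal.ofReal (e m) * ENNReal.ofReal (GG (ω k) x) ∂μ := by
          apply lintegral_mono_ae
          filter_upwards [hball] with x hx
          rw [← ENNReal.ofReal_mul (he m).le, abs_sub_comm]
          exact ENNReal.ofReal_le_ofReal (Nre_sub (e m) (he m) (he1 m) x (mem_ball_zero_iff.1 hx).le _ (hc k) (hi k))
      _ = ENNReal.ofReal (e m) * ∫⁻ x, ENNReal.ofReal (GG (ω k) x) ∂μ := lintegral_const_mul' _ _ ENNReal.ofReal_ne_top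
      _ ≤ _ := by
          rw [ENNReal.ofReal_mul (he m).le]; gcongr; exact hGG _ (hc k) (hi k) (hω k)
  have hmem : ∀ k, MemLp (Np (ω k)) 1 μ := by
    intro k
    rw [memLp_one_iff_integrable]
    refine ⟨(hN k).aestronglyMeasurable, ?_⟩
    rw [hasFiniteIntegral_iff_norm]
    refine lt_of_le_of_lt ?_ (ENNReal.ofReal_lt_top (r := C))
    refine le_trans (lintegral_mono_ae ?_) (hGG _ (hc k) (hi k) (hω k))
    filter_upwards [hball] with x hx
    exact ENNReal.ofReal_le_ofReal (Np_abs x (mem_ball_zero_iff.1 hx).le _ (hc k) (hi k))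
  set f : ℕ → Lp ℝ 1 μ := fun k => (hmem (φ k)).toLp (Np (ω (φ k))) with hf
  have hcau : CauchySeq f := by
    rw [EMetric.cauchySeq_iff]
    intro η hη
    obtain ⟨m, hm⟩ : ∃ m, ENNReal.ofReal (e m * C) < η / 4 := by
      have h1 : Tendsto e atTop (𝓝 0) := tendsto_one_div_add_atTop_nhds_zero_nat
      have h2 := (ENNReal.continuous_ofReal.tendsto _).comp (h1.mul_const C)
      rw [zero_mul, ENNReal.ofReal_zero] at h2
      exact (h2.eventually_lt_const (ENNReal.div_pos hη.ne' (by norm_num))).exists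
    obtain ⟨K, hK⟩ := eventually_atTop.1 ((hE m).eventually_lt_const (ENNReal.div_pos hη.ne' (by norm_num : (4:ℝ≥0∞) ≠ ⊤)))
    have hone : ∀ k, ∫⁻ x, ENNReal.ofReal |Np (ω (φ k)) x - G m x| ∂μ ≤ ENNReal.ofReal (e m * C) + ∫⁻ x, ENNReal.ofReal |Nre (e m) (ω (φ k)) x - G m x| ∂μ := by
      intro k
      refine le_trans ?_ (add_le_add_left (hsub m (φ k)) _)
      have hms : AEMeasurable (fun x => ENNReal.ofReal |Nre (e m) (ω (φ k)) x - G m x|) μ := ((hNm m (φ k)).sub (hGm m)).abs.ennreal_ofReal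
      rw [← lintegral_add_right' _ hms]
      apply lintegral_mono; intro x; beta_reduce
      rw [← ENNReal.ofReal_add (abs_nonneg _) (abs_nonneg _)]
      exact ENNReal.ofReal_le_ofReal (abs_sub_le _ _ _)
    refine ⟨K, fun a ha b hb => ?_⟩
    simp only [hf]
    rw [Lp.edist_toLp_toLp, eLpNorm_one_eq_lintegral_enorm]
    calc ∫⁻ x, ‖(Np (ω (φ a)) - Np (ω (φ b))) x‖ₑ ∂μ
        ≤ ∫⁻ x, (ENNReal.ofReal |Np (ω (φ a)) x - G m x| + ENNReal.ofReal |Np (ω (φ b)) x - G m x|) ∂μ := by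
          apply lintegral_mono; intro x; beta_reduce
          rw [Pi.sub_apply, ← ENNReal.ofReal_add (abs_nonneg _) (abs_nonneg _), ← ofReal_norm, Real.norm_eq_abs]
          apply ENNReal.ofReal_le_ofReal
          rw [abs_sub_comm (Np (ω (φ b)) x)]
          exact abs_sub_le _ _ _
      _ = ∫⁻ x, ENNReal.ofReal |Np (ω (φ a)) x - G m x| ∂μ + ∫⁻ x, ENNReal.ofReal |Np (ω (φ b)) x - G m x| ∂μ :=
          lintegral_add_right' _ ((hN _).aemeasurable.sub (hGm m)).abs.ennreal_ofReal
      _ ≤ (ENNReal.ofReal (e m * C) + ∫⁻ x, ENNReal.ofReal |Nre (e m) (ω (φ a)) x - G m x| ∂μ) +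
          (ENNReal.ofReal (e m * C) + ∫⁻ x, ENNReal.ofReal |Nre (e m) (ω (φ b)) x - G m x| ∂μ) := add_le_add (hone a) (hone b)
      _ < (η / 4 + η / 4) + (η / 4 + η / 4) := by
          have ha' := hK a ha
          have hb' := hK b hb
          exact ENNReal.add_lt_add (ENNReal.add_lt_add hm ha') (ENNReal.add_lt_add hm hb')
      _ = η := by
          have h4 : η / 4 = η / 2 / 2 := by
            rw [ENNReal.div_eq_inv_mul, ENNReal.div_eq_inv_mul, ENNReal.div_eq_inv_mul, ← mul_assoc, ← ENNReal.mul_inv (by norm_num) (by norm_num)]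
            norm_num
          rw [h4, ENNReal.add_halves, ENNReal.add_halves]
  obtain ⟨F, hF⟩ := cauchySeq_tendsto_of_complete hcau
  have hFm := (Lp.aestronglyMeasurable F).aemeasurable
  set N : ℂ → ℝ := hFm.mk F with hNdef
  have hNF : F =ᵐ[μ] N := hFm.ae_eq_mk
  have hlim : Tendsto (fun k => eLpNorm (Np (ω (φ k)) - N) 1 μ) atTop (𝓝 0) := by
    rw [tendsto_iff_edist_tendsto_0] at hF
    refine hF.congr fun k => ?_
    rw [Lp.edist_def]
    apply eLpNorm_congr_ae
    filter_upwards [(hmem (φ k)).coeFn_toLp, hNF] with x hx hx2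
    simp only [Pi.sub_apply, hf, hx, hx2]
  have htm := tendstoInMeasure_of_tendsto_eLpNorm one_ne_zero (fun k => (hmem (φ k)).1) hFm.measurable_mk.aestronglyMeasurable hlim
  obtain ⟨ψ, hψ, hψae⟩ := htm.exists_seq_tendsto_ae
  refine ⟨φ ∘ ψ, hφ.comp hψ, N, hFm.measurable_mk, ?_, ?_, hψae⟩
  · exact (memLp_one_iff_integrable.1 ((Lp.memLp F).ae_eq hNF))
  · have := hlim.comp hψ.tendsto_atTop
    refine this.congr fun k => ?_
    simp only [Function.comp]
    rw [eLpNorm_one_eq_lintegral_enorm]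
    apply lintegral_congr; intro x
    rw [Pi.sub_apply, ← ofReal_norm, Real.norm_eq_abs]

lemma Np_up (Λ r : ℝ) (hr1 : r < 1) (x : ℂ) (hx : ‖x‖ < r) (ω : ℂ → ℝ) (hc : Continuous ω) (hi : Integrable ω)
    (hω : ∫ y, |ω y| ≤ Λ) :
    Np ω x ≤ (2 * Real.pi)⁻¹ * (Λ * (Real.log 2 + (1 - r)⁻¹)) + (2 * Real.pi)⁻¹ * ∫ y in ball (0:ℂ) 1, Lg x y * |ω y| := by
  refine (Np_le x ω hc hi).trans ?_
  rw [Lg_split x ω hc hi (ball 0 1) measurableSet_ball]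
  have h0 : 0 ≤ ∫ y, |ω y| := integral_nonneg fun y => abs_nonneg _
  have h1 : (∫ y, |ω y|) * Real.log (1 + ‖x‖) ≤ Λ * Real.log 2 := by
    apply mul_le_mul hω (Real.log_le_log (by positivity) (by linarith)) (Real.log_nonneg (by linarith [norm_nonneg x])) (h0.trans hω)
  have h2 : ∫ y in (ball (0:ℂ) 1)ᶜ, Lg x y * |ω y| ≤ Λ * (1 - r)⁻¹ := by
    calc _ ≤ ∫ y in (ball (0:ℂ) 1)ᶜ, (1 - r)⁻¹ * |ω y| := by
          apply setIntegral_mono_on (Lg_integrable x ω hc hi).integrableOn (hi.abs.const_mul _).integrableOn measurableSet_ball.compl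
          intro y hy
          gcongr
          refine (Lg_le x y).trans ?_
          have h3 : 1 ≤ ‖y‖ := by simpa using hy
          have h4 : 1 - r ≤ ‖x - y‖ := by
            have := norm_sub_norm_le y x; rw [norm_sub_rev] at this; linarith
          gcongr
      _ ≤ ∫ y, (1 - r)⁻¹ * |ω y| := by
          apply setIntegral_le_integral (hi.abs.const_mul _)
          refine Eventually.of_forall fun y => ?_
          have : 0 ≤ (1 - r)⁻¹ := inv_nonneg.2 (by linarith)
          exact mul_nonneg this (abs_nonneg _)
      _ ≤ _ := by
          rw [integral_const_mul, mul_comm]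
          have : 0 ≤ (1 - r)⁻¹ := inv_nonneg.2 (by linarith)
          gcongr
  rw [mul_assoc, ← mul_add, ← mul_add]
  apply mul_le_mul_of_nonneg_left _ (by positivity)
  linarith

lemma exp_pt (Λ r τ : ℝ) (hr1 : r < 1) (q δ : ℝ) (hq : 0 ≤ q) (hδ : 0 < δ) (hδ2 : δ < 2) (hqδ : q * (2 * Real.pi)⁻¹ * τ ≤ δ)
    (x : ℂ) (hx : ‖x‖ < r) (ω : ℂ → ℝ) (hc : Continuous ω) (hi : Integrable ω)
    (hω : ∫ y, |ω y| ≤ Λ) (hτ : ∫ y in ball (0:ℂ) 1, |ω y| ≤ τ) :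
    ENNReal.ofReal (Real.exp (q * Np ω x)) ≤ ENNReal.ofReal (Real.exp (q * ((2 * Real.pi)⁻¹ * (Λ * (Real.log 2 + (1 - r)⁻¹))))) *
      (1 + ENNReal.ofReal (4 / δ) * ∫⁻ y in ball (0:ℂ) 1, (1 + ENNReal.ofReal (‖x - y‖ ^ (-δ))) * ENNReal.ofReal (q * (2 * Real.pi)⁻¹ * |ω y|)) := by
  have h1 := Np_up Λ r hr1 x hx ω hc hi hω
  have h2 := exp_master x ω hc hi (ball 0 1) measurableSet_ball (q * (2 * Real.pi)⁻¹) δ (by positivity) hδ hδ2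
    (le_trans (by gcongr) hqδ)
  refine le_trans ?_ (mul_le_mul_right h2 _)
  rw [← ENNReal.ofReal_mul (Real.exp_nonneg _), ← Real.exp_add]
  apply ENNReal.ofReal_le_ofReal
  apply Real.exp_le_exp.2
  rw [mul_assoc q, ← mul_add]
  gcongr

lemma exp_int (Λ r τ : ℝ) (hr1 : r < 1) (hτ0 : 0 < τ) (q : ℝ) (hq : 0 < q) (hqτ : q < 4 * Real.pi / τ) :
    ∃ C : ℝ, 0 < C ∧ ∀ ω : ℂ → ℝ, Continuous ω → Integrable ω → ∫ y, |ω y| ≤ Λ → ∫ y in ball (0:ℂ) 1, |ω y| ≤ τ →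
      ∫⁻ x in ball (0:ℂ) r, ENNReal.ofReal (Real.exp (q * Np ω x)) ≤ ENNReal.ofReal C := by
  set δ := q * (2 * Real.pi)⁻¹ * τ with hδ
  have hδ0 : 0 < δ := by positivity
  have hδ2 : δ < 2 := by
    rw [lt_div_iff₀ hτ0] at hqτ
    have : δ = q * τ / (2 * Real.pi) := by rw [hδ]; field_simp
    rw [this, div_lt_iff₀ (by positivity)]; linarith
  obtain ⟨C₀, hC₀, hk⟩ := kint δ hδ0.le hδ2 r
  set K := ENNReal.ofReal (Real.exp (q * ((2 * Real.pi)⁻¹ * (Λ * (Real.log 2 + (1 - r)⁻¹))))) with hK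
  set B : ℝ≥0∞ := K * (volume (ball (0:ℂ) r) + ENNReal.ofReal (4 / δ) * ((volume (ball (0:ℂ) r) + ENNReal.ofReal C₀) * ENNReal.ofReal (q * (2 * Real.pi)⁻¹ * Λ))) with hB
  have hv : volume (ball (0:ℂ) r) ≠ ⊤ := measure_ball_lt_top.ne
  have hBf : B ≠ ⊤ := by
    refine ENNReal.mul_ne_top ENNReal.ofReal_ne_top (ENNReal.add_ne_top.2 ⟨hv, ENNReal.mul_ne_top ENNReal.ofReal_ne_top (ENNReal.mul_ne_top (ENNReal.add_ne_top.2 ⟨hv, ENNReal.ofReal_ne_top⟩) ENNReal.ofReal_ne_top)⟩)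
  refine ⟨B.toReal + 1, by positivity, fun ω hc hi hω hτ => ?_⟩
  have hle : B ≤ ENNReal.ofReal (B.toReal + 1) := by
    rw [← ENNReal.ofReal_toReal hBf]; apply ENNReal.ofReal_le_ofReal
    rw [ENNReal.toReal_ofReal ENNReal.toReal_nonneg]; linarith
  refine le_trans ?_ hle
  have hmω : Measurable (fun y => ENNReal.ofReal (q * (2 * Real.pi)⁻¹ * |ω y|)) := by
    have := hc.measurable; fun_prop
  have hsw : ∫⁻ x in ball (0:ℂ) r, ∫⁻ y in ball (0:ℂ) 1, (1 + ENNReal.ofReal (‖x - y‖ ^ (-δ))) * ENNReal.ofReal (q * (2 * Real.pi)⁻¹ * |ω y|)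
      ≤ (volume (ball (0:ℂ) r) + ENNReal.ofReal C₀) * ENNReal.ofReal (q * (2 * Real.pi)⁻¹ * Λ) := by
    rw [lintegral_lintegral_swap (Measurable.aemeasurable (by
      unfold Function.uncurry
      have := hc.measurable
      fun_prop))]
    calc _ ≤ ∫⁻ y in ball (0:ℂ) 1, (volume (ball (0:ℂ) r) + ENNReal.ofReal C₀) * ENNReal.ofReal (q * (2 * Real.pi)⁻¹ * |ω y|) := by
          apply lintegral_mono; intro y; beta_reduce
          rw [lintegral_mul_const' _ _ ENNReal.ofReal_ne_top, lintegral_add_left measurable_const]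
          gcongr
          · simp
          · exact hk y
      _ = (volume (ball (0:ℂ) r) + ENNReal.ofReal C₀) * ∫⁻ y in ball (0:ℂ) 1, ENNReal.ofReal (q * (2 * Real.pi)⁻¹ * |ω y|) :=
          lintegral_const_mul' _ _ (ENNReal.add_ne_top.2 ⟨hv, ENNReal.ofReal_ne_top⟩)
      _ ≤ (volume (ball (0:ℂ) r) + ENNReal.ofReal C₀) * ∫⁻ y, ENNReal.ofReal (q * (2 * Real.pi)⁻¹ * |ω y|) := by
          exact mul_le_mul_right (setLIntegral_le_lintegral _ _) _
      _ ≤ _ := by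
          rw [← ofReal_integral_eq_lintegral_ofReal (hi.abs.const_mul _) (Eventually.of_forall fun y => by positivity), integral_const_mul]
          gcongr
  calc ∫⁻ x in ball (0:ℂ) r, ENNReal.ofReal (Real.exp (q * Np ω x))
      ≤ ∫⁻ x in ball (0:ℂ) r, K * (1 + ENNReal.ofReal (4 / δ) * ∫⁻ y in ball (0:ℂ) 1, (1 + ENNReal.ofReal (‖x - y‖ ^ (-δ))) * ENNReal.ofReal (q * (2 * Real.pi)⁻¹ * |ω y|)) := by
        apply setLIntegral_mono' measurableSet_ball
        intro x hx
        exact exp_pt Λ r τ hr1 q δ hq.le hδ0 hδ2 le_rfl x (mem_ball_zero_iff.1 hx) ω hc hi hω hτ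
    _ = K * (volume (ball (0:ℂ) r) + ENNReal.ofReal (4 / δ) * ∫⁻ x in ball (0:ℂ) r, ∫⁻ y in ball (0:ℂ) 1, (1 + ENNReal.ofReal (‖x - y‖ ^ (-δ))) * ENNReal.ofReal (q * (2 * Real.pi)⁻¹ * |ω y|)) := by
        rw [lintegral_const_mul' _ _ ENNReal.ofReal_ne_top, lintegral_add_left measurable_const, lintegral_const_mul' _ _ ENNReal.ofReal_ne_top,
          lintegral_const, one_mul, Measure.restrict_apply_univ]
    _ ≤ B := by rw [hB]; gcongr

lemma vitali0 {μ : Measure ℂ} [IsFiniteMeasure μ] (h : ℕ → ℂ → ℝ) (hm : ∀ k, AEMeasurable (h k) μ) (h0 : ∀ k x, 0 ≤ h k x)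
    (hae : ∀ᵐ x ∂μ, Tendsto (fun k => h k x) atTop (𝓝 0)) (s : ℝ) (hs : 1 < s) (C : ℝ) (hC : 0 ≤ C)
    (hb : ∀ k, ∫⁻ x, ENNReal.ofReal (h k x ^ s) ∂μ ≤ ENNReal.ofReal C) :
    Tendsto (fun k => ∫⁻ x, ENNReal.ofReal (h k x) ∂μ) atTop (𝓝 0) := by
  have key : ∀ M : ℝ, 0 < M → ∀ k, ∫⁻ x, ENNReal.ofReal (h k x) ∂μ ≤ ∫⁻ x, ENNReal.ofReal (min (h k x) M) ∂μ + ENNReal.ofReal (M ^ (1 - s) * C) := by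
    intro M hM k
    calc _ ≤ ∫⁻ x, (ENNReal.ofReal (min (h k x) M) + ENNReal.ofReal (M ^ (1 - s)) * ENNReal.ofReal (h k x ^ s)) ∂μ := by
          apply lintegral_mono; intro x; beta_reduce
          rcases le_total (h k x) M with hle | hle
          · rw [min_eq_left hle]; exact le_self_add
          · refine le_trans ?_ le_add_self
            rw [← ENNReal.ofReal_mul (by positivity)]
            apply ENNReal.ofReal_le_ofReal
            have hp : 0 < h k x := hM.trans_le hle
            have h1 : h k x ^ s = h k x ^ (s - 1) * h k x := by
              rw [← Real.rpow_add_one hp.ne']; ring_nf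
            have h2 : M ^ (s - 1) ≤ h k x ^ (s - 1) := Real.rpow_le_rpow hM.le hle (by linarith)
            have h3 : M ^ (1 - s) * M ^ (s - 1) = 1 := by rw [← Real.rpow_add hM]; simp
            rw [h1]
            calc h k x = M ^ (1 - s) * (M ^ (s - 1) * h k x) := by rw [← mul_assoc, h3, one_mul]
              _ ≤ _ := by gcongr
      _ = ∫⁻ x, ENNReal.ofReal (min (h k x) M) ∂μ + ENNReal.ofReal (M ^ (1 - s)) * ∫⁻ x, ENNReal.ofReal (h k x ^ s) ∂μ := by
          rw [lintegral_add_left' ((hm k).min aemeasurable_const).ennreal_ofReal, lintegral_const_mul' _ _ ENNReal.ofReal_ne_top]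
      _ ≤ _ := by
          rw [ENNReal.ofReal_mul (by positivity)]; gcongr; exact hb k
  have hmin : ∀ M : ℝ, 0 < M → Tendsto (fun k => ∫⁻ x, ENNReal.ofReal (min (h k x) M) ∂μ) atTop (𝓝 0) := by
    intro M hM
    have := tendsto_lintegral_of_dominated_convergence' (μ := μ) (F := fun k x => ENNReal.ofReal (min (h k x) M))
      (f := fun _ => 0) (fun _ => ENNReal.ofReal M) (fun k => ((hm k).min aemeasurable_const).ennreal_ofReal)
      (fun k => Eventually.of_forall fun x => ENNReal.ofReal_le_ofReal (min_le_right _ _))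
      (by simp [ENNReal.mul_eq_top, measure_ne_top])
      (by
        filter_upwards [hae] with x hx
        have h2 : Tendsto (fun k => min (h k x) M) atTop (𝓝 0) := by
          have := hx.min (tendsto_const_nhds (x := M)); rwa [min_eq_left hM.le] at this
        have := (ENNReal.continuous_ofReal.tendsto _).comp h2
        simpa [Function.comp_def] using this)
    simpa using this
  rw [ENNReal.tendsto_nhds_zero]
  intro η hη
  obtain ⟨M, hM0, hM⟩ : ∃ M : ℝ, 0 < M ∧ ENNReal.ofReal (M ^ (1 - s) * C) < η / 2 := by
    have h1 : Tendsto (fun M : ℝ => M ^ (1 - s)) atTop (𝓝 0) := by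
      have := tendsto_rpow_neg_atTop (show 0 < s - 1 by linarith); simpa using this
    have h2 := (ENNReal.continuous_ofReal.tendsto _).comp (h1.mul_const C)
    rw [zero_mul, ENNReal.ofReal_zero] at h2
    exact ((eventually_gt_atTop 0).and (h2.eventually_lt_const (ENNReal.half_pos hη.ne'))).exists
  filter_upwards [(hmin M hM0).eventually_lt_const (ENNReal.half_pos hη.ne')] with k hk
  calc _ ≤ _ := key M hM0 k
    _ ≤ η / 2 + η / 2 := add_le_add hk.le hM.le
    _ = η := ENNReal.add_halves η

lemma Lq_conv (Λ τ : ℝ) (hτ0 : 0 < τ) (ω : ℕ → ℂ → ℝ) (hc : ∀ k, Continuous (ω k)) (hi : ∀ k, Integrable (ω k))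
    (hω : ∀ k, ∫ y, |ω k y| ≤ Λ) (hωτ : ∀ k, ∫ y in ball (0:ℂ) 1, |ω k y| ≤ τ)
    (hN : ∀ k, Continuous (Np (ω k))) (N : ℂ → ℝ) (hNm : Measurable N)
    (hae : ∀ᵐ x ∂(volume.restrict (ball (0:ℂ) 1)), Tendsto (fun k => Np (ω k) x) atTop (𝓝 (N x)))
    (c : ℕ → ℝ) (M : ℝ) (hcM : ∀ k, c k ≤ M) (a : ℝ) (hca : Tendsto (fun k => Real.exp (c k)) atTop (𝓝 a))
    (r : ℝ) (hr1 : r < 1) (q : ℝ) (hq : 1 ≤ q) (hqτ : q < 4 * Real.pi / τ) :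
    Tendsto (fun k => ∫ x in ball (0:ℂ) r, |Real.exp (c k + Np (ω k) x) - a * Real.exp (N x)| ^ q) atTop (𝓝 0) := by
  set μ := volume.restrict (ball (0:ℂ) r) with hμ
  have : IsFiniteMeasure μ := ⟨by rw [hμ, Measure.restrict_apply_univ]; exact measure_ball_lt_top⟩
  have hae' : ∀ᵐ x ∂μ, Tendsto (fun k => Np (ω k) x) atTop (𝓝 (N x)) :=
    ae_mono (Measure.restrict_mono (ball_subset_ball hr1.le) le_rfl) hae
  have hconv : ∀ᵐ x ∂μ, Tendsto (fun k => Real.exp (c k + Np (ω k) x)) atTop (𝓝 (a * Real.exp (N x))) := by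
    filter_upwards [hae'] with x hx
    simp_rw [Real.exp_add]
    exact hca.mul ((Real.continuous_exp.tendsto _).comp hx)
  have ha0 : 0 ≤ a := ge_of_tendsto' hca fun k => (Real.exp_pos _).le
  set q' := (q + 4 * Real.pi / τ) / 2 with hq'
  have hqq : q < q' := by rw [hq']; linarith
  have hq'1 : 1 < q' := by linarith
  obtain ⟨C, hC, hE⟩ := exp_int Λ r τ hr1 hτ0 q' (by linarith) (by rw [hq']; linarith)
  set C1 := Real.exp (q' * M) * C with hC1
  have hC1p : 0 < C1 := by positivity
  have hmA : ∀ k, Measurable (fun x => Real.exp (c k + Np (ω k) x)) := fun k => by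
    have := hN k; exact (by fun_prop : Continuous fun x => Real.exp (c k + Np (ω k) x)).measurable
  have hmB : Measurable (fun x => a * Real.exp (N x)) := (Real.measurable_exp.comp hNm).const_mul a
  have hA : ∀ k, ∫⁻ x, ENNReal.ofReal (Real.exp (c k + Np (ω k) x)) ^ q' ∂μ ≤ ENNReal.ofReal C1 := by
    intro k
    calc _ ≤ ∫⁻ x, ENNReal.ofReal (Real.exp (q' * M)) * ENNReal.ofReal (Real.exp (q' * Np (ω k) x)) ∂μ := by
          apply lintegral_mono; intro x; beta_reduce
          rw [ENNReal.ofReal_rpow_of_pos (Real.exp_pos _), ← Real.exp_mul, ← ENNReal.ofReal_mul (Real.exp_nonneg _), ← Real.exp_add]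
          apply ENNReal.ofReal_le_ofReal
          apply Real.exp_le_exp.2
          nlinarith [hcM k]
      _ = ENNReal.ofReal (Real.exp (q' * M)) * ∫⁻ x, ENNReal.ofReal (Real.exp (q' * Np (ω k) x)) ∂μ :=
          lintegral_const_mul' _ _ ENNReal.ofReal_ne_top
      _ ≤ _ := by
          rw [hC1, ENNReal.ofReal_mul (Real.exp_nonneg _)]; gcongr; exact hE _ (hc k) (hi k) (hω k) (hωτ k)
  have hB : ∫⁻ x, ENNReal.ofReal (a * Real.exp (N x)) ^ q' ∂μ ≤ ENNReal.ofReal C1 := by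
    calc _ = ∫⁻ x, liminf (fun k => ENNReal.ofReal (Real.exp (c k + Np (ω k) x)) ^ q') atTop ∂μ := by
          apply lintegral_congr_ae
          filter_upwards [hconv] with x hx
          have := (ENNReal.continuous_rpow_const (y := q').tendsto _).comp ((ENNReal.continuous_ofReal.tendsto _).comp hx)
          exact this.liminf_eq.symm
      _ ≤ liminf (fun k => ∫⁻ x, ENNReal.ofReal (Real.exp (c k + Np (ω k) x)) ^ q' ∂μ) atTop :=
          lintegral_liminf_le fun k => (hmA k).ennreal_ofReal.pow_const _
      _ ≤ liminf (fun _ : ℕ => ENNReal.ofReal C1) atTop := liminf_le_liminf (Eventually.of_forall hA)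
      _ = _ := by simp
  set h : ℕ → ℂ → ℝ := fun k x => |Real.exp (c k + Np (ω k) x) - a * Real.exp (N x)| ^ q with hh
  have hhm : ∀ k, Measurable (h k) := fun k => ((hmA k).sub hmB).abs.pow_const q
  have hv := vitali0 (μ := μ) h (fun k => (hhm k).aemeasurable) (fun k x => by simp only [hh]; positivity)
    (by
      filter_upwards [hconv] with x hx
      have h2 : Tendsto (fun k => |Real.exp (c k + Np (ω k) x) - a * Real.exp (N x)|) atTop (𝓝 0) := by
        have := (hx.sub_const (a * Real.exp (N x))).abs; simpa using this
      have := h2.rpow_const (p := q) (Or.inr (by linarith))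
      rwa [Real.zero_rpow (by linarith)] at this)
    (q' / q) (by rw [lt_div_iff₀ (by linarith)]; linarith) (2 ^ (q' - 1) * (C1 + C1)) (by positivity)
    (by
      intro k
      calc _ ≤ ∫⁻ x, 2 ^ (q' - 1) * (ENNReal.ofReal (Real.exp (c k + Np (ω k) x)) ^ q' + ENNReal.ofReal (a * Real.exp (N x)) ^ q') ∂μ := by
            apply lintegral_mono; intro x; beta_reduce
            refine le_trans ?_ (ENNReal.rpow_add_le_mul_rpow_add_rpow _ _ hq'1.le)
            simp only [hh]
            have hB0 : 0 ≤ a * Real.exp (N x) := mul_nonneg ha0 (Real.exp_nonneg _)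
            rw [← ENNReal.ofReal_add (Real.exp_nonneg _) hB0, ← Real.rpow_mul (abs_nonneg _), mul_div_cancel₀ _ (by linarith : q ≠ 0),
              ENNReal.ofReal_rpow_of_nonneg (add_nonneg (Real.exp_nonneg _) hB0) (by linarith)]
            apply ENNReal.ofReal_le_ofReal
            apply Real.rpow_le_rpow (abs_nonneg _) _ (by linarith)
            rw [abs_le]; constructor <;> linarith [Real.exp_nonneg (c k + Np (ω k) x)]
        _ = 2 ^ (q' - 1) * ((∫⁻ x, ENNReal.ofReal (Real.exp (c k + Np (ω k) x)) ^ q' ∂μ) + ∫⁻ x, ENNReal.ofReal (a * Real.exp (N x)) ^ q' ∂μ) := by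
            rw [lintegral_const_mul' _ _ (ENNReal.rpow_ne_top_of_nonneg (by linarith) (by norm_num)), lintegral_add_left ((hmA k).ennreal_ofReal.pow_const _)]
        _ ≤ 2 ^ (q' - 1) * (ENNReal.ofReal C1 + ENNReal.ofReal C1) := by gcongr; exact hA k
        _ = _ := by
            rw [ENNReal.ofReal_mul (p := (2:ℝ) ^ (q' - 1)) (by positivity), ENNReal.ofReal_add hC1p.le hC1p.le, ← ENNReal.ofReal_rpow_of_pos (by norm_num)]
            norm_num)
  have := (ENNReal.tendsto_toReal ENNReal.zero_ne_top).comp hv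
  rw [ENNReal.toReal_zero] at this
  refine this.congr fun k => ?_
  rw [integral_eq_lintegral_of_nonneg_ae (Eventually.of_forall fun x => by positivity) (hhm k).aestronglyMeasurable]
  rfl

lemma int_le_of_lint {μ : Measure ℂ} (f : ℂ → ℝ) (h0 : ∀ x, 0 ≤ f x) (C : ℝ) (hC : 0 ≤ C)
    (h : ∫⁻ x, ENNReal.ofReal (f x) ∂μ ≤ ENNReal.ofReal C) : ∫ x, f x ∂μ ≤ C := by
  by_cases hf : Integrable f μ
  · rw [integral_eq_lintegral_of_nonneg_ae (Eventually.of_forall h0) hf.aestronglyMeasurable]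
    exact ENNReal.toReal_le_of_le_ofReal hC h
  · rw [integral_undef hf]; exact hC

lemma sum_Lp {μ : Measure ℂ} (f g h : ℂ → ℝ) (hg : AEMeasurable g μ) (p : ℝ) (hp : 1 < p)
    (hfg : ∀ᵐ x ∂μ, |f x| ≤ |g x| + |h x|) (C D : ℝ) (hC : 0 ≤ C) (hD : 0 ≤ D)
    (h1 : ∫⁻ x, ENNReal.ofReal |g x| ^ p ∂μ ≤ ENNReal.ofReal C)
    (h2 : ∫⁻ x, ENNReal.ofReal |h x| ^ p ∂μ ≤ ENNReal.ofReal D) : ∫ x, |f x| ^ p ∂μ ≤ 2 ^ (p - 1) * (C + D) := by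
  apply int_le_of_lint _ (fun x => by positivity) _ (by positivity)
  calc _ ≤ ∫⁻ x, 2 ^ (p - 1) * (ENNReal.ofReal |g x| ^ p + ENNReal.ofReal |h x| ^ p) ∂μ := by
        apply lintegral_mono_ae
        filter_upwards [hfg] with x hx
        refine le_trans ?_ (ENNReal.rpow_add_le_mul_rpow_add_rpow _ _ hp.le)
        rw [← ENNReal.ofReal_add (abs_nonneg _) (abs_nonneg _), ENNReal.ofReal_rpow_of_nonneg (by positivity) (by linarith)]
        apply ENNReal.ofReal_le_ofReal
        exact Real.rpow_le_rpow (abs_nonneg _) hx (by linarith)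
    _ = 2 ^ (p - 1) * ((∫⁻ x, ENNReal.ofReal |g x| ^ p ∂μ) + ∫⁻ x, ENNReal.ofReal |h x| ^ p ∂μ) := by
        rw [lintegral_const_mul' _ _ (ENNReal.rpow_ne_top_of_nonneg (by linarith) (by norm_num)), lintegral_add_left' (hg.abs.ennreal_ofReal.pow_const _)]
    _ ≤ 2 ^ (p - 1) * (ENNReal.ofReal C + ENNReal.ofReal D) := by gcongr
    _ = _ := by
        rw [ENNReal.ofReal_mul (by positivity), ENNReal.ofReal_add hC hD, ← ENNReal.ofReal_rpow_of_pos (by norm_num)]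
        norm_num

lemma fderiv_dotC (g : ℂ → ℝ) (x w : ℂ) :
    dotC ((fderiv ℝ g x 1 : ℂ) + (fderiv ℝ g x Complex.I : ℂ) * Complex.I) w = fderiv ℝ g x w := by
  have hw : w = w.re • (1:ℂ) + w.im • Complex.I := by
    simp only [Complex.real_smul, mul_one]; exact (Complex.re_add_im w).symm
  conv_rhs => rw [hw, map_add, map_smul, map_smul]
  simp [dotC]; ring

lemma weakgrad (Ω : Set ℂ) (u g : ℂ → ℝ) (hg : ContDiff ℝ 1 g) (hΩ : MeasurableSet Ω) (he : Set.EqOn u g Ω) :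
    IsWeakGradOn Ω u (fun x => (fderiv ℝ g x 1 : ℂ) + (fderiv ℝ g x Complex.I : ℂ) * Complex.I) := by
  intro φ hφ hφc hφs w
  simp_rw [fderiv_dotC]
  have h1 : ∫ x in Ω, u x * fderiv ℝ φ x w = ∫ x in Ω, g x * fderiv ℝ φ x w :=
    setIntegral_congr_fun hΩ fun x hx => by simp only [he hx]
  have hz : ∀ x, x ∉ Ω → x ∉ tsupport φ := fun x hx h => hx (hφs h)
  rw [h1, setIntegral_eq_integral_of_forall_compl_eq_zero (fun x hx => by
      have : fderiv ℝ φ x = 0 := by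
        by_contra h
        exact hz x hx (support_fderiv_subset ℝ h)
      rw [this]; simp), setIntegral_eq_integral_of_forall_compl_eq_zero (fun x hx => by
      rw [image_eq_zero_of_notMem_tsupport (hz x hx), mul_zero])]
  exact ibp g φ hg (hφ.of_le (WithTop.coe_le_coe.2 (le_top : (1:ℕ∞) ≤ ⊤))) hφc w

lemma L1_test (Ω : Set ℂ) (N : ℂ → ℝ) (hN : IntegrableOn N Ω) (f : ℕ → ℂ → ℝ) (hf : ∀ k, IntegrableOn (f k) Ω)
    (hlim : Tendsto (fun k => ∫⁻ x in Ω, ENNReal.ofReal |f k x - N x|) atTop (𝓝 0))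
    (ψ : ℂ → ℝ) (hψ : Continuous ψ) (hψc : HasCompactSupport ψ) :
    Tendsto (fun k => ∫ x in Ω, f k x * ψ x) atTop (𝓝 (∫ x in Ω, N x * ψ x)) := by
  obtain ⟨B, hB⟩ := hψc.exists_bound_of_continuous hψ
  have hB' : ∀ᵐ x ∂(volume.restrict Ω), ‖ψ x‖ ≤ B := Eventually.of_forall hB
  have hB0 : 0 ≤ B := (norm_nonneg _).trans (hB 0)
  refine tendsto_integral_of_L1 _ (hN.mul_bdd hψ.aestronglyMeasurable hB').aestronglyMeasurable
    (Eventually.of_forall fun k => (hf k).mul_bdd hψ.aestronglyMeasurable hB') ?_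
  have hl : Tendsto (fun k => ENNReal.ofReal B * ∫⁻ x in Ω, ENNReal.ofReal |f k x - N x|) atTop (𝓝 0) := by
    have := ENNReal.Tendsto.const_mul hlim (Or.inr (ENNReal.ofReal_ne_top (r := B)))
    simpa using this
  refine tendsto_of_tendsto_of_tendsto_of_le_of_le tendsto_const_nhds hl (fun _ => zero_le) fun k => ?_
  beta_reduce
  rw [← lintegral_const_mul' _ _ ENNReal.ofReal_ne_top]
  apply lintegral_mono; intro x; beta_reduce
  rw [← sub_mul, ← ofReal_norm, ← ENNReal.ofReal_mul hB0, norm_mul, Real.norm_eq_abs, mul_comm]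
  apply ENNReal.ofReal_le_ofReal
  exact mul_le_mul_of_nonneg_right (hB x) (abs_nonneg _)

lemma weak_lim (Λ : ℝ) (ω : ℕ → ℂ → ℝ) (hc : ∀ k, Continuous (ω k)) (hi : ∀ k, Integrable (ω k))
    (hω : ∀ k, ∫ y, |ω k y| ≤ Λ) (N : ℂ → ℝ) (hNi : IntegrableOn N (ball (0:ℂ) 1))
    (hlim : Tendsto (fun k => ∫⁻ x in ball (0:ℂ) 1, ENNReal.ofReal |Np (ω k) x - N x|) atTop (𝓝 0))
    (d : ℕ → ℝ) (d₀ : ℝ) (hd : Tendsto d atTop (𝓝 d₀)) (hg : ∀ k, ContDiff ℝ 1 (fun x => d k + Np (ω k) x))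
    (u : ℕ → ℂ → ℝ) (hu : ∀ k, Set.EqOn (u k) (fun x => d k + Np (ω k) x) (ball (0:ℂ) 1))
    (r : ℝ) (hr1 : r < 1) (p : ℝ) (hp : 1 < p) (hp2 : p < 2) :
    WeakW1pLim (ball (0:ℂ) r) p u (fun x => d₀ + N x) := by
  have hsub : ball (0:ℂ) r ⊆ ball 0 1 := ball_subset_ball hr1.le
  have hmono : volume.restrict (ball (0:ℂ) r) ≤ volume.restrict (ball (0:ℂ) 1) := Measure.restrict_mono hsub le_rfl
  have hfin : volume (ball (0:ℂ) r) ≠ ⊤ := measure_ball_lt_top.ne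
  set g : ℕ → ℂ → ℝ := fun k x => d k + Np (ω k) x with hgdef
  have hW : ∀ k, IsWeakGradOn (ball (0:ℂ) r) (u k) (fun x => (fderiv ℝ (g k) x 1 : ℂ) + (fderiv ℝ (g k) x Complex.I : ℂ) * Complex.I) :=
    fun k => weakgrad _ _ _ (hg k) measurableSet_ball fun x hx => hu k (hsub hx)
  have hNr : IntegrableOn N (ball (0:ℂ) r) := hNi.mono_set hsub
  have hgi : ∀ k, IntegrableOn (g k) (ball (0:ℂ) r) := fun k =>
    ((hg k).continuous.continuousOn.integrableOn_compact (isCompact_closedBall (0:ℂ) r)).mono_set ball_subset_closedBall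
  have hci : ∀ a : ℝ, IntegrableOn (fun _ : ℂ => a) (ball (0:ℂ) r) := fun a => integrableOn_const hfin
  have hNpi : ∀ k, IntegrableOn (Np (ω k)) (ball (0:ℂ) r) := fun k => by
    have := (hgi k).sub (hci (d k))
    refine this.congr (Eventually.of_forall fun x => ?_)
    simp [hgdef]
  have hl2 : Tendsto (fun k => ∫⁻ x in ball (0:ℂ) r, ENNReal.ofReal |Np (ω k) x - N x|) atTop (𝓝 0) :=
    tendsto_of_tendsto_of_tendsto_of_le_of_le tendsto_const_nhds hlim (fun _ => zero_le)
      fun k => lintegral_mono' hmono le_rfl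
  have htest : ∀ ψ : ℂ → ℝ, Continuous ψ → HasCompactSupport ψ →
      Tendsto (fun k => ∫ x in ball (0:ℂ) r, u k x * ψ x) atTop (𝓝 (∫ x in ball (0:ℂ) r, (d₀ + N x) * ψ x)) := by
    intro ψ hψ hψc
    have hψi : IntegrableOn ψ (ball (0:ℂ) r) := (hψ.integrable_of_hasCompactSupport hψc).integrableOn
    obtain ⟨B, hB⟩ := hψc.exists_bound_of_continuous hψ
    have hB' : ∀ᵐ x ∂(volume.restrict (ball (0:ℂ) r)), ‖ψ x‖ ≤ B := Eventually.of_forall hB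
    have h1 := L1_test _ N hNr _ hNpi hl2 ψ hψ hψc
    have h2 := (hd.mul_const (∫ x in ball (0:ℂ) r, ψ x)).add h1
    convert h2 using 2 with k
    · rw [← integral_const_mul, ← integral_add (hψi.const_mul _) ((hNpi k).mul_bdd hψ.aestronglyMeasurable hB')]
      refine setIntegral_congr_fun measurableSet_ball fun x hx => ?_
      simp only [hu k (hsub hx), hgdef]; ring
    · rw [← integral_const_mul, ← integral_add (hψi.const_mul _) (hNr.mul_bdd hψ.aestronglyMeasurable hB')]
      simp_rw [add_mul]
  refine ⟨_, hW, ?_, ?_⟩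
  · obtain ⟨D, hD⟩ : ∃ D : ℝ, ∀ k, |d k| ≤ D := by
      obtain ⟨D, hD⟩ := hd.abs.bddAbove_range
      exact ⟨D, fun k => hD ⟨k, rfl⟩⟩
    have hD0 : 0 ≤ D := (abs_nonneg _).trans (hD 0)
    obtain ⟨C1, hC1, h1⟩ := Np_Lp p hp hp2 Λ
    obtain ⟨C2, hC2, h2⟩ := grad_Lp p hp hp2 Λ
    set A := D ^ p * volume.real (ball (0:ℂ) r) with hA
    have hA0 : 0 ≤ A := by positivity
    refine ⟨(2 ^ (p - 1) * (A + C1)) ^ (1/p) + (2 ^ (p - 1) * (C2 + C2)) ^ (1/p), fun k => ?_⟩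
    have hG : ∀ w : ℂ, ‖w‖ = 1 → ∫⁻ x in ball (0:ℂ) r, ENNReal.ofReal |fderiv ℝ (g k) x w| ^ p ≤ ENNReal.ofReal C2 :=
      fun w hw => (lintegral_mono' hmono le_rfl).trans (h2 _ (hc k) (hi k) (hω k) (g k) (hg k) (d k) (fun x => rfl) w hw)
    have hfd : Continuous fun x => fderiv ℝ (g k) x 1 := ((hg k).continuous_fderiv one_ne_zero).clm_apply continuous_const
    gcongr
    · refine sum_Lp (u k) (fun _ => D) (Np (ω k)) aemeasurable_const p hp ?_ A C1 hA0 hC1.le ?_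
        ((lintegral_mono' hmono le_rfl).trans (h1 _ (hc k) (hi k) (hω k)))
      · filter_upwards [ae_restrict_mem measurableSet_ball] with x hx
        rw [hu k (hsub hx), abs_of_nonneg hD0]
        exact (abs_add_le _ _).trans (by gcongr; exact hD k)
      · rw [setLIntegral_const, hA, abs_of_nonneg hD0, ENNReal.ofReal_mul (by positivity), ENNReal.ofReal_rpow_of_nonneg hD0 (by linarith), Measure.real, ENNReal.ofReal_toReal hfin]
    · have := sum_Lp (μ := volume.restrict (ball (0:ℂ) r)) (fun x => ‖(fderiv ℝ (g k) x 1 : ℂ) + (fderiv ℝ (g k) x Complex.I : ℂ) * Complex.I‖)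
        (fun x => fderiv ℝ (g k) x 1) (fun x => fderiv ℝ (g k) x Complex.I) hfd.aemeasurable p hp
        (Eventually.of_forall fun x => by
          beta_reduce
          rw [abs_norm]
          refine (norm_add_le _ _).trans ?_
          simp) C2 C2 hC2.le hC2.le (hG 1 (by simp)) (hG _ (by simp))
      simpa only [abs_norm] using this
  · intro φ hφ hφc hφs
    have hφ1 : ContDiff ℝ 1 φ := hφ.of_le (WithTop.coe_le_coe.2 (le_top : (1:ℕ∞) ≤ ⊤))
    refine ⟨htest φ hφ.continuous hφc, fun w => ?_⟩
    have h := (htest (fun x => fderiv ℝ φ x w) ((hφ1.continuous_fderiv one_ne_zero).clm_apply continuous_const)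
      ((hφc.fderiv_apply (𝕜 := ℝ) w))).neg
    refine h.congr fun k => ?_
    rw [hW k φ hφ hφc hφs w, neg_neg]

lemma seg_kern (r : ℝ) : ∃ K : ℝ, 0 < K ∧ ∀ (m y : ℂ) (b : ℝ), 0 < b →
    ∫⁻ s in ball (0:ℂ) r, ENNReal.ofReal (‖m + b * s - y‖ ^ (-(1/2:ℝ))) ≤ ENNReal.ofReal (b ^ (-(1/2:ℝ))) * ENNReal.ofReal K := by
  obtain ⟨K, hK, h⟩ := kint (1/2) (by norm_num) (by norm_num) r
  refine ⟨K, hK, fun m y b hb => ?_⟩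
  have hb' : (b:ℂ) ≠ 0 := by exact_mod_cast hb.ne'
  calc _ = ∫⁻ s in ball (0:ℂ) r, ENNReal.ofReal (b ^ (-(1/2:ℝ))) * ENNReal.ofReal (‖s - (y - m) / b‖ ^ (-(1/2:ℝ))) := by
        congr 1; ext s
        rw [← ENNReal.ofReal_mul (by positivity), ← Real.mul_rpow hb.le (norm_nonneg _)]
        congr 2
        rw [show m + b * s - y = b * (s - (y - m) / b) by field_simp; ring, norm_mul, Complex.norm_real, Real.norm_of_nonneg hb.le]
    _ = ENNReal.ofReal (b ^ (-(1/2:ℝ))) * ∫⁻ s in ball (0:ℂ) r, ENNReal.ofReal (‖s - (y - m) / b‖ ^ (-(1/2:ℝ))) :=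
        lintegral_const_mul' _ _ ENNReal.ofReal_ne_top
    _ ≤ _ := by gcongr; exact h _

lemma diam_t (Λ r τ : ℝ) (hr1 : r < 1) (hτ1 : τ ≤ 1) : ∃ A : ℝ≥0∞, A ≠ ⊤ ∧ ∀ ω : ℂ → ℝ, Continuous ω → Integrable ω →
    ∫ y, |ω y| ≤ Λ → ∫ y in ball (0:ℂ) 1, |ω y| ≤ τ → ∀ (m : ℂ) (b : ℝ), 0 < b → (∀ s ∈ ball (0:ℂ) r, m + b * s ∈ ball (0:ℂ) r) →
    ∫⁻ s in ball (0:ℂ) r, ENNReal.ofReal (Real.exp (Np ω (m + b * s))) ≤ A * (1 + ENNReal.ofReal (b ^ (-(1/2:ℝ)))) := by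
  obtain ⟨K, hK, hk⟩ := seg_kern r
  set A0 : ℝ≥0∞ := ENNReal.ofReal (Real.exp (1 * ((2*Real.pi)⁻¹ * (Λ * (Real.log 2 + (1-r)⁻¹))))) with hA0
  set v := volume (ball (0:ℂ) r) with hv
  have hvf : v ≠ ⊤ := measure_ball_lt_top.ne
  refine ⟨A0 * (v + ENNReal.ofReal (4/(1/2)) * (v + ENNReal.ofReal K)), by finiteness, fun ω hc hi hω hτ m b hb hm => ?_⟩
  set β : ℝ≥0∞ := ENNReal.ofReal (b ^ (-(1/2:ℝ))) with hβ
  have hpi := twopi_inv_le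
  have hpt : ∀ s ∈ ball (0:ℂ) r, ENNReal.ofReal (Real.exp (Np ω (m + b * s))) ≤ A0 * (1 + ENNReal.ofReal (4/(1/2)) *
      ∫⁻ y in ball (0:ℂ) 1, (1 + ENNReal.ofReal (‖m + b * s - y‖ ^ (-(1/2:ℝ)))) * ENNReal.ofReal (1 * (2*Real.pi)⁻¹ * |ω y|)) := by
    intro s hs
    have := exp_pt Λ r τ hr1 1 (1/2) (by norm_num) (by norm_num) (by norm_num) (by
      have : (2*Real.pi)⁻¹ ≤ 1/2 := by
        rw [inv_le_comm₀ (by positivity) (by norm_num)]; linarith [Real.pi_gt_three]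
      have h0 : 0 ≤ (2*Real.pi)⁻¹ := by positivity
      nlinarith) (m + b * s) (mem_ball_zero_iff.1 (hm s hs)) ω hc hi hω hτ
    rwa [one_mul] at this
  have hωm : Measurable fun y => ENNReal.ofReal (1 * (2*Real.pi)⁻¹ * |ω y|) :=
    (by fun_prop : Continuous fun y => 1 * (2*Real.pi)⁻¹ * |ω y|).measurable.ennreal_ofReal
  have hkm : Measurable fun z : ℂ × ℂ => (1 + ENNReal.ofReal (‖m + b * z.1 - z.2‖ ^ (-(1/2:ℝ)))) * ENNReal.ofReal (1 * (2*Real.pi)⁻¹ * |ω z.2|) :=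
    (measurable_const.add (Measurable.ennreal_ofReal ((by fun_prop : Continuous fun z : ℂ × ℂ => ‖m + b * z.1 - z.2‖).measurable.pow_const _))).mul
      (hωm.comp measurable_snd)
  have hint : ∫⁻ y in ball (0:ℂ) 1, ENNReal.ofReal (1 * (2*Real.pi)⁻¹ * |ω y|) ≤ 1 := by
    calc _ ≤ ∫⁻ y in ball (0:ℂ) 1, ENNReal.ofReal |ω y| := by
          apply lintegral_mono; intro y; beta_reduce
          apply ENNReal.ofReal_le_ofReal
          have : (2*Real.pi)⁻¹ ≤ 1 := by
            rw [inv_le_comm₀ (by positivity) (by norm_num)]; linarith [Real.pi_gt_three]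
          rw [one_mul]; exact mul_le_of_le_one_left (abs_nonneg _) this
      _ = ENNReal.ofReal (∫ y in ball (0:ℂ) 1, |ω y|) :=
          (ofReal_integral_eq_lintegral_ofReal hi.abs.integrableOn (Eventually.of_forall fun _ => abs_nonneg _)).symm
      _ ≤ ENNReal.ofReal 1 := ENNReal.ofReal_le_ofReal (hτ.trans hτ1)
      _ = 1 := ENNReal.ofReal_one
  have hdouble : ∫⁻ s in ball (0:ℂ) r, ∫⁻ y in ball (0:ℂ) 1, (1 + ENNReal.ofReal (‖m + b * s - y‖ ^ (-(1/2:ℝ)))) * ENNReal.ofReal (1 * (2*Real.pi)⁻¹ * |ω y|)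
      ≤ v + β * ENNReal.ofReal K := by
    rw [lintegral_lintegral_swap hkm.aemeasurable]
    calc _ ≤ ∫⁻ y in ball (0:ℂ) 1, (v + β * ENNReal.ofReal K) * ENNReal.ofReal (1 * (2*Real.pi)⁻¹ * |ω y|) := by
          apply lintegral_mono; intro y; beta_reduce
          rw [lintegral_mul_const' _ _ ENNReal.ofReal_ne_top, lintegral_add_left measurable_const, setLIntegral_const, one_mul]
          gcongr
          exact hk m y b hb
      _ = (v + β * ENNReal.ofReal K) * ∫⁻ y in ball (0:ℂ) 1, ENNReal.ofReal (1 * (2*Real.pi)⁻¹ * |ω y|) :=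
          lintegral_const_mul' _ _ (by finiteness)
      _ ≤ (v + β * ENNReal.ofReal K) * 1 := by gcongr
      _ = _ := mul_one _
  calc _ ≤ ∫⁻ s in ball (0:ℂ) r, A0 * (1 + ENNReal.ofReal (4/(1/2)) *
      ∫⁻ y in ball (0:ℂ) 1, (1 + ENNReal.ofReal (‖m + b * s - y‖ ^ (-(1/2:ℝ)))) * ENNReal.ofReal (1 * (2*Real.pi)⁻¹ * |ω y|)) :=
        setLIntegral_mono' measurableSet_ball hpt
    _ = A0 * (v + ENNReal.ofReal (4/(1/2)) * ∫⁻ s in ball (0:ℂ) r, ∫⁻ y in ball (0:ℂ) 1, (1 + ENNReal.ofReal (‖m + b * s - y‖ ^ (-(1/2:ℝ)))) * ENNReal.ofReal (1 * (2*Real.pi)⁻¹ * |ω y|)) := by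
        rw [lintegral_const_mul' _ _ ENNReal.ofReal_ne_top, lintegral_add_left measurable_const, setLIntegral_const, one_mul (volume (ball (0:ℂ) r)),
          lintegral_const_mul' _ _ ENNReal.ofReal_ne_top]
    _ ≤ A0 * (v + ENNReal.ofReal (4/(1/2)) * (v + β * ENNReal.ofReal K)) := by gcongr
    _ ≤ A0 * (v * (1 + β) + ENNReal.ofReal (4/(1/2)) * (v * (1 + β) + (1 + β) * ENNReal.ofReal K)) := by
        have h1 : v ≤ v * (1 + β) := le_mul_of_one_le_right zero_le le_self_add
        have h2 : β ≤ 1 + β := le_add_self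
        gcongr
    _ = _ := by ring

lemma bez_int : ∫⁻ t in Set.Ioo (0:ℝ) 1, ENNReal.ofReal ((2 * t * (1 - t)) ^ (-(1/2:ℝ))) < ⊤ := by
  have h1 : ∫⁻ t in Set.Ioo (0:ℝ) 1, ENNReal.ofReal (t ^ (-(1/2:ℝ))) < ⊤ := by
    have : IntervalIntegrable (fun t : ℝ => t ^ (-(1/2:ℝ))) volume 0 1 := intervalIntegral.intervalIntegrable_rpow' (by norm_num)
    rw [intervalIntegrable_iff_integrableOn_Ioo_of_le zero_le_one] at this
    exact this.lintegral_lt_top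
  have h2 := half_int
  calc _ ≤ ∫⁻ t in Set.Ioo (0:ℝ) 1, (ENNReal.ofReal (t ^ (-(1/2:ℝ))) + ENNReal.ofReal ((1 - t) ^ (-(1/2:ℝ)))) := by
        refine setLIntegral_mono' measurableSet_Ioo fun t ht => ?_
        have ht0 := ht.1
        have ht1 : 0 < 1 - t := by linarith [ht.2]
        rw [← ENNReal.ofReal_add (by positivity) (by positivity)]
        apply ENNReal.ofReal_le_ofReal
        have p1 : 0 ≤ t ^ (-(1/2:ℝ)) := by positivity
        have p2 : 0 ≤ (1-t) ^ (-(1/2:ℝ)) := by positivity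
        rcases le_total t (1/2) with h | h
        · have := Real.rpow_le_rpow_of_nonpos ht0 (show t ≤ 2 * t * (1 - t) by nlinarith) (show -(1/2:ℝ) ≤ 0 by norm_num)
          linarith
        · have := Real.rpow_le_rpow_of_nonpos ht1 (show 1 - t ≤ 2 * t * (1 - t) by nlinarith) (show -(1/2:ℝ) ≤ 0 by norm_num)
          linarith
    _ = (∫⁻ t in Set.Ioo (0:ℝ) 1, ENNReal.ofReal (t ^ (-(1/2:ℝ)))) + ∫⁻ t in Set.Ioo (0:ℝ) 1, ENNReal.ofReal ((1 - t) ^ (-(1/2:ℝ))) :=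
        lintegral_add_left (measurable_id.pow_const _).ennreal_ofReal _
    _ < ⊤ := ENNReal.add_lt_top.2 ⟨h1, h2⟩

lemma bez_norm (x s y : ℂ) (r t : ℝ) (ht : t ∈ Set.Icc (0:ℝ) 1) (hx : ‖x‖ < r) (hs : ‖s‖ < r) (hy : ‖y‖ < r) :
    ‖(((1 - t) ^ 2 : ℝ) : ℂ) * x + ((t ^ 2 : ℝ) : ℂ) * y + ((2 * t * (1 - t) : ℝ) : ℂ) * s‖ < r := by
  obtain ⟨h0, h1⟩ := ht
  have h2 : 0 ≤ 1 - t := by linarith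
  set ρ := max ‖x‖ (max ‖s‖ ‖y‖) with hρ
  have hρr : ρ < r := max_lt hx (max_lt hs hy)
  have e1 : ‖x‖ ≤ ρ := le_max_left _ _
  have e2 : ‖s‖ ≤ ρ := (le_max_left _ _).trans (le_max_right _ _)
  have e3 : ‖y‖ ≤ ρ := (le_max_right _ _).trans (le_max_right _ _)
  refine lt_of_le_of_lt ?_ hρr
  calc _ ≤ ‖(((1 - t) ^ 2 : ℝ) : ℂ) * x‖ + ‖((t ^ 2 : ℝ) : ℂ) * y‖ + ‖((2 * t * (1 - t) : ℝ) : ℂ) * s‖ := norm_add₃_le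
    _ = (1 - t) ^ 2 * ‖x‖ + t ^ 2 * ‖y‖ + 2 * t * (1 - t) * ‖s‖ := by
        rw [norm_mul, norm_mul, norm_mul, Complex.norm_real, Complex.norm_real, Complex.norm_real,
          Real.norm_of_nonneg (by positivity), Real.norm_of_nonneg (by positivity), Real.norm_of_nonneg (by positivity)]
    _ ≤ (1 - t) ^ 2 * ρ + t ^ 2 * ρ + 2 * t * (1 - t) * ρ := by gcongr
    _ = ρ := by ring

lemma diam_bound (Λ r τ : ℝ) (hr0 : 0 < r) (hr1 : r < 1) (hτ1 : τ ≤ 1) : ∃ C : ℝ≥0∞, C ≠ ⊤ ∧ ∀ ω : ℂ → ℝ, Continuous ω → Integrable ω →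
    ∫ y, |ω y| ≤ Λ → ∫ y in ball (0:ℂ) 1, |ω y| ≤ τ → Continuous (Np ω) → ∀ x ∈ ball (0:ℂ) r, ∀ y ∈ ball (0:ℂ) r,
    ∃ γ ∈ PathsIn (ball (0:ℂ) r) x y, ∫⁻ t in Set.Ioo (0:ℝ) 1, ENNReal.ofReal (Real.exp (Np ω (γ t)) * ‖deriv γ t‖) ≤ C := by
  obtain ⟨A, hA, hAt⟩ := diam_t Λ r τ hr1 hτ1
  set J := ∫⁻ t in Set.Ioo (0:ℝ) 1, ENNReal.ofReal ((2 * t * (1 - t)) ^ (-(1/2:ℝ))) with hJ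
  have hJf : J ≠ ⊤ := bez_int.ne
  set v := volume (ball (0:ℂ) r) with hv
  have hvf : v ≠ ⊤ := measure_ball_lt_top.ne
  have hv0 : v ≠ 0 := (measure_ball_pos volume _ hr0).ne'
  refine ⟨4 * ((A * (1 + J)) / v), ENNReal.mul_ne_top (by norm_num) (ENNReal.div_ne_top (by finiteness) hv0),
    fun ω hc hi hω hτ hN x hx y hy => ?_⟩
  have hx' := mem_ball_zero_iff.1 hx
  have hy' := mem_ball_zero_iff.1 hy
  set γ : ℂ → ℝ → ℂ := fun s t => (((1 - t) ^ 2 : ℝ) : ℂ) * x + ((t ^ 2 : ℝ) : ℂ) * y + ((2 * t * (1 - t) : ℝ) : ℂ) * s with hγ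
  have hcont : Continuous fun z : ℂ × ℝ => ENNReal.ofReal (Real.exp (Np ω (γ z.1 z.2))) := by
    apply ENNReal.continuous_ofReal.comp
    apply Real.continuous_exp.comp
    apply hN.comp
    simp only [hγ]
    fun_prop
  have htot : ∫⁻ s in ball (0:ℂ) r, ∫⁻ t in Set.Ioo (0:ℝ) 1, ENNReal.ofReal (Real.exp (Np ω (γ s t))) ≤ A * (1 + J) := by
    rw [lintegral_lintegral_swap hcont.measurable.aemeasurable]
    calc _ ≤ ∫⁻ t in Set.Ioo (0:ℝ) 1, A * (1 + ENNReal.ofReal ((2 * t * (1 - t)) ^ (-(1/2:ℝ)))) := by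
          refine setLIntegral_mono' measurableSet_Ioo fun t ht => ?_
          have ht1 : 0 < 1 - t := by linarith [ht.2]
          have ht0 := ht.1
          exact hAt ω hc hi hω hτ _ (2 * t * (1 - t)) (by positivity) fun s hs =>
            mem_ball_zero_iff.2 (bez_norm x s y r t ⟨ht.1.le, ht.2.le⟩ hx' (mem_ball_zero_iff.1 hs) hy')
      _ = A * (1 + J) := by
          rw [lintegral_const_mul' _ _ hA, lintegral_add_left measurable_const, setLIntegral_const, one_mul, Real.volume_Ioo]
          simp [hJ]
  obtain ⟨s, hs, hsl⟩ := exists_le_setLAverage (μ := volume) (s := ball (0:ℂ) r) (f := fun s => ∫⁻ t in Set.Ioo (0:ℝ) 1, ENNReal.ofReal (Real.exp (Np ω (γ s t))))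
    hv0 hvf (Measurable.lintegral_prod_right' hcont.measurable).aemeasurable
  rw [setLAverage_eq] at hsl
  have hs' := mem_ball_zero_iff.1 hs
  have hder : ∀ t, HasDerivAt (γ s) (((-(2 * (1 - t)) : ℝ) : ℂ) * x + ((2 * t : ℝ) : ℂ) * y + ((2 * (1 - 2 * t) : ℝ) : ℂ) * s) t := by
    intro t
    have a1 : HasDerivAt (fun t : ℝ => (1 - t) ^ 2) (-(2 * (1 - t))) t := by
      have := ((hasDerivAt_id t).const_sub 1).pow 2
      exact this.congr_deriv (by simp)
    have a2 : HasDerivAt (fun t : ℝ => t ^ 2) (2 * t) t := by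
      have := (hasDerivAt_id t).pow 2
      exact this.congr_deriv (by simp)
    have a3 : HasDerivAt (fun t : ℝ => 2 * t * (1 - t)) (2 * (1 - 2 * t)) t := by
      have := ((hasDerivAt_id t).const_mul 2).mul ((hasDerivAt_id t).const_sub 1)
      exact this.congr_deriv (by simp; ring)
    exact ((a1.ofReal_comp.mul_const x).add (a2.ofReal_comp.mul_const y)).add (a3.ofReal_comp.mul_const s)
  refine ⟨γ s, ⟨by simp [hγ], by simp [hγ], fun t ht => mem_ball_zero_iff.2 (bez_norm x s y r t ht hx' hs' hy'), ?_⟩, ?_⟩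
  · simp only [hγ]
    have hof : ContDiff ℝ 1 (fun t : ℝ => (t : ℂ)) := Complex.ofRealCLM.contDiff
    have b1 : ContDiff ℝ 1 (fun t : ℝ => (1 - t) ^ 2) := by fun_prop
    have b2 : ContDiff ℝ 1 (fun t : ℝ => t ^ 2) := by fun_prop
    have b3 : ContDiff ℝ 1 (fun t : ℝ => 2 * t * (1 - t)) := by fun_prop
    exact (((hof.comp b1).mul contDiff_const).add ((hof.comp b2).mul contDiff_const)).add ((hof.comp b3).mul contDiff_const)
  · calc _ ≤ ∫⁻ t in Set.Ioo (0:ℝ) 1, 4 * ENNReal.ofReal (Real.exp (Np ω (γ s t))) := by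
          refine setLIntegral_mono' measurableSet_Ioo fun t ht => ?_
          have ht1 : 0 < 1 - t := by linarith [ht.2]
          have ht0 := ht.1
          rw [(hder t).deriv, mul_comm, ENNReal.ofReal_mul (norm_nonneg _)]
          gcongr
          rw [← ENNReal.ofReal_ofNat]
          apply ENNReal.ofReal_le_ofReal
          refine norm_add₃_le.trans ?_
          rw [norm_mul, norm_mul, norm_mul, Complex.norm_real, Complex.norm_real, Complex.norm_real, norm_neg,
            Real.norm_of_nonneg (by positivity), Real.norm_of_nonneg (by positivity), Real.norm_eq_abs]
          have k1 : |2 * (1 - 2 * t)| ≤ 2 := by rw [abs_le]; constructor <;> linarith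
          have k2 : |2 * (1 - 2 * t)| * ‖s‖ ≤ 2 * 1 := by gcongr; linarith
          have k3 : 2 * (1 - t) * ‖x‖ ≤ 2 * (1 - t) * 1 := by gcongr; linarith
          have k4 : 2 * t * ‖y‖ ≤ 2 * t * 1 := by gcongr; linarith
          linarith
      _ = 4 * ∫⁻ t in Set.Ioo (0:ℝ) 1, ENNReal.ofReal (Real.exp (Np ω (γ s t))) := lintegral_const_mul' _ _ (by norm_num)
      _ ≤ _ := by gcongr; exact hsl.trans (by gcongr)

lemma dist_bound (Λ r τ : ℝ) (hr0 : 0 < r) (hr1 : r < 1) (hτ1 : τ ≤ 1) : ∃ C : ℝ, 0 < C ∧ ∀ ω : ℂ → ℝ, Continuous ω → Integrable ω →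
    ∫ y, |ω y| ≤ Λ → ∫ y in ball (0:ℂ) 1, |ω y| ≤ τ → Continuous (Np ω) → ∀ (c : ℝ) (u : ℂ → ℝ), Set.EqOn u (fun x => c + Np ω x) (ball (0:ℂ) 1) →
    ∀ x ∈ ball (0:ℂ) r, ∀ y ∈ ball (0:ℂ) r, confDist u (ball (0:ℂ) r) x y ≤ Real.exp c * C := by
  obtain ⟨C, hC, h⟩ := diam_bound Λ r τ hr0 hr1 hτ1
  refine ⟨C.toReal + 1, by positivity, fun ω hc hi hω hτ hN c u hu x hx y hy => ?_⟩
  obtain ⟨γ, hγ, hl⟩ := h ω hc hi hω hτ hN x hx y hy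
  refine (confDist_le u _ x y γ hγ).trans ?_
  unfold confLen
  have hin := hγ.2.2.1
  have hγc := hγ.2.2.2
  rw [intervalIntegral.integral_of_le zero_le_one, integral_Ioc_eq_integral_Ioo]
  have e : ∫ t in Set.Ioo (0:ℝ) 1, Real.exp (u (γ t)) * ‖deriv γ t‖ = Real.exp c * ∫ t in Set.Ioo (0:ℝ) 1, Real.exp (Np ω (γ t)) * ‖deriv γ t‖ := by
    rw [← integral_const_mul]
    refine setIntegral_congr_fun measurableSet_Ioo fun t ht => ?_
    have : γ t ∈ ball (0:ℂ) 1 := ball_subset_ball hr1.le (hin t ⟨ht.1.le, ht.2.le⟩)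
    simp only [hu this, Real.exp_add, mul_assoc]
  rw [e]
  gcongr
  have hm : Continuous fun t => Real.exp (Np ω (γ t)) * ‖deriv γ t‖ :=
    (Real.continuous_exp.comp (hN.comp hγc.continuous)).mul (hγc.continuous_deriv le_rfl).norm
  rw [integral_eq_lintegral_of_nonneg_ae (Eventually.of_forall fun t => by positivity) hm.aestronglyMeasurable]
  have := ENNReal.toReal_mono hC hl
  linarith

lemma gauss_exp (u : ℂ → ℝ) (x : ℂ) : |gauss u x| * Real.exp (2 * u x) = |lap u x| := by
  unfold gauss
  rw [abs_mul, abs_neg, abs_of_pos (Real.exp_pos _), mul_right_comm, ← Real.exp_add, neg_add_cancel, Real.exp_zero, one_mul]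

lemma extr (u : ℂ → ℝ) (Λ : ℝ) (hΛ : 0 < Λ) (h : ExtendsComplete u Λ) : ∃ (ω : ℂ → ℝ) (c : ℝ), Continuous ω ∧ Integrable ω ∧
    ∫ y, |ω y| ≤ Λ ∧ ContDiff ℝ 1 (fun x => c + Np ω x) ∧ Set.EqOn u (fun x => c + Np ω x) (ball (0:ℂ) 1) ∧
    ∀ x ∈ ball (0:ℂ) 1, ω x = lap u x := by
  obtain ⟨v, hv, he, hcomp, hcurv⟩ := h
  have hc : Continuous (lap v) := lap_cont v (hv.of_le (WithTop.coe_le_coe.2 (le_top : (2:ℕ∞) ≤ ⊤)))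
  unfold curvIntE at hcurv
  simp_rw [gauss_exp] at hcurv
  rw [Measure.restrict_univ] at hcurv
  have hi : Integrable (lap v) := by
    refine ⟨hc.aestronglyMeasurable, ?_⟩
    rw [hasFiniteIntegral_iff_norm]
    exact lt_of_le_of_lt hcurv ENNReal.ofReal_lt_top
  obtain ⟨F, hF, hr⟩ := repr_glob v hv hi
  have hFc := F_const v hv.continuous _ hc hi F hF hr hcomp
  have hve : v = fun x => (F 0).re + Np (lap v) x := by
    ext x; rw [hr x, hFc x, add_comm]
  refine ⟨lap v, (F 0).re, hc, hi, int_le_of_lint _ (fun _ => abs_nonneg _) _ hΛ.le hcurv, ?_, ?_, ?_⟩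
  · rw [← hve]; exact hv.of_le (WithTop.coe_le_coe.2 (le_top : (1:ℕ∞) ≤ ⊤))
  · rw [← hve]; exact he.symm
  · intro x hx
    exact lap_congr (he.eventuallyEq_of_mem (isOpen_ball.mem_nhds hx))

lemma c_bound (Λ Λ₂ : ℝ) : ∃ M : ℝ, ∀ (ω : ℂ → ℝ) (c : ℝ), Continuous ω → Integrable ω → ∫ y, |ω y| ≤ Λ →
    Continuous (Np ω) → ∫⁻ x in ball (0:ℂ) 1, ENNReal.ofReal (Real.exp (2 * (c + Np ω x))) ≤ ENNReal.ofReal Λ₂ → c ≤ M := by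
  obtain ⟨C, hC, h⟩ := GG_L1 Λ
  set v := volume (ball (0:ℂ) 1) with hv
  have hvf : v ≠ ⊤ := measure_ball_lt_top.ne
  have hv0 : v ≠ 0 := (measure_ball_pos volume _ one_pos).ne'
  refine ⟨((ENNReal.ofReal Λ₂ + 2 * ENNReal.ofReal C) / v).toReal / 2, fun ω c hc hi hω hN hA => ?_⟩
  have key : ENNReal.ofReal (2 * c) * v ≤ ENNReal.ofReal Λ₂ + 2 * ENNReal.ofReal C := by
    calc _ = ∫⁻ x in ball (0:ℂ) 1, ENNReal.ofReal (2 * c) := by rw [setLIntegral_const]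
      _ ≤ ∫⁻ x in ball (0:ℂ) 1, (ENNReal.ofReal (Real.exp (2 * (c + Np ω x))) + 2 * ENNReal.ofReal (GG ω x)) := by
          refine setLIntegral_mono' measurableSet_ball fun x hx => ?_
          rw [← ENNReal.ofReal_ofNat, ← ENNReal.ofReal_mul (by norm_num), ← ENNReal.ofReal_add (Real.exp_nonneg _) (by have := GG_nonneg ω x; positivity)]
          apply ENNReal.ofReal_le_ofReal
          have h1 := Real.add_one_le_exp (2 * (c + Np ω x))
          have h2 := Np_abs x (mem_ball_zero_iff.1 hx).le ω hc hi
          have h3 := neg_abs_le (Np ω x)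
          linarith
      _ = (∫⁻ x in ball (0:ℂ) 1, ENNReal.ofReal (Real.exp (2 * (c + Np ω x)))) + 2 * ∫⁻ x in ball (0:ℂ) 1, ENNReal.ofReal (GG ω x) := by
          rw [lintegral_add_left (by fun_prop : Continuous fun x => Real.exp (2 * (c + Np ω x))).measurable.ennreal_ofReal,
            lintegral_const_mul' _ _ (by norm_num)]
      _ ≤ _ := by gcongr; exact h ω hc hi hω
  have h2 : ENNReal.ofReal (2 * c) ≤ (ENNReal.ofReal Λ₂ + 2 * ENNReal.ofReal C) / v :=
    (ENNReal.le_div_iff_mul_le (Or.inl hv0) (Or.inl hvf)).2 key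
  have h3 := (ENNReal.ofReal_le_iff_le_toReal (ENNReal.div_ne_top (by finiteness) hv0)).1 h2
  linarith

/-- dichotomy (convergence versus collapsing) for a sequence of conformal
metrics with small total curvature, complete extension and bounded area. -/
theorem statement3 (Λ Λ₂ : ℝ) (hΛ : 0 < Λ) (hΛ₂ : 0 < Λ₂) :
    ∃ ε₀ : ℝ, 0 < ε₀ ∧
      ∀ τ : ℝ, 0 < τ → τ ≤ ε₀ →
        ∀ u : ℕ → ℂ → ℝ,
          (∀ k, ContDiffOn ℝ (⊤ : ℕ∞) (u k) (ball (0:ℂ) 1)) →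
          (∀ k, ExtendsComplete (u k) Λ) →
          (∀ k, curvIntE (u k) (ball (0:ℂ) 1) < ENNReal.ofReal τ) →
          (∀ k, confAreaE (u k) (ball (0:ℂ) 1) < ENNReal.ofReal Λ₂) →
          ∃ φ : ℕ → ℕ, StrictMono φ ∧
            -- `e^{u_k}` converges in `L^q(D_r)` for every `q < 4π/τ`
            (∃ w : ℂ → ℝ, ∀ r : ℝ, 0 < r → r < 1 → ∀ q : ℝ, 1 ≤ q → q < 4 * Real.pi / τ →
              Tendsto (fun k => ∫ x in ball (0:ℂ) r, |Real.exp (u (φ k) x) - w x| ^ q)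
                atTop (𝓝 0)) ∧
            ∀ r : ℝ, 0 < r → r < 1 → ∀ p : ℝ, 1 < p → p < 2 →
              -- (a) `u_k` converges weakly in `W^{1,p}(D_r)`, or
              ((∃ u₀ : ℂ → ℝ, WeakW1pLim (ball (0:ℂ) r) p (fun k => u (φ k)) u₀) ∨
               -- (b) collapse: `e^{u_k} → 0` in `L^q`, areas and diameters go to `0`,
               -- and `u_k - c_k` converges weakly for suitable constants `c_k`
               ((∀ q : ℝ, 1 ≤ q → q < 4 * Real.pi / τ →
                   Tendsto (fun k => ∫ x in ball (0:ℂ) r, Real.exp (u (φ k) x) ^ q)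
                     atTop (𝓝 0)) ∧
                Tendsto (fun k => confAreaE (u (φ k)) (ball (0:ℂ) r)) atTop (𝓝 0) ∧
                (∀ ε : ℝ, 0 < ε → ∀ᶠ k in atTop,
                  ∀ x ∈ ball (0:ℂ) r, ∀ y ∈ ball (0:ℂ) r,
                    confDist (u (φ k)) (ball (0:ℂ) r) x y < ε) ∧
                (∃ c : ℕ → ℝ, ∃ u₀ : ℂ → ℝ,
                  WeakW1pLim (ball (0:ℂ) r) p (fun k x => u (φ k) x - c k) u₀))) := by
  refine ⟨1, one_pos, fun τ hτ0 hτ1 u hu hext hcurv harea => ?_⟩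
  choose ω c hωc hωi hωΛ hgd hue hlap using fun k => extr (u k) Λ hΛ (hext k)
  have hN : ∀ k, Continuous (Np (ω k)) := fun k => by
    have h1 := (hgd k).continuous.sub (continuous_const (y := c k))
    refine h1.congr fun x => ?_
    simp
  have hωτ : ∀ k, ∫ y in ball (0:ℂ) 1, |ω k y| ≤ τ := fun k => by
    apply int_le_of_lint _ (fun _ => abs_nonneg _) _ hτ0.le
    have h1 := (hcurv k).le
    unfold curvIntE at h1
    simp_rw [gauss_exp] at h1
    refine le_trans (le_of_eq ?_) h1
    exact setLIntegral_congr_fun measurableSet_ball fun x hx => by simp only [hlap k x hx]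
  obtain ⟨M, hM⟩ := c_bound Λ Λ₂
  have hcM : ∀ k, c k ≤ M := fun k => by
    apply hM (ω k) (c k) (hωc k) (hωi k) (hωΛ k) (hN k)
    refine le_trans (le_of_eq ?_) (harea k).le
    exact setLIntegral_congr_fun measurableSet_ball fun x hx => by simp only [hue k hx]
  obtain ⟨a, -, φ₁, hφ₁, ha⟩ := (isCompact_Icc (a := (0:ℝ)) (b := Real.exp M)).tendsto_subseq
    (x := fun k => Real.exp (c k)) fun k => ⟨Real.exp_nonneg _, Real.exp_le_exp.2 (hcM k)⟩
  obtain ⟨φ₂, hφ₂, N, hNm, hNi, hlim, hae⟩ := compact_L1 Λ (fun k => ω (φ₁ k)) (fun k => hωc _) (fun k => hωi _)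
    (fun k => hωΛ _) (fun k => hN _)
  have ha2 : Tendsto (fun k => Real.exp (c (φ₁ (φ₂ k)))) atTop (𝓝 a) := ha.comp hφ₂.tendsto_atTop
  have ha0 : 0 ≤ a := ge_of_tendsto' ha2 fun k => (Real.exp_pos _).le
  have hLq : ∀ r : ℝ, r < 1 → ∀ q : ℝ, 1 ≤ q → q < 4 * Real.pi / τ →
      Tendsto (fun k => ∫ x in ball (0:ℂ) r, |Real.exp (u (φ₁ (φ₂ k)) x) - a * Real.exp (N x)| ^ q) atTop (𝓝 0) := by
    intro r hr1 q hq hqτ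
    have h1 := Lq_conv Λ τ hτ0 (fun k => ω (φ₁ (φ₂ k))) (fun k => hωc _) (fun k => hωi _) (fun k => hωΛ _) (fun k => hωτ _)
      (fun k => hN _) N hNm hae (fun k => c (φ₁ (φ₂ k))) M (fun k => hcM _) a ha2 r hr1 q hq hqτ
    refine h1.congr fun k => ?_
    exact setIntegral_congr_fun measurableSet_ball fun x hx => by
      simp only [hue (φ₁ (φ₂ k)) (ball_subset_ball hr1.le hx)]
  refine ⟨fun k => φ₁ (φ₂ k), hφ₁.comp hφ₂, ⟨fun x => a * Real.exp (N x), fun r hr0 hr1 q hq hqτ => hLq r hr1 q hq hqτ⟩, ?_⟩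
  intro r hr0 hr1 p hp hp2
  rcases ha0.lt_or_eq with hapos | hazero
  · left
    refine ⟨_, weak_lim Λ (fun k => ω (φ₁ (φ₂ k))) (fun k => hωc _) (fun k => hωi _) (fun k => hωΛ _) N hNi hlim
      (fun k => c (φ₁ (φ₂ k))) (Real.log a) ?_ (fun k => hgd _) _ (fun k => hue _) r hr1 p hp hp2⟩
    have := (Real.continuousAt_log hapos.ne').tendsto.comp ha2
    refine this.congr fun k => ?_
    simp
  · right
    have hq0 : ∀ q : ℝ, 1 ≤ q → q < 4 * Real.pi / τ →
        Tendsto (fun k => ∫ x in ball (0:ℂ) r, Real.exp (u (φ₁ (φ₂ k)) x) ^ q) atTop (𝓝 0) := by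
      intro q hq hqτ
      refine (hLq r hr1 q hq hqτ).congr fun k => ?_
      rw [← hazero]
      simp only [zero_mul, sub_zero, abs_of_pos (Real.exp_pos _)]
    refine ⟨hq0, ?_, ?_, ?_⟩
    · have h2 := hq0 2 (by norm_num) (by
        rw [lt_div_iff₀ hτ0]; nlinarith [Real.pi_gt_three])
      have h3 := (ENNReal.continuous_ofReal.tendsto 0).comp h2
      rw [ENNReal.ofReal_zero] at h3
      refine h3.congr fun k => ?_
      unfold confAreaE
      have hcont : Continuous (fun x => Real.exp (2 * (c (φ₁ (φ₂ k)) + Np (ω (φ₁ (φ₂ k))) x))) := by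
        have := hN (φ₁ (φ₂ k)); fun_prop
      have hint : IntegrableOn (fun x => Real.exp (2 * (c (φ₁ (φ₂ k)) + Np (ω (φ₁ (φ₂ k))) x))) (ball (0:ℂ) r) :=
        (hcont.continuousOn.integrableOn_compact (isCompact_closedBall (0:ℂ) r)).mono_set ball_subset_closedBall
      have e1 : ∫ x in ball (0:ℂ) r, Real.exp (u (φ₁ (φ₂ k)) x) ^ (2:ℝ) =
          ∫ x in ball (0:ℂ) r, Real.exp (2 * (c (φ₁ (φ₂ k)) + Np (ω (φ₁ (φ₂ k))) x)) :=
        setIntegral_congr_fun measurableSet_ball fun x hx => by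
          simp only [hue (φ₁ (φ₂ k)) (ball_subset_ball hr1.le hx)]
          rw [← Real.exp_mul, mul_comm]
      have e2 : ∫⁻ x in ball (0:ℂ) r, ENNReal.ofReal (Real.exp (2 * u (φ₁ (φ₂ k)) x)) =
          ∫⁻ x in ball (0:ℂ) r, ENNReal.ofReal (Real.exp (2 * (c (φ₁ (φ₂ k)) + Np (ω (φ₁ (φ₂ k))) x))) :=
        setLIntegral_congr_fun measurableSet_ball fun x hx => by
          simp only [hue (φ₁ (φ₂ k)) (ball_subset_ball hr1.le hx)]
      simp only [Function.comp]
      rw [e1, e2]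
      exact ofReal_integral_eq_lintegral_ofReal hint (Eventually.of_forall fun _ => Real.exp_nonneg _)
    · intro ε hε
      obtain ⟨C, hC, hd⟩ := dist_bound Λ r τ hr0 hr1 hτ1
      have h1 : Tendsto (fun k => Real.exp (c (φ₁ (φ₂ k))) * C) atTop (𝓝 0) := by
        have := ha2.mul_const C
        rwa [← hazero, zero_mul] at this
      filter_upwards [h1.eventually_lt_const hε] with k hk x hx y hy
      exact (hd _ (hωc _) (hωi _) (hωΛ _) (hωτ _) (hN _) _ _ (hue _) x hx y hy).trans_lt hk
    · refine ⟨fun k => c (φ₁ (φ₂ k)), _, weak_lim Λ (fun k => ω (φ₁ (φ₂ k))) (fun k => hωc _) (fun k => hωi _) (fun k => hωΛ _) N hNi hlim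
        (fun _ => 0) 0 tendsto_const_nhds (fun k => ?_) _ (fun k x hx => ?_) r hr1 p hp hp2⟩
      · have := (hgd (φ₁ (φ₂ k))).sub (contDiff_const (c := c (φ₁ (φ₂ k))))
        convert this using 2
        simp
      · simp only [hue (φ₁ (φ₂ k)) hx]; ring
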